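/- arXiv:0903.1626 — 4 statements merged into one kernel-verified Lean document; each statement's English description precedes it below -/
import Mathlib

section
/- For every countable field K there exists an associative K-algebra A such that A contains no free noncommutative K-subalgebra of rank two, while the polynomial ring A[x] in one central commuting indeterminate x over A does contain a free noncommutative K-subalgebra of rank two. -/
/-- A (possibly non-unital) associative `K`-algebra `B` contains a free noncommutative
`K`-subalgebra of rank two: there are `a b : B` such that the family of all evaluations at
`(a, b)` of the nonempty words in two letters is `K`-linearly independent, i.e. the unique
`K`-algebra homomorphism from the free associative `K`-algebra without unit on two generators
sending the generators to `a` and `b` is injective. -/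
def HasFreeRankTwo (K B : Type) [Field K] [NonUnitalSemiring B] [Module K B] : Prop :=
  ∃ a b : B, LinearIndependent K
    (fun w : FreeSemigroup (Fin 2) =>
      (FreeSemigroup.lift (fun i : Fin 2 => if i = 0 then a else b) w : B))

theorem FreeSemigroup.lift_eq_prod {α M : Type} [Monoid M] (f : α → M) (w : FreeSemigroup α) :
    FreeSemigroup.lift f w = ((w.head :: w.tail).map f).prod := by
  induction w with
  | ih1 x => simp
  | ih2 x y _ ih => rw [map_mul, ih]; simp

theorem FreeSemigroup.map_lift {α M N F : Type} [Semigroup M] [Semigroup N] [FunLike F M N]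
    [MulHomClass F M N] (φ : F) (f : α → M) (w : FreeSemigroup α) :
    φ (FreeSemigroup.lift f w) = FreeSemigroup.lift (fun i => φ (f i)) w := by
  induction w with
  | ih1 x => simp
  | ih2 x y _ ih => rw [map_mul, map_mul, map_mul, ih]; simp

namespace FreeAlgebra

section Functionals

variable (K : Type) {X : Type} [Field K]

/-- The monomial of the free algebra given by a word. -/
noncomputable def word (z : List X) : FreeAlgebra K X := (z.map (ι K)).prod

variable {K}

theorem word_append (z z' : List X) : word K (z ++ z') = word K z * word K z' := by
  simp [word]

theorem word_nil : word K ([] : List X) = 1 := by simp [word]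

theorem basisFreeMonoid_eq_word (z : List X) :
    basisFreeMonoid K X (FreeMonoid.ofList z) = word K z := by
  rw [basisFreeMonoid, Module.Basis.map_apply, Finsupp.coe_basisSingleOne]
  change equivMonoidAlgebraFreeMonoid.symm (MonoidAlgebra.single (FreeMonoid.ofList z) 1) = _
  simp [equivMonoidAlgebraFreeMonoid, word, FreeMonoid.lift_apply]

/-- The linear functional on the free algebra with prescribed values on words. -/
noncomputable def ev : (List X → K) →ₗ[K] FreeAlgebra K X →ₗ[K] K :=
  ((basisFreeMonoid K X).constr K).toLinearMap

@[simp]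
theorem ev_word (τ : List X → K) (z : List X) : ev τ (word K z) = τ z := by
  rw [← basisFreeMonoid_eq_word]
  exact (basisFreeMonoid K X).constr_basis K τ _

theorem span_range_word : Submodule.span K (Set.range (word K : List X → FreeAlgebra K X)) = ⊤ := by
  rw [← (basisFreeMonoid K X).span_eq]
  congr 1
  ext x
  simp only [Set.mem_range, ← basisFreeMonoid_eq_word]
  exact Iff.rfl

theorem hom_ext_word {M : Type} [AddCommMonoid M] [Module K M] {f g : FreeAlgebra K X →ₗ[K] M}
    (h : ∀ z, f (word K z) = g (word K z)) : f = g :=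
  LinearMap.ext_on_range span_range_word h

/-- The span of the words whose length lies between `1` and `D`. -/
noncomputable def shortSpan (K X : Type) [Field K] (D : ℕ) : Submodule K (FreeAlgebra K X) :=
  Submodule.span K (word K '' {g | 1 ≤ g.length ∧ g.length ≤ D})

theorem eq_zero_of_mem_shortSpan {M : Type} [AddCommMonoid M] [Module K M] {D : ℕ}
    {u : FreeAlgebra K X} (hu : u ∈ shortSpan K X D) (f : FreeAlgebra K X →ₗ[K] M)
    (h : ∀ g : List X, 1 ≤ g.length → g.length ≤ D → f (word K g) = 0) : f u = 0 := by
  have : shortSpan K X D ≤ LinearMap.ker f := by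
    refine Submodule.span_le.2 ?_
    rintro _ ⟨g, hg, rfl⟩
    exact h g hg.1 hg.2
  exact this hu

/-- The functional `τ` vanishes on words of length different from `n`. -/
def IsSupportedOnLength (n : ℕ) (τ : List X → K) : Prop := ∀ z, z.length ≠ n → τ z = 0

/-- The concatenation product of `σ`, read on the first `a` letters, and `ρ`, read on the rest. -/
def tens (a : ℕ) (σ ρ : List X → K) : List X → K := fun z => σ (z.take a) * ρ (z.drop a)

theorem isSupportedOnLength_tens {a c : ℕ} {σ ρ : List X → K} (hσ : IsSupportedOnLength a σ)
    (hρ : IsSupportedOnLength c ρ) : IsSupportedOnLength (a + c) (tens a σ ρ) := by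
  intro z hz
  by_cases h : z.length < a
  · rw [tens, hσ _ (by simp; omega), zero_mul]
  · rw [tens, hρ _ (by simp; omega), mul_zero]

theorem ev_expand_left {D : ℕ} {u : FreeAlgebra K X} (hu : u ∈ shortSpan K X D) (τ : List X → K)
    (p : List X) (t : ℕ) (y : FreeAlgebra K X)
    (h : ∀ g : List X, 1 ≤ g.length → g.length ≤ D → ev τ (word K (p ++ g) * u ^ t * y) = 0) :
    ev τ (word K p * u ^ (t + 1) * y) = 0 := by
  have := eq_zero_of_mem_shortSpan hu
    (ev τ ∘ₗ LinearMap.mulLeft K (word K p) ∘ₗ LinearMap.mulRight K (u ^ t * y))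
    (fun g h1 h2 => by simpa [word_append, mul_assoc] using h g h1 h2)
  simpa [pow_succ', mul_assoc] using this

theorem ev_expand_right {D : ℕ} {u : FreeAlgebra K X} (hu : u ∈ shortSpan K X D) (τ : List X → K)
    (x : FreeAlgebra K X) (t : ℕ) (q : List X)
    (h : ∀ g : List X, 1 ≤ g.length → g.length ≤ D → ev τ (x * u ^ t * word K (g ++ q)) = 0) :
    ev τ (x * u ^ (t + 1) * word K q) = 0 := by
  have := eq_zero_of_mem_shortSpan hu
    (ev τ ∘ₗ LinearMap.mulLeft K (x * u ^ t) ∘ₗ LinearMap.mulRight K (word K q))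
    (fun g h1 h2 => by simpa [word_append, mul_assoc] using h g h1 h2)
  simpa [pow_succ, mul_assoc] using this

theorem ev_eq_zero_of_length_lt {D n : ℕ} {u : FreeAlgebra K X} (hu : u ∈ shortSpan K X D)
    {τ : List X → K} (hτ : IsSupportedOnLength n τ) (p q : List X) (t : ℕ)
    (h : n < p.length + t + q.length) : ev τ (word K p * u ^ t * word K q) = 0 := by
  induction t generalizing p with
  | zero =>
    rw [pow_zero, mul_one, ← word_append, ev_word]
    exact hτ _ (by simp; omega)
  | succ t ih =>
    exact ev_expand_left hu _ _ _ _ fun g h1 _ => ih _ (by simp; omega)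

theorem ev_tens_word_mul {a : ℕ} (σ ρ : List X → K) {p : List X} (hp : p.length = a)
    (x : FreeAlgebra K X) : ev (tens a σ ρ) (word K p * x) = σ p * ev ρ x := by
  have : ev (tens a σ ρ) ∘ₗ LinearMap.mulLeft K (word K p) = σ p • ev ρ := by
    refine hom_ext_word fun z => ?_
    subst hp
    simp [← word_append, tens]
  simpa using LinearMap.congr_fun this x

theorem ev_tens_mul_word {a c : ℕ} {σ ρ : List X → K} (hσ : IsSupportedOnLength a σ)
    (hρ : IsSupportedOnLength c ρ) {q : List X} (hq : q.length = c)
    (x : FreeAlgebra K X) : ev (tens a σ ρ) (x * word K q) = ev σ x * ρ q := by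
  have : ev (tens a σ ρ) ∘ₗ LinearMap.mulRight K (word K q) = ρ q • ev σ := by
    refine hom_ext_word fun z => ?_
    simp only [LinearMap.comp_apply, LinearMap.mulRight_apply, ← word_append, ev_word,
      LinearMap.smul_apply, smul_eq_mul]
    by_cases h : z.length = a
    · subst h
      simp [tens, mul_comm]
    · rw [hσ z h, mul_zero]
      exact isSupportedOnLength_tens hσ hρ _ (by simp; omega)
  simpa [mul_comm] using LinearMap.congr_fun this x

/-- The functional `τ` kills every product `p * u ^ t * q` for words `p`, `q` of length at most
`A`, `B`. -/
def Kills (u : FreeAlgebra K X) (A B : ℕ) (τ : List X → K) : Prop :=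
  ∀ (p q : List X) (t : ℕ), p.length ≤ A → q.length ≤ B → ev τ (word K p * u ^ t * word K q) = 0

theorem Kills.tens_right {D m c A B : ℕ} {u : FreeAlgebra K X} (hu : u ∈ shortSpan K X D)
    {σ ρ : List X → K} (hσ : IsSupportedOnLength m σ) (hρ : IsSupportedOnLength c ρ)
    (hA : A ≤ m) (hB : D ≤ B) (h : Kills u A B σ) : Kills u A (B + c) (tens m σ ρ) := by
  intro p q t hp hq
  induction t generalizing q with
  | zero =>
    by_cases hqc : q.length < c
    · rw [pow_zero, mul_one, ← word_append, ev_word]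
      exact isSupportedOnLength_tens hσ hρ _ (by simp; omega)
    · rw [← List.take_append_drop (q.length - c) q, word_append, ← mul_assoc,
        ev_tens_mul_word hσ hρ (by simp; omega), h _ _ _ hp (by simp; omega), zero_mul]
  | succ t ih =>
    by_cases hqc : q.length < c
    · exact ev_expand_right hu _ _ _ _ fun g _ h2 => ih _ (by simp; omega)
    · rw [← List.take_append_drop (q.length - c) q, word_append, ← mul_assoc,
        ev_tens_mul_word hσ hρ (by simp; omega), h _ _ _ hp (by simp; omega), zero_mul]

theorem Kills.tens_left {D m c A B : ℕ} {u : FreeAlgebra K X} (hu : u ∈ shortSpan K X D)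
    {σ ρ : List X → K} (hσ : IsSupportedOnLength m σ) (hρ : IsSupportedOnLength c ρ)
    (hB : B ≤ c) (hA : D ≤ A) (h : Kills u A B ρ) : Kills u (A + m) B (tens m σ ρ) := by
  intro p q t hp hq
  have split : ∀ (p : List X) (t : ℕ), p.length ≤ A + m → ¬ p.length < m →
      ev (tens m σ ρ) (word K p * u ^ t * word K q) = 0 := by
    intro p t hp hpm
    rw [← List.take_append_drop m p, word_append, mul_assoc, mul_assoc,
      ev_tens_word_mul _ _ (by simp; omega), ← mul_assoc, h _ _ _ (by simp; omega) hq, mul_zero]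
  induction t generalizing p with
  | zero =>
    by_cases hpm : p.length < m
    · rw [pow_zero, mul_one, ← word_append, ev_word]
      exact isSupportedOnLength_tens hσ hρ _ (by simp; omega)
    · exact split p 0 hp hpm
  | succ t ih =>
    by_cases hpm : p.length < m
    · exact ev_expand_left hu _ _ _ _ fun g _ h2 => ih _ (by simp; omega)
    · exact split p _ hp hpm

theorem Kills.mono {A B A' B' : ℕ} {u : FreeAlgebra K X} {τ : List X → K} (h : Kills u A B τ)
    (hA : A' ≤ A) (hB : B' ≤ B) : Kills u A' B' τ :=
  fun p q t hp hq => h p q t (hp.trans hA) (hq.trans hB)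

/-- A functional of length `L`, divided into blocks of length `l`, such that no chain of factors
`u` crosses a whole block. -/
def Blocked (u : FreeAlgebra K X) (D l L : ℕ) (τ : List X → K) : Prop :=
  ∀ k m, L = (k + 1 + m) * l → Kills u (k * l + D) (m * l + D) τ

theorem Blocked.tens {D l L₁ L₂ : ℕ} {u : FreeAlgebra K X} (hu : u ∈ shortSpan K X D)
    {σ ρ : List X → K} (hσ : IsSupportedOnLength L₁ σ) (hρ : IsSupportedOnLength L₂ ρ)
    (hl : 0 < l) (hD : D ≤ l) (h₁ : l ∣ L₁) (h₂ : l ∣ L₂) (hbσ : Blocked u D l L₁ σ)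
    (hbρ : Blocked u D l L₂ ρ) : Blocked u D l (L₁ + L₂) (tens L₁ σ ρ) := by
  obtain ⟨n₁, rfl⟩ := h₁
  obtain ⟨n₂, rfl⟩ := h₂
  intro k m hkm
  have hn : n₁ + n₂ = k + 1 + m := by
    refine Nat.eq_of_mul_eq_mul_right hl ?_
    rw [← hkm]; ring
  by_cases hk : k < n₁
  · obtain ⟨j, rfl⟩ := Nat.exists_eq_add_of_lt hk
    have hm : m = j + n₂ := by omega
    subst hm
    refine (Kills.tens_right hu hσ hρ ?_ (Nat.le_add_left D (j * l))
      (hbσ k j (by ring))).mono le_rfl ?_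
    · nlinarith
    · apply le_of_eq; ring
  · obtain ⟨j, rfl⟩ := Nat.exists_eq_add_of_le (not_lt.1 hk)
    have hm : n₂ = j + 1 + m := by omega
    subst hm
    refine (Kills.tens_left hu hσ hρ ?_ (Nat.le_add_left D (j * l))
      (hbρ j m (by ring))).mono ?_ le_rfl
    · nlinarith
    · apply le_of_eq; ring

theorem Kills.sum_smul {ι : Type} (s : Finset ι) (c : ι → K) {u : FreeAlgebra K X} {A B : ℕ}
    {τ : ι → List X → K} (h : ∀ i ∈ s, Kills u A B (τ i)) : Kills u A B (∑ i ∈ s, c i • τ i) := by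
  intro p q t hp hq
  simp only [map_sum, map_smul, LinearMap.sum_apply, LinearMap.smul_apply]
  exact Finset.sum_eq_zero fun i hi => by rw [h i hi p q t hp hq, smul_zero]

theorem Blocked.ev_pow_eq_zero {D l L : ℕ} {u : FreeAlgebra K X} (hu : u ∈ shortSpan K X D)
    {τ : List X → K} (hτ : IsSupportedOnLength L τ) (hl : 0 < l) (hL : l ∣ L)
    (h : Blocked u D l L τ) (p q : List X) :
    ev τ (word K p * u ^ (2 * l) * word K q) = 0 := by
  rcases lt_or_ge L (p.length + 2 * l + q.length) with hlen | hlen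
  · exact ev_eq_zero_of_length_lt hu hτ _ _ _ hlen
  obtain ⟨n, rfl⟩ := hL
  obtain ⟨k, r, hr, hk⟩ : ∃ k r, r < l ∧ p.length = l * k + r :=
    ⟨p.length / l, p.length % l, Nat.mod_lt _ hl, (Nat.div_add_mod _ _).symm⟩
  have hkn : k + 2 ≤ n := by
    refine Nat.le_of_mul_le_mul_left (c := l) ?_ hl
    nlinarith
  obtain ⟨m, rfl⟩ := Nat.exists_eq_add_of_le hkn
  refine h (k + 1) m (by ring) p q _ ?_ ?_ <;> nlinarith

theorem Blocked.sum_smul {ι : Type} (s : Finset ι) (c : ι → K) {u : FreeAlgebra K X}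
    {D l L : ℕ} {τ : ι → List X → K} (h : ∀ i ∈ s, Blocked u D l L (τ i)) :
    Blocked u D l L (∑ i ∈ s, c i • τ i) :=
  fun k m hkm => Kills.sum_smul s c fun i hi => h i hi k m hkm

end Functionals

section Letters

open Polynomial

variable {K : Type} [Field K]

/-- The functional `τ` is supported on words with letters `w`, an index in `Fin 3` being attached
to each letter. -/
def IsSupportedOnLetters (w : List (Fin 2)) (τ : List (Fin 2 × Fin 3) → K) : Prop :=
  ∀ z, z.map Prod.fst ≠ w → τ z = 0

theorem IsSupportedOnLetters.length {w : List (Fin 2)} {τ : List (Fin 2 × Fin 3) → K}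
    (h : IsSupportedOnLetters w τ) : IsSupportedOnLength w.length τ :=
  fun z hz => h z fun hzw => hz (by simp [← hzw])

theorem IsSupportedOnLetters.tens {w₁ w₂ : List (Fin 2)} {σ ρ : List (Fin 2 × Fin 3) → K}
    (hσ : IsSupportedOnLetters w₁ σ) (hρ : IsSupportedOnLetters w₂ ρ) :
    IsSupportedOnLetters (w₁ ++ w₂) (tens w₁.length σ ρ) := by
  intro z hz
  by_cases h : (z.take w₁.length).map Prod.fst = w₁
  · rw [FreeAlgebra.tens, hρ _ fun h' => hz ?_, mul_zero]
    rw [← List.take_append_drop w₁.length z, List.map_append, h, h']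
  · rw [FreeAlgebra.tens, hσ _ h, zero_mul]

theorem IsSupportedOnLetters.sum_smul {ι : Type} (s : Finset ι) (c : ι → K) {w : List (Fin 2)}
    {τ : ι → List (Fin 2 × Fin 3) → K} (h : ∀ i ∈ s, IsSupportedOnLetters w (τ i)) :
    IsSupportedOnLetters w (∑ i ∈ s, c i • τ i) := by
  intro z hz
  simp only [Finset.sum_apply, Pi.smul_apply]
  exact Finset.sum_eq_zero fun i hi => by rw [h i hi z hz, smul_zero]

variable (K) in
/-- The weights `1`, `x`, `y` attached to the indices. -/
noncomputable def weight : Fin 3 → K[X][X] := ![1, C X, X]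

/-- The polynomial obtained from `τ` by summing over all ways of attaching indices to the letters
of the given word, each index contributing its weight. -/
noncomputable def symbol : List (Fin 2) → (List (Fin 2 × Fin 3) → K) →ₗ[K] K[X][X]
  | [] => Algebra.linearMap K K[X][X] ∘ₗ LinearMap.proj []
  | l :: w => ∑ s, LinearMap.mulLeft K (weight K s) ∘ₗ symbol w ∘ₗ
      LinearMap.funLeft K K (List.cons (l, s))

theorem symbol_nil (τ : List (Fin 2 × Fin 3) → K) : symbol [] τ = C (C (τ [])) := rfl

theorem symbol_cons (l : Fin 2) (w : List (Fin 2)) (τ : List (Fin 2 × Fin 3) → K) :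
    symbol (l :: w) τ = ∑ s, weight K s * symbol w (fun z => τ ((l, s) :: z)) := by
  rw [symbol, LinearMap.sum_apply]
  rfl

theorem symbol_tens (w₁ w₂ : List (Fin 2)) (σ ρ : List (Fin 2 × Fin 3) → K) :
    symbol (w₁ ++ w₂) (tens w₁.length σ ρ) = symbol w₁ σ * symbol w₂ ρ := by
  induction w₁ generalizing σ with
  | nil =>
    have : tens 0 σ ρ = σ [] • ρ := by ext; simp [tens]
    simp only [List.nil_append, List.length_nil, this, map_smul, symbol_nil]
    rw [Algebra.smul_def]; rfl
  | cons l w ih =>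
    simp only [List.cons_append, symbol_cons, Finset.sum_mul, mul_assoc, ← ih]
    rfl

/-- Products of `L`-letter blocks, one for each index in the list. -/
def chain (L : ℕ) (B : List (Fin 2) → Fin 3 → List (Fin 2 × Fin 3) → K) :
    List (Fin 2) → List (Fin 3) → List (Fin 2 × Fin 3) → K
  | _, [] => fun z => if z = [] then 1 else 0
  | w, s :: h => tens L (B (w.take L) s) (chain L B (w.drop L) h)

theorem isSupportedOnLetters_chain {L : ℕ}
    {B : List (Fin 2) → Fin 3 → List (Fin 2 × Fin 3) → K}
    (hB : ∀ w s, w.length = L → IsSupportedOnLetters w (B w s)) (w : List (Fin 2))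
    (h : List (Fin 3)) (hw : w.length = h.length * L) :
    IsSupportedOnLetters w (chain L B w h) := by
  induction h generalizing w with
  | nil =>
    have hw : w = [] := by simpa using hw
    subst hw
    intro z hz
    simp only [chain]
    rw [if_neg]
    rintro rfl
    simp at hz
  | cons s h ih =>
    have hw' : w.length = h.length * L + L := by rw [hw, List.length_cons]; ring
    have htake : (w.take L).length = L := by simp; omega
    have := (hB (w.take L) s htake).tens (ih (w.drop L) (by simp; omega))
    rwa [List.take_append_drop, htake] at this

theorem exists_symbol_chain {L : ℕ} {B : List (Fin 2) → Fin 3 → List (Fin 2 × Fin 3) → K}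
    (hB : ∀ w, w.length = L → ∃ m ≠ 0, ∀ s, symbol w (B w s) = m * weight K s) (n : ℕ)
    (w : List (Fin 2)) (hw : w.length = n * L) :
    ∃ M ≠ 0, ∀ h : List (Fin 3), h.length = n →
      symbol w (chain L B w h) = M * (h.map (weight K)).prod := by
  induction n generalizing w with
  | zero =>
    have hw : w = [] := by simpa using hw
    subst hw
    refine ⟨1, one_ne_zero, fun h hh => ?_⟩
    rw [List.length_eq_zero_iff] at hh
    subst hh
    simp [chain, symbol_nil]
  | succ n ih =>
    have hw' : w.length = n * L + L := by rw [hw]; ring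
    have htake : (w.take L).length = L := by simp; omega
    obtain ⟨m, hm, hmB⟩ := hB (w.take L) htake
    obtain ⟨M, hM, hMB⟩ := ih (w.drop L) (by simp; omega)
    refine ⟨m * M, mul_ne_zero hm hM, fun h hh => ?_⟩
    obtain ⟨s, h, rfl⟩ := List.exists_cons_of_length_eq_add_one hh
    have := symbol_tens (w.take L) (w.drop L) (B (w.take L) s) (chain L B (w.drop L) h)
    rw [List.take_append_drop, htake, hmB, hMB h (by simpa using hh)] at this
    rw [chain, this, List.map_cons, List.prod_cons]
    ring

theorem blocked_chain {D l L : ℕ} {u : FreeAlgebra K (Fin 2 × Fin 3)}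
    (hu : u ∈ shortSpan K (Fin 2 × Fin 3) D) (hl : 0 < l) (hD : D ≤ l) (hL : l ∣ L)
    {B : List (Fin 2) → Fin 3 → List (Fin 2 × Fin 3) → K}
    (hB : ∀ w s, w.length = L → IsSupportedOnLetters w (B w s))
    (hbB : ∀ w s, w.length = L → Blocked u D l L (B w s)) (w : List (Fin 2))
    (h : List (Fin 3)) (hw : w.length = h.length * L) :
    Blocked u D l w.length (chain L B w h) := by
  induction h generalizing w with
  | nil =>
    intro k m hkm
    have : 0 < (k + 1 + m) * l := by positivity
    simp at hw
    simp [hw] at hkm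
    omega
  | cons s h ih =>
    have hw' : w.length = h.length * L + L := by rw [hw, List.length_cons]; ring
    have htake : (w.take L).length = L := by simp; omega
    have hdrop : (w.drop L).length = h.length * L := by simp; omega
    have hσ := (hB (w.take L) s htake).length
    rw [htake] at hσ
    have := Blocked.tens hu hσ
      (isSupportedOnLetters_chain hB (w.drop L) h hdrop).length hl hD hL
      (hdrop ▸ hL.mul_left _) (hbB _ s htake) (ih _ hdrop)
    rwa [hdrop, add_comm L, ← hw'] at this

end Letters

section Levels

open Polynomial

variable {K : Type} [Field K]

/-- A family of functionals, indexed by the words of length `len` and by a further index,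
whose symbols are proportional to the weights. -/
structure Level (K : Type) [Field K] where
  len : ℕ
  block : List (Fin 2) → Fin 3 → List (Fin 2 × Fin 3) → K
  len_pos : 0 < len
  supp : ∀ w s, w.length = len → IsSupportedOnLetters w (block w s)
  exists_symbol : ∀ w, w.length = len → ∃ m ≠ 0, ∀ s, symbol w (block w s) = m * weight K s

/-- All functionals of the level are blocked for `u`, with blocks of length `l`. -/
def Level.Controls (S : Level K) (u : FreeAlgebra K (Fin 2 × Fin 3)) (D l : ℕ) : Prop :=
  u ∈ shortSpan K (Fin 2 × Fin 3) D ∧ 0 < l ∧ D ≤ l ∧ l ∣ S.len ∧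
    ∀ w s, w.length = S.len → Blocked u D l S.len (S.block w s)

/-- The level of words of length one. -/
def Level.base (K : Type) [Field K] : Level K where
  len := 1
  block w s z := open Classical in if z = w.map (fun l => (l, s)) then 1 else 0
  len_pos := one_pos
  supp w s _ z hz := if_neg fun h => hz (by simp [h, Function.comp_def])
  exists_symbol w hw := by
    obtain ⟨l, rfl⟩ := List.length_eq_one_iff.1 hw
    refine ⟨1, one_ne_zero, fun s => ?_⟩
    rw [symbol_cons, Finset.sum_eq_single s]
    · simp [symbol_nil]
    · intro s' _ hs
      simp [symbol_nil, hs]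
    · simp

/-- The index list with `i` indices `1` and `j` indices `2`, of length `2 * r`. -/
def indexList (r : ℕ) (e : Fin r × Fin r) : List (Fin 3) :=
  (List.replicate e.1 1 ++ List.replicate (r - e.1) 0) ++
    (List.replicate e.2 2 ++ List.replicate (r - e.2) 0)

theorem length_indexList (r : ℕ) (e : Fin r × Fin r) : (indexList r e).length = 2 * r := by
  simp [indexList]; omega

theorem prod_weight_indexList (r : ℕ) (e : Fin r × Fin r) :
    ((indexList r e).map (weight K)).prod = C (X ^ (e.1 : ℕ)) * X ^ (e.2 : ℕ) := by
  simp [indexList, weight]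

theorem sum_smul_monomials_ne_zero {r : ℕ} {c : Fin r × Fin r → K} (hc : c ≠ 0) :
    ∑ e, c e • (C (X ^ (e.1 : ℕ)) * X ^ (e.2 : ℕ) : K[X][X]) ≠ 0 := by
  obtain ⟨e₀, he₀⟩ := Function.ne_iff.1 hc
  intro h
  apply he₀
  have := congrArg (fun P : K[X][X] => (P.coeff e₀.2).coeff e₀.1) h
  simp only [finsetSum_coeff, coeff_smul, coeff_C_mul_X_pow, coeff_zero] at this
  rw [Finset.sum_eq_single e₀] at this
  · simpa using this
  · intro e _ he
    split_ifs with h2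
    · rw [coeff_X_pow, if_neg, smul_zero]
      intro h1
      exact he (Prod.ext (Fin.ext h1.symm) (Fin.ext h2.symm))
    · simp
  · simp

instance finite_words_length_le (X : Type) [Finite X] (D : ℕ) :
    Finite {z : List X // z.length ≤ D} :=
  (List.finite_length_le X D).to_subtype

theorem Level.exists_kills (S : Level K) {u : FreeAlgebra K (Fin 2 × Fin 3)} {D r : ℕ}
    (hu : u ∈ shortSpan K (Fin 2 × Fin 3) D)
    (hr : Nat.card {z : List (Fin 2 × Fin 3) // z.length ≤ D} ^ 2 * (2 * r * S.len + 1) < r ^ 2)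
    (w : List (Fin 2)) (hw : w.length = 2 * r * S.len) :
    ∃ τ : List (Fin 2 × Fin 3) → K, IsSupportedOnLetters w τ ∧ symbol w τ ≠ 0 ∧ Kills u D D τ ∧
      ∀ v D' l, S.Controls v D' l → Blocked v D' l w.length τ := by
  classical
  have := Fintype.ofFinite {z : List (Fin 2 × Fin 3) // z.length ≤ D}
  let σ : Fin r × Fin r → List (Fin 2 × Fin 3) → K :=
    fun e => chain S.len S.block w (indexList r e)
  have hσ : ∀ e, w.length = (indexList r e).length * S.len := fun e => by
    rw [length_indexList, hw]
  let Φ : (Fin r × Fin r → K) →ₗ[K] ({z : List (Fin 2 × Fin 3) // z.length ≤ D} ×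
      {z : List (Fin 2 × Fin 3) // z.length ≤ D} × Fin (2 * r * S.len + 1) → K) :=
    LinearMap.pi fun i => ∑ e, ev (σ e) (word K i.1.1 * u ^ (i.2.2 : ℕ) * word K i.2.1.1) •
      LinearMap.proj e
  have hker : LinearMap.ker Φ ≠ ⊥ := by
    apply LinearMap.ker_ne_bot_of_finrank_lt
    simp only [Module.finrank_fintype_fun_eq_card, Fintype.card_prod, Fintype.card_fin]
    rw [← Nat.card_eq_fintype_card]
    nlinarith
  obtain ⟨c, hc, hc0⟩ := Submodule.exists_mem_ne_zero_of_ne_bot hker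
  have hsupp : IsSupportedOnLetters w (∑ e, c e • σ e) :=
    IsSupportedOnLetters.sum_smul _ _ fun e _ =>
      isSupportedOnLetters_chain S.supp w _ (hσ e)
  refine ⟨∑ e, c e • σ e, hsupp, ?_, ?_, ?_⟩
  · obtain ⟨M, hM, hMσ⟩ := exists_symbol_chain S.exists_symbol (2 * r) w hw
    simp only [map_sum, map_smul, σ, hMσ _ (length_indexList r _), prod_weight_indexList]
    have := mul_ne_zero hM (sum_smul_monomials_ne_zero hc0)
    simpa only [Finset.mul_sum, mul_smul_comm] using this
  · intro p q t hp hq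
    by_cases ht : t < 2 * r * S.len + 1
    · have := congrFun (LinearMap.mem_ker.1 hc) (⟨p, hp⟩, ⟨q, hq⟩, ⟨t, ht⟩)
      simpa [Φ, mul_comm] using this
    · exact ev_eq_zero_of_length_lt hu hsupp.length _ _ _ (by omega)
  · rintro v D' l ⟨hv, hl, hD', hlen, hb⟩
    exact Blocked.sum_smul _ _ fun e _ =>
      blocked_chain hv hl hD' hlen S.supp hb w _ (hσ e)

theorem Level.exists_next (S : Level K) {u : FreeAlgebra K (Fin 2 × Fin 3)} {D : ℕ}
    (hu : u ∈ shortSpan K (Fin 2 × Fin 3) D) :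
    ∃ S' : Level K, S.len < S'.len ∧ S'.Controls u D S'.len ∧
      ∀ v D' l, S.Controls v D' l → S'.Controls v D' l := by
  set N := Nat.card {z : List (Fin 2 × Fin 3) // z.length ≤ D}
  obtain ⟨r, hr, hDr⟩ : ∃ r, N ^ 2 * (2 * r * S.len + 1) < r ^ 2 ∧ D < r := by
    refine ⟨N ^ 2 * (2 * S.len + 1) + D + 1, ?_, by omega⟩
    set r := N ^ 2 * (2 * S.len + 1) + D + 1 with hr
    have h1 : 1 ≤ r := by omega
    have h2 : N ^ 2 * (2 * S.len + 1) < r := by omega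
    calc N ^ 2 * (2 * r * S.len + 1) ≤ N ^ 2 * (2 * r * S.len + r) := by gcongr
      _ = N ^ 2 * (2 * S.len + 1) * r := by ring
      _ < r * r := by gcongr
      _ = r ^ 2 := by ring
  choose! Y hYsupp hYsymb hYkill hYblock using S.exists_kills hu hr
  have hpos := S.len_pos
  set m := 2 * r * S.len with hm
  have hDm : D ≤ m := by nlinarith
  have htake : ∀ w : List (Fin 2), w.length = m + S.len → (w.take m).length = m := by
    intro w hw; simp; omega
  have hdrop : ∀ w : List (Fin 2), w.length = m + S.len → (w.drop m).length = S.len := by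
    intro w hw; simp; omega
  have hYlen : ∀ w, w.length = m → IsSupportedOnLength m (Y w) :=
    fun w hw => hw ▸ (hYsupp w hw).length
  have hSlen : ∀ w s, w.length = S.len → IsSupportedOnLength S.len (S.block w s) :=
    fun w s hw => by simpa [hw] using (S.supp w s hw).length
  refine ⟨⟨m + S.len, fun w s => tens m (Y (w.take m)) (S.block (w.drop m) s), by omega, ?_, ?_⟩,
    ?_, ⟨hu, ?_, ?_, dvd_rfl, ?_⟩, ?_⟩
  · intro w s hw
    have := (hYsupp _ (htake w hw)).tens (S.supp _ s (hdrop w hw))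
    rwa [List.take_append_drop, htake w hw] at this
  · intro w hw
    obtain ⟨M, hM, hMS⟩ := S.exists_symbol _ (hdrop w hw)
    refine ⟨symbol _ (Y (w.take m)) * M, mul_ne_zero (hYsymb _ (htake w hw)) hM, fun s => ?_⟩
    have := symbol_tens (w.take m) (w.drop m) (Y (w.take m)) (S.block (w.drop m) s)
    rw [List.take_append_drop, htake w hw, hMS, ← mul_assoc] at this
    exact this
  · change S.len < m + S.len
    nlinarith
  · change 0 < m + S.len
    omega
  · change D ≤ m + S.len
    omega
  · intro w s hw k j hkj
    refine (Kills.tens_right hu (hYlen _ (htake w hw)) (hSlen _ s (hdrop w hw)) hDm le_rfl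
      (hYkill _ (htake w hw))).mono ?_ ?_
    all_goals
      change m + S.len = (k + 1 + j) * (m + S.len) at hkj
      have : k + 1 + j = 1 := Nat.eq_of_mul_eq_mul_right (by omega : 0 < m + S.len) (by omega)
      obtain ⟨rfl, rfl⟩ : k = 0 ∧ j = 0 := by omega
      omega
  · rintro v D' l hS
    obtain ⟨hv, hl, hD', hlen, hb⟩ := id hS
    have hlm : l ∣ m := hlen.mul_left _
    refine ⟨hv, hl, hD', hlm.add hlen, fun w s hw => ?_⟩
    refine Blocked.tens hv (hYlen _ (htake w hw)) (hSlen _ s (hdrop w hw)) hl hD' hlm hlen ?_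
      (hb _ s (hdrop w hw))
    have := hYblock _ (htake w hw) v D' l hS
    rwa [htake w hw] at this

end Levels

section Quotient

open Polynomial

variable {K : Type} [Field K]

theorem Level.exists_seq (u : ℕ → FreeAlgebra K (Fin 2 × Fin 3)) (D : ℕ → ℕ)
    (hu : ∀ n, u n ∈ shortSpan K (Fin 2 × Fin 3) (D n)) :
    ∃ S : ℕ → Level K, (∀ n, (S n).len < (S (n + 1)).len) ∧
      ∀ n, ∀ k, n < k → (S k).Controls (u n) (D n) (S (n + 1)).len := by
  choose next hlt hnew hold using fun (n : ℕ) (S : Level K) => S.exists_next (hu n)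
  let S : ℕ → Level K := fun n => Nat.rec (Level.base K) next n
  refine ⟨S, fun n => hlt n (S n), fun n k hk => ?_⟩
  induction k, hk using Nat.le_induction with
  | base => exact hnew n (S n)
  | succ k _ ih => exact hold k (S k) _ _ _ ih

/-- The linear polynomial in two central variables with coefficients `g (l, 0)`, `g (l, 1)` and
`g (l, 2)`. -/
noncomputable def linearForm {Q : Type} [Semiring Q] (g : Fin 2 × Fin 3 → Q) (l : Fin 2) :
    Q[X][X] :=
  C (C (g (l, 0)) + C (g (l, 1)) * X) + C (C (g (l, 2))) * X

theorem ev_cons (τ : List (Fin 2 × Fin 3) → K) (a : Fin 2 × Fin 3)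
    (x : FreeAlgebra K (Fin 2 × Fin 3)) :
    ev (fun z => τ (a :: z)) x = ev τ (ι K a * x) := by
  have : ev (fun z => τ (a :: z)) = ev τ ∘ₗ LinearMap.mulLeft K (ι K a) := by
    refine hom_ext_word fun z => ?_
    have : ι K a * word K z = word K (a :: z) := by simp [word]
    simp [this]
  exact LinearMap.congr_fun this x

theorem ev_coeff_prod_linearForm (w : List (Fin 2)) (τ : List (Fin 2 × Fin 3) → K) (i j : ℕ) :
    ev τ (((w.map (linearForm (ι K))).prod.coeff j).coeff i) =
      ((symbol w τ).coeff j).coeff i := by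
  induction w generalizing τ i j with
  | nil =>
    have h : ev τ 1 = τ [] := by rw [← word_nil, ev_word]
    simp only [List.map_nil, List.prod_nil, symbol_nil, coeff_C, coeff_one]
    by_cases hj : j = 0 <;> by_cases hi : i = 0 <;> simp [hi, hj, h, coeff_one, coeff_C]
  | cons l w ih =>
    rw [List.map_cons, List.prod_cons, symbol_cons, linearForm]
    simp only [Fin.sum_univ_three, weight, add_mul, map_add, map_mul, mul_assoc, coeff_add,
      coeff_C_mul, Matrix.cons_val, one_mul]
    cases j <;> cases i <;> simp [coeff_X_mul, ← ih, ev_cons]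

theorem symbol_eq_zero_of_ne {w w' : List (Fin 2)} {τ : List (Fin 2 × Fin 3) → K}
    (hτ : IsSupportedOnLetters w τ) (h : w' ≠ w) : symbol w' τ = 0 := by
  induction w' generalizing w τ with
  | nil => simp [symbol_nil, hτ [] (by simpa using h)]
  | cons l w' ih =>
    rw [symbol_cons]
    refine Finset.sum_eq_zero fun s _ => ?_
    cases w with
    | nil =>
      have : (fun z => τ ((l, s) :: z)) = 0 := funext fun z => hτ _ (by simp)
      simp [this]
    | cons l₀ w =>
      by_cases hl : l = l₀
      · rw [ih (w := w) (fun z hz => hτ _ (by simp [hz])) (by simpa [hl] using h), mul_zero]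
      · have : (fun z => τ ((l, s) :: z)) = 0 := funext fun z => hτ _ (by simp [hl])
        simp [this]

/-- The largest two-sided ideal killed by the functionals of the given levels. -/
def levelIdeal (S : ℕ → Level K) : Ideal (FreeAlgebra K (Fin 2 × Fin 3)) where
  carrier := {r | ∀ n w s, w.length = (S n).len → ∀ x y, ev ((S n).block w s) (x * r * y) = 0}
  zero_mem' := by simp
  add_mem' := fun ha hb n w s hw x y => by
    rw [mul_add, add_mul, map_add, ha n w s hw, hb n w s hw, add_zero]
  smul_mem' := fun c a ha n w s hw x y => by
    rw [smul_eq_mul, ← mul_assoc, ha n w s hw]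

instance isTwoSided_levelIdeal (S : ℕ → Level K) : (levelIdeal S).IsTwoSided :=
  ⟨fun c ha n w s hw x y => by rw [← mul_assoc, mul_assoc, ha n w s hw]⟩

theorem shortSpan_mono {X : Type} {D D' : ℕ} (h : D ≤ D') : shortSpan K X D ≤ shortSpan K X D' :=
  Submodule.span_mono (Set.image_mono fun _ hg => ⟨hg.1, hg.2.trans h⟩)

theorem mul_mem_shortSpan {X : Type} {D D' : ℕ} {u v : FreeAlgebra K X} (hu : u ∈ shortSpan K X D)
    (hv : v ∈ shortSpan K X D') : u * v ∈ shortSpan K X (D + D') := by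
  have := Submodule.mul_mem_mul hu hv
  rw [shortSpan, shortSpan, Submodule.span_mul_span] at this
  refine Submodule.span_mono ?_ this
  rintro _ ⟨_, ⟨g, hg, rfl⟩, _, ⟨g', hg', rfl⟩, rfl⟩
  refine ⟨g ++ g', ?_, word_append g g'⟩
  simp only [Set.mem_ofPred_eq, List.length_append] at hg hg' ⊢
  omega

instance countable [Countable K] {X : Type} [Countable X] : Countable (FreeAlgebra K X) :=
  have : Countable (FreeMonoid X) := inferInstanceAs (Countable (List X))
  (basisFreeMonoid K X).repr.injective.countable

theorem pow_mem_levelIdeal {u : ℕ → FreeAlgebra K (Fin 2 × Fin 3)} {D : ℕ → ℕ} {S : ℕ → Level K}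
    (hu : ∀ n, u n ∈ shortSpan K (Fin 2 × Fin 3) (D n)) (hlen : StrictMono fun n => (S n).len)
    (hS : ∀ n, ∀ k, n < k → (S k).Controls (u n) (D n) (S (n + 1)).len) (n : ℕ) :
    u n ^ (2 * (S (n + 1)).len) ∈ levelIdeal S := by
  intro k w s hw
  have hsupp : IsSupportedOnLength (S k).len ((S k).block w s) :=
    fun z hz => ((S k).supp w s hw).length z (by rwa [hw])
  have key : ∀ p q : List (Fin 2 × Fin 3), ev ((S k).block w s)
      (word K p * u n ^ (2 * (S (n + 1)).len) * word K q) = 0 := by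
    intro p q
    rcases lt_or_ge n k with hk | hk
    · obtain ⟨-, hl, -, hdvd, hb⟩ := hS n k hk
      exact (hb w s hw).ev_pow_eq_zero (hu n) hsupp hl hdvd p q
    · refine ev_eq_zero_of_length_lt (hu n) hsupp _ _ _ ?_
      have := hlen (Nat.lt_succ_of_le hk)
      simp only [Nat.succ_eq_add_one] at this
      omega
  have h1 : ∀ p : List (Fin 2 × Fin 3), ev ((S k).block w s) ∘ₗ
      LinearMap.mulLeft K (word K p * u n ^ (2 * (S (n + 1)).len)) = 0 := fun p =>
    hom_ext_word fun q => by simpa [mul_assoc] using key p q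
  intro x y
  have h2 : ev ((S k).block w s) ∘ₗ
      LinearMap.mulRight K (u n ^ (2 * (S (n + 1)).len) * y) = 0 :=
    hom_ext_word fun p => by simpa [mul_assoc] using LinearMap.congr_fun (h1 p) y
  simpa [mul_assoc] using LinearMap.congr_fun h2 x

theorem linearIndependent_lift_linearForm (S : ℕ → Level K)
    (hlen : StrictMono fun n => (S n).len) :
    LinearIndependent K (fun w : FreeSemigroup (Fin 2) => FreeSemigroup.lift
      (linearForm fun a => Ideal.Quotient.mkₐ K (levelIdeal S) (ι K a)) w) := by
  rw [linearIndependent_iff']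
  intro T c hc v₀ hv₀
  set π := Ideal.Quotient.mkₐ K (levelIdeal S)
  let word₀ : FreeSemigroup (Fin 2) → List (Fin 2) := fun v => v.head :: v.tail
  have hinj : Function.Injective word₀ := fun v v' h => by
    simp only [word₀, List.cons.injEq] at h
    exact FreeSemigroup.ext h.1 h.2
  let n := (word₀ v₀).length
  have hn : n ≤ (S n).len := hlen.le_apply
  let pad : List (Fin 2) := List.replicate ((S n).len - n) 0
  have hw : (word₀ v₀ ++ pad).length = (S n).len := by
    simp only [List.length_append, pad, List.length_replicate]; omega
  obtain ⟨M, hM, hMS⟩ := (S n).exists_symbol _ hw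
  set τ := (S n).block (word₀ v₀ ++ pad) 0
  have hsupp : IsSupportedOnLetters (word₀ v₀ ++ pad) τ := (S n).supp _ _ hw
  have hsymb : symbol (word₀ v₀ ++ pad) τ = M := by simp [τ, hMS, weight]
  let Z : (FreeAlgebra K (Fin 2 × Fin 3))[X][X] :=
    ∑ v ∈ T, c v • ((word₀ v ++ pad).map (linearForm (ι K))).prod
  have hmapform : ∀ l, mapAlgHom (mapAlgHom π) (linearForm (ι K) l) =
      linearForm (fun a => π (ι K a)) l := by
    intro l
    simp [linearForm]
  have hZ : mapAlgHom (mapAlgHom π) Z = 0 := by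
    have : mapAlgHom (mapAlgHom π) Z = (∑ v ∈ T, c v • FreeSemigroup.lift
        (linearForm fun a => π (ι K a)) v) *
          (pad.map (linearForm fun a => π (ι K a))).prod := by
      simp only [Z, map_sum, map_smul, map_list_prod, List.map_map, Finset.sum_mul,
        FreeSemigroup.lift_eq_prod, smul_mul_assoc, ← List.prod_append, ← List.map_append,
        Function.comp_def, hmapform, word₀]
    rw [this, hc, zero_mul]
  have hcoeff : ∀ i j, ev τ ((Z.coeff j).coeff i) = 0 := by
    intro i j
    have h0 : π ((Z.coeff j).coeff i) = 0 := by
      have := congrArg (fun P => (P.coeff j).coeff i) hZ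
      simpa using this
    have hmem : (Z.coeff j).coeff i ∈ levelIdeal S := Ideal.Quotient.eq_zero_iff_mem.1 h0
    simpa using hmem n _ 0 hw 1 1
  have hcM : c v₀ • M = 0 := by
    ext j i
    have := hcoeff i j
    simp only [Z, finsetSum_coeff, coeff_smul, map_sum, map_smul,
      ev_coeff_prod_linearForm] at this
    rw [Finset.sum_eq_single v₀, hsymb] at this
    · simpa using this
    · intro v _ hv
      rw [symbol_eq_zero_of_ne hsupp]
      · simp
      · intro h
        exact hv (hinj (List.append_cancel_right h))
    · exact fun h => absurd hv₀ h
  exact (smul_eq_zero.1 hcM).resolve_right hM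

theorem exists_nil_of_countable (K : Type) [Field K] [Countable K] :
    ∃ (Q : Type) (_ : Ring Q) (_ : Algebra K Q) (g : Fin 2 × Fin 3 → Q),
      (∀ x ∈ NonUnitalAlgebra.adjoin K (Set.range g), IsNilpotent x) ∧
      LinearIndependent K
        (fun w : FreeSemigroup (Fin 2) => FreeSemigroup.lift (linearForm g) w) := by
  let E := {e : FreeAlgebra K (Fin 2 × Fin 3) × ℕ // e.1 ∈ shortSpan K (Fin 2 × Fin 3) e.2}
  have : Nonempty E := ⟨⟨(0, 0), zero_mem _⟩⟩
  obtain ⟨f, hf⟩ := exists_surjective_nat E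
  obtain ⟨S, hlt, hS⟩ := Level.exists_seq (fun n => (f n).1.1) (fun n => (f n).1.2)
    (fun n => (f n).2)
  have hlen : StrictMono fun n => (S n).len := strictMono_nat_of_lt_succ hlt
  refine ⟨_ ⧸ levelIdeal S, inferInstance, inferInstance,
    fun a => Ideal.Quotient.mkₐ K (levelIdeal S) (ι K a), fun x hx => ?_,
    linearIndependent_lift_linearForm S hlen⟩
  have hx : ∃ u D, u ∈ shortSpan K (Fin 2 × Fin 3) D ∧
      Ideal.Quotient.mkₐ K (levelIdeal S) u = x := by
    induction hx using NonUnitalAlgebra.adjoin_induction with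
    | mem x hx =>
      obtain ⟨a, rfl⟩ := hx
      exact ⟨ι K a, 1, Submodule.subset_span ⟨[a], by simp, by simp [word]⟩, rfl⟩
    | add x y _ _ hx hy =>
      obtain ⟨u, D, hu, rfl⟩ := hx
      obtain ⟨v, D', hv, rfl⟩ := hy
      exact ⟨u + v, max D D', add_mem (shortSpan_mono (le_max_left _ _) hu)
        (shortSpan_mono (le_max_right _ _) hv), map_add _ _ _⟩
    | zero => exact ⟨0, 0, zero_mem _, map_zero _⟩
    | mul x y _ _ hx hy =>
      obtain ⟨u, D, hu, rfl⟩ := hx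
      obtain ⟨v, D', hv, rfl⟩ := hy
      exact ⟨u * v, D + D', mul_mem_shortSpan hu hv, map_mul _ _ _⟩
    | smul c x _ hx =>
      obtain ⟨u, D, hu, rfl⟩ := hx
      exact ⟨c • u, D, Submodule.smul_mem _ _ hu, map_smul _ _ _⟩
  obtain ⟨u, D, hu, rfl⟩ := hx
  obtain ⟨n, hn⟩ := hf ⟨(u, D), hu⟩
  have hmem := pow_mem_levelIdeal (fun n => (f n).2) hlen hS n
  rw [hn] at hmem
  refine ⟨2 * (S (n + 1)).len, ?_⟩
  rw [← map_pow]
  exact Ideal.Quotient.eq_zero_iff_mem.2 hmem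

end Quotient

end FreeAlgebra

open Polynomial in
/-- The polynomials over the unitization of `A` all of whose coefficients lie in `A`. -/
def Unitization.polynomialSubalgebra (K A : Type) [Field K] [NonUnitalRing A] [Module K A]
    [SMulCommClass K A A] [IsScalarTower K A A] :
    NonUnitalSubalgebra K (Unitization K A)[X] where
  carrier := {p | ∀ n, p.coeff n ∈ NonUnitalAlgHom.range (Unitization.inrNonUnitalAlgHom K A)}
  zero_mem' n := by simp
  add_mem' hp hq n := by rw [coeff_add]; exact add_mem (hp n) (hq n)
  mul_mem' hp hq n := by
    rw [coeff_mul]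
    exact sum_mem fun x _ => mul_mem (hp x.1) (hq x.2)
  smul_mem' c p hp n := by
    rw [coeff_smul]
    exact SMulMemClass.smul_mem c (hp n)

theorem HasFreeRankTwo.not_of_isNilpotent {K R Q : Type} [Field K] [NonUnitalRing R] [Module K R]
    [Ring Q] [Algebra K Q] (φ : R →ₙₐ[K] Q) (hφ : Function.Injective φ)
    (hR : ∀ x, IsNilpotent (φ x)) : ¬ HasFreeRankTwo K R := by
  rintro ⟨a, b, h⟩
  obtain ⟨n, hn⟩ := hR a
  refine h.ne_zero ⟨0, List.replicate n 0⟩ (hφ ?_)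
  rw [FreeSemigroup.map_lift, FreeSemigroup.lift_eq_prod, map_zero]
  simp [hn]

theorem HasFreeRankTwo.linearIndependent_map {K B B' : Type} [Field K] [NonUnitalSemiring B]
    [Module K B] [NonUnitalSemiring B'] [Module K B'] (φ : B →ₙₐ[K] B') (hφ : Function.Injective φ)
    {a b : B} (h : LinearIndependent K (fun w : FreeSemigroup (Fin 2) =>
      FreeSemigroup.lift (fun i : Fin 2 => if i = 0 then a else b) w)) :
    LinearIndependent K (fun w : FreeSemigroup (Fin 2) =>
      FreeSemigroup.lift (fun i : Fin 2 => if i = 0 then φ a else φ b) w) := by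
  convert h.map_injOn (φ : B →ₗ[K] B') hφ.injOn using 2 with w
  exact (congrArg (fun f => FreeSemigroup.lift f w)
    (funext fun i => (apply_ite φ _ _ _).symm)).trans (FreeSemigroup.map_lift φ _ w).symm

open Polynomial in
theorem Unitization.linear_mem_polynomialSubalgebra {K A : Type} [Field K] [NonUnitalRing A]
    [Module K A] [SMulCommClass K A A] [IsScalarTower K A A] (p q : A) :
    C (p : Unitization K A) + C (q : Unitization K A) * X ∈ polynomialSubalgebra K A := by
  intro n
  rcases n with _ | _ | n <;> simp [coeff_C, coeff_X]

open Polynomial in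
theorem Unitization.exists_linearIndependent_polynomialSubalgebra {K R Q : Type} [Field K]
    [NonUnitalRing R] [Module K R] [SMulCommClass K R R] [IsScalarTower K R R] [Ring Q]
    [Algebra K Q] (φ : R →ₙₐ[K] Q) (g : Fin 2 × Fin 3 → R)
    (hg : LinearIndependent K (fun w : FreeSemigroup (Fin 2) =>
      FreeSemigroup.lift (FreeAlgebra.linearForm fun x => φ (g x)) w)) :
    ∃ a ∈ polynomialSubalgebra K (polynomialSubalgebra K R),
      ∃ b ∈ polynomialSubalgebra K (polynomialSubalgebra K R),
        LinearIndependent K (fun w : FreeSemigroup (Fin 2) =>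
          FreeSemigroup.lift (fun i : Fin 2 => if i = 0 then a else b) w) := by
  let c₀ (l : Fin 2) : polynomialSubalgebra K R :=
    ⟨_, linear_mem_polynomialSubalgebra (g (l, 0)) (g (l, 1))⟩
  let c₁ (l : Fin 2) : polynomialSubalgebra K R :=
    ⟨C (g (l, 2) : Unitization K R), by
      simpa using linear_mem_polynomialSubalgebra (K := K) (g (l, 2)) 0⟩
  let a (l : Fin 2) : (Unitization K (polynomialSubalgebra K R))[X] := 
    C (inr (c₀ l)) + C (inr (c₁ l)) * X
  have ha l : a l ∈ polynomialSubalgebra K (polynomialSubalgebra K R) :=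
    linear_mem_polynomialSubalgebra _ _
  let ψ : (Unitization K (polynomialSubalgebra K R))[X] →ₐ[K] Q[X][X] :=
    mapAlgHom (Unitization.lift
      ((mapAlgHom (Unitization.lift φ)).toNonUnitalAlgHom.comp
        (NonUnitalSubalgebraClass.subtype (polynomialSubalgebra K R))))
  have hψ l : ψ (a l) = FreeAlgebra.linearForm (fun x => φ (g x)) l := by
    have hF (p) : NonUnitalAlgHomClass.toNonUnitalAlgHom (mapAlgHom φ.toAlgHom) p =
      mapAlgHom φ.toAlgHom p := rfl
    simp [ψ, a, c₀, c₁, FreeAlgebra.linearForm, hF]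
  refine ⟨a 0, ha 0, a 1, ha 1, .of_comp ψ.toLinearMap ?_⟩
  have hcomp : (fun w => ψ (FreeSemigroup.lift (fun i : Fin 2 => if i = 0 then a 0 else a 1) w)) =
      fun w => FreeSemigroup.lift (FreeAlgebra.linearForm fun x => φ (g x)) w := by
    funext w
    rw [FreeSemigroup.map_lift]
    congr 2
    funext i
    fin_cases i <;> simp [hψ]
  change LinearIndependent K (fun w => ψ (FreeSemigroup.lift _ w))
  rw [hcomp]
  exact hg

theorem HasFreeRankTwo.exists_linearIndependent {K A : Type} [Field K] [NonUnitalRing A]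
    [Module K A] [SMulCommClass K A A] [IsScalarTower K A A]
    (h : HasFreeRankTwo K (Unitization.polynomialSubalgebra K A)) :
    ∃ a ∈ Unitization.polynomialSubalgebra K A, ∃ b ∈ Unitization.polynomialSubalgebra K A,
      LinearIndependent K (fun w : FreeSemigroup (Fin 2) =>
        FreeSemigroup.lift (fun i : Fin 2 => if i = 0 then a else b) w) := by
  obtain ⟨a, b, h⟩ := h
  exact ⟨a, a.2, b, b.2, linearIndependent_map
    (NonUnitalSubalgebraClass.subtype (Unitization.polynomialSubalgebra K A))
    Subtype.val_injective h⟩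

/-- If the polynomials in two variables over an algebra without free subalgebras of rank two
contain such a subalgebra, then it appears on adjoining one of the two variables. -/
theorem exists_not_hasFreeRankTwo_of_linearForm {K R Q : Type} [Field K] [NonUnitalRing R]
    [Module K R] [SMulCommClass K R R] [IsScalarTower K R R] [Ring Q] [Algebra K Q]
    (φ : R →ₙₐ[K] Q) (hR : ¬ HasFreeRankTwo K R) (g : Fin 2 × Fin 3 → R)
    (hg : LinearIndependent K (fun w : FreeSemigroup (Fin 2) =>
      FreeSemigroup.lift (FreeAlgebra.linearForm fun x => φ (g x)) w)) :
    ∃ (A : Type) (_ : NonUnitalRing A) (_ : Module K A) (_ : SMulCommClass K A A)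
      (_ : IsScalarTower K A A), ¬ HasFreeRankTwo K A ∧
        ∃ a ∈ Unitization.polynomialSubalgebra K A, ∃ b ∈ Unitization.polynomialSubalgebra K A,
          LinearIndependent K (fun w : FreeSemigroup (Fin 2) =>
            FreeSemigroup.lift (fun i : Fin 2 => if i = 0 then a else b) w) := by
  by_cases h : HasFreeRankTwo K (Unitization.polynomialSubalgebra K R)
  · exact ⟨R, inferInstance, inferInstance, inferInstance, inferInstance, hR,
      h.exists_linearIndependent⟩
  · exact ⟨Unitization.polynomialSubalgebra K R, inferInstance, inferInstance, inferInstance,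
      inferInstance, h, Unitization.exists_linearIndependent_polynomialSubalgebra φ g hg⟩

/-- Over every countable field `K` there is an associative `K`-algebra `A` without free
noncommutative subalgebras of rank two such that the polynomial ring `A[x]` in one central
commuting indeterminate over `A` (realized as the non-unital subalgebra of polynomials over
the unitization of `A` all of whose coefficients lie in `A`) contains a free noncommutative
`K`-subalgebra of rank two. -/
theorem stmt0 (K : Type) [Field K] [Countable K] :
    ∃ (A : Type) (i₁ : NonUnitalRing A),
      letI := i₁
      ∃ (i₂ : Module K A),
        letI := i₂
        ∃ (_ : SMulCommClass K A A) (_ : IsScalarTower K A A),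
          ¬ HasFreeRankTwo K A ∧
          (∃ a b : Polynomial (Unitization K A),
            (∀ n, (a.coeff n) ∈ Set.range (Unitization.inr : A → Unitization K A)) ∧
            (∀ n, (b.coeff n) ∈ Set.range (Unitization.inr : A → Unitization K A)) ∧
            LinearIndependent K
              (fun w : FreeSemigroup (Fin 2) =>
                (FreeSemigroup.lift (fun i : Fin 2 => if i = 0 then a else b) w
                  : Polynomial (Unitization K A)))) := by
  obtain ⟨Q, _, _, g, hnil, hg⟩ := FreeAlgebra.exists_nil_of_countable K
  obtain ⟨A, _, _, _, _, hA, a, ha, b, hb, h⟩ := exists_not_hasFreeRankTwo_of_linearForm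
    (NonUnitalSubalgebraClass.subtype (NonUnitalAlgebra.adjoin K (Set.range g)))
    (HasFreeRankTwo.not_of_isNilpotent
      (NonUnitalSubalgebraClass.subtype (NonUnitalAlgebra.adjoin K (Set.range g)))
      Subtype.val_injective fun x => hnil x x.2)
    (fun x => ⟨g x, NonUnitalAlgebra.subset_adjoin K ⟨x, rfl⟩⟩) hg
  exact ⟨A, _, _, ‹_›, ‹_›, hA, a, b, ha, hb, h⟩
end

section
/- For every countable field K there exist a field extension F of K and an associative K-algebra A containing no free noncommutative K-subalgebra of rank two, such that the K-algebra A ⊗_K F obtained by extending scalars contains a free noncommutative K-subalgebra of rank two. -/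
open scoped TensorProduct

/-- The unital free `R`-algebra on `X`, in its basis of words. -/
abbrev WordAlgebra (R X : Type) [CommSemiring R] : Type := MonoidAlgebra R (FreeMonoid X)

namespace WordAlgebra

section Words

variable {R X V : Type} [CommRing R] [AddCommGroup V] [Module R V]

/-- A word, as an element of the free algebra. -/
noncomputable def word (w : FreeMonoid X) : WordAlgebra R X := MonoidAlgebra.single w 1

lemma word_mul (v w : FreeMonoid X) : (word (v * w) : WordAlgebra R X) = word v * word w := by
  simp [word, MonoidAlgebra.single_mul_single]

lemma word_one : (word 1 : WordAlgebra R X) = 1 := rfl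

lemma span_range_word : Submodule.span R (Set.range (word : _ → WordAlgebra R X)) = ⊤ := by
  rw [eq_top_iff]
  rintro x -
  induction x using MonoidAlgebra.induction_linear with
  | zero => exact zero_mem _
  | add x y hx hy => exact add_mem hx hy
  | single w r =>
    have : (MonoidAlgebra.single w r : WordAlgebra R X) = r • word w := by simp [word]
    rw [this]
    exact Submodule.smul_mem _ _ (Submodule.subset_span ⟨w, rfl⟩)

@[elab_as_elim]
lemma word_induction {p : WordAlgebra R X → Prop} (x : WordAlgebra R X)
    (word : ∀ w, p (word w)) (zero : p 0) (add : ∀ x y, p x → p y → p (x + y))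
    (smul : ∀ (r : R) x, p x → p (r • x)) : p x := by
  have hx : x ∈ Submodule.span R (Set.range (WordAlgebra.word : _ → WordAlgebra R X)) := by
    simp [span_range_word]
  induction hx using Submodule.span_induction with
  | mem x h => obtain ⟨w, rfl⟩ := h; exact word w
  | zero => exact zero
  | add x y _ _ hx hy => exact add x y hx hy
  | smul r x _ hx => exact smul r x hx

/-- The linear map with prescribed values on words. -/
noncomputable def ofWords (g : FreeMonoid X → V) : WordAlgebra R X →ₗ[R] V :=
  Finsupp.linearCombination R g ∘ₗ (MonoidAlgebra.coeffLinearEquiv R).toLinearMap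

@[simp]
lemma ofWords_word (g : FreeMonoid X → V) (w : FreeMonoid X) :
    ofWords g (word w : WordAlgebra R X) = g w := by
  simp [ofWords, word]

variable (R X) in
/-- The span of the words of length one. -/
noncomputable def letters : Submodule R (WordAlgebra R X) :=
  Submodule.span R (Set.range fun x => word (FreeMonoid.of x))

lemma word_of_mem_letters (x : X) : (word (FreeMonoid.of x) : WordAlgebra R X) ∈ letters R X :=
  Submodule.subset_span ⟨x, rfl⟩

lemma word_mem_letters_pow (w : FreeMonoid X) :
    (word w : WordAlgebra R X) ∈ letters R X ^ w.length := by
  induction w using FreeMonoid.inductionOn' with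
  | one => exact pow_zero (letters R X) ▸ Submodule.one_le.1 le_rfl
  | of_mul x w ih =>
    rw [word_mul, FreeMonoid.length_mul, FreeMonoid.length_of, pow_add, pow_one]
    exact Submodule.mul_mem_mul (word_of_mem_letters x) ih

lemma letters_pow_eq_span (n : ℕ) :
    letters R X ^ n = Submodule.span R (word '' {w : FreeMonoid X | w.length = n}) := by
  refine le_antisymm ?_ ?_
  · induction n with
    | zero =>
      rw [pow_zero, Submodule.one_le]
      exact Submodule.subset_span ⟨1, rfl, word_one⟩
    | succ n ih =>
      rw [pow_succ]
      refine (mul_le_mul' ih le_rfl).trans ?_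
      rw [letters, Submodule.span_mul_span, Submodule.span_le]
      rintro _ ⟨_, ⟨w, hw, rfl⟩, _, ⟨x, rfl⟩, rfl⟩
      refine Submodule.subset_span ⟨w * FreeMonoid.of x, ?_, word_mul _ _⟩
      simpa using hw
  · rw [Submodule.span_le]
    rintro _ ⟨w, rfl, rfl⟩
    exact word_mem_letters_pow w

lemma eqOn_letters_pow {n : ℕ} {π ρ : WordAlgebra R X →ₗ[R] V}
    (h : ∀ w : FreeMonoid X, w.length = n → π (word w) = ρ (word w))
    {x : WordAlgebra R X} (hx : x ∈ letters R X ^ n) : π x = ρ x := by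
  rw [letters_pow_eq_span] at hx
  refine LinearMap.eqOn_span (f := π) (g := ρ) ?_ hx
  rintro _ ⟨w, hw, rfl⟩
  exact h w hw

/-- The linear map which agrees with `π` on words of length `n` and kills all other words. -/
noncomputable def restrict (n : ℕ) (π : WordAlgebra R X →ₗ[R] V) : WordAlgebra R X →ₗ[R] V :=
  ofWords fun w => if w.length = n then π (word w) else 0

lemma restrict_apply {m n : ℕ} (π : WordAlgebra R X →ₗ[R] V) {x : WordAlgebra R X}
    (hx : x ∈ letters R X ^ m) : restrict n π x = if m = n then π x else 0 := by
  split_ifs with h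
  · exact eqOn_letters_pow (fun w hw => by simp [restrict, hw, h]) hx
  · exact eqOn_letters_pow (ρ := 0) (fun w hw => by simp [restrict, hw, h]) hx

variable {B : Type} [Ring B] [Algebra R B]

/-- The linear map `x y ↦ π x * ρ y`, where `x` is the initial part of length `n`. -/
noncomputable def splitMul (n : ℕ) (π ρ : WordAlgebra R X →ₗ[R] B) : WordAlgebra R X →ₗ[R] B :=
  ofWords fun w => π (word (FreeMonoid.ofList (w.toList.take n))) *
    ρ (word (FreeMonoid.ofList (w.toList.drop n)))

lemma splitMul_mul {n : ℕ} (π ρ : WordAlgebra R X →ₗ[R] B) {x : WordAlgebra R X}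
    (hx : x ∈ letters R X ^ n) (y : WordAlgebra R X) :
    splitMul n π ρ (x * y) = π x * ρ y := by
  have key : ∀ w : FreeMonoid X, w.length = n → ∀ y : WordAlgebra R X,
      splitMul n π ρ (word w * y) = π (word w) * ρ y := by
    intro w hw y
    induction y using word_induction with
    | word v =>
      rw [← word_mul]
      have hw' : w.toList.length = n := hw
      simp [splitMul, ← hw']
    | zero => simp
    | add x y hx hy => simp [mul_add, hx, hy]
    | smul r x hx => simp [hx]
  exact eqOn_letters_pow (π := splitMul n π ρ ∘ₗ LinearMap.mulRight R y)
    (ρ := LinearMap.mulRight R (ρ y) ∘ₗ π) (fun w hw => key w hw y) hx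

end Words

section Homogenize

variable {R X : Type} [CommRing R]

open Polynomial in
/-- The algebra homomorphism to polynomials which multiplies each letter by the variable: the
coefficients of the image are the homogeneous components. -/
noncomputable def homogenize : WordAlgebra R X →ₐ[R] (WordAlgebra R X)[X] :=
  MonoidAlgebra.lift R _ _
    (FreeMonoid.lift fun x => Polynomial.monomial 1 (word (FreeMonoid.of x)))

lemma homogenize_word (w : FreeMonoid X) :
    homogenize (word w : WordAlgebra R X) = Polynomial.monomial w.length (word w) := by
  have h : homogenize (word w : WordAlgebra R X) =
      FreeMonoid.lift (fun x => Polynomial.monomial 1 (word (FreeMonoid.of x))) w := by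
    simp [homogenize, word]
  rw [h]
  induction w using FreeMonoid.inductionOn' with
  | one => simp [word_one, Polynomial.monomial_zero_left]
  | of_mul x w ih =>
    rw [map_mul, ih (by simp [homogenize, word]), FreeMonoid.lift_eval_of,
      Polynomial.monomial_mul_monomial, FreeMonoid.length_mul, FreeMonoid.length_of, word_mul]

lemma coeff_homogenize_mem (f : WordAlgebra R X) (m : ℕ) :
    (homogenize f).coeff m ∈ letters R X ^ m := by
  induction f using word_induction with
  | word w =>
    rw [homogenize_word, Polynomial.coeff_monomial]
    split_ifs with h
    · exact h ▸ word_mem_letters_pow w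
    · exact zero_mem _
  | zero => simp
  | add x y hx hy => rw [map_add, Polynomial.coeff_add]; exact add_mem hx hy
  | smul r x hx => rw [map_smul, Polynomial.coeff_smul]; exact Submodule.smul_mem _ _ hx

lemma sum_coeff_homogenize (f : WordAlgebra R X) {n : ℕ} (hn : (homogenize f).natDegree < n) :
    ∑ m ∈ Finset.range n, (homogenize f).coeff m = f := by
  have h : (homogenize f).eval 1 = f := by
    induction f using word_induction generalizing n with
    | word w => simp [homogenize_word]
    | zero => simp
    | add x y hx hy =>
      rw [map_add, Polynomial.eval_add, hx (Nat.lt_succ_self _), hy (Nat.lt_succ_self _)]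
    | smul r x hx => rw [map_smul, Polynomial.eval_smul, hx (Nat.lt_succ_self _)]
  conv_rhs => rw [← h, Polynomial.eval_eq_sum_range' hn]
  simp

lemma coeff_homogenize_pow_eq_zero {f : WordAlgebra R X} (hf : (homogenize f).coeff 0 = 0)
    (k h : ℕ) (hk : h < k) : (homogenize (f ^ k)).coeff h = 0 := by
  induction k generalizing h with
  | zero => omega
  | succ k ih =>
    rw [pow_succ', map_mul, Polynomial.coeff_mul]
    refine Finset.sum_eq_zero fun p hp => ?_
    rw [Finset.HasAntidiagonal.mem_antidiagonal] at hp
    rcases Nat.eq_zero_or_pos p.1 with h0 | h0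
    · rw [h0, hf, zero_mul]
    · rw [ih p.2 (by omega), mul_zero]

/-- The elements of degree `L` through which all high powers of `f` factor. -/
noncomputable def gate (f : WordAlgebra R X) (L : ℕ)
    (p : ({w : FreeMonoid X | w.length ≤ (homogenize f).natDegree} ×
      {w : FreeMonoid X | w.length ≤ (homogenize f).natDegree}) × Fin (L + 1)) :
    WordAlgebra R X :=
  word p.1.1.1 * (homogenize (f ^ (p.2 : ℕ))).coeff (L - p.1.1.1.length - p.1.2.1.length) *
    word p.1.2.1

lemma gate_mem {f : WordAlgebra R X} {L : ℕ} (hL : 2 * (homogenize f).natDegree ≤ L) (p) :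
    gate f L p ∈ letters R X ^ L := by
  obtain ⟨⟨⟨u, hu⟩, ⟨v, hv⟩⟩, k⟩ := p
  simp only [Set.mem_ofPred_eq] at hu hv
  have h : u.length + (L - u.length - v.length) + v.length = L := by omega
  have hpow : letters R X ^ u.length * letters R X ^ (L - u.length - v.length) *
      letters R X ^ v.length = letters R X ^ L := by
    rw [← pow_add, ← pow_add, h]
  rw [← hpow]
  exact Submodule.mul_mem_mul (Submodule.mul_mem_mul (word_mem_letters_pow u)
    (coeff_homogenize_mem _ _)) (word_mem_letters_pow v)

lemma mem_top_mul {S : Submodule R (WordAlgebra R X)} {y : WordAlgebra R X} (hy : y ∈ S) :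
    y ∈ ⊤ * S := by
  simpa only [one_mul] using
    Submodule.mul_mem_mul (Submodule.mem_top (x := (1 : WordAlgebra R X))) hy

lemma mul_mem_top_mul {S : Submodule R (WordAlgebra R X)} (x : WordAlgebra R X)
    {y : WordAlgebra R X} (hy : y ∈ ⊤ * S) : x * y ∈ ⊤ * S := by
  refine Submodule.mul_induction_on hy (fun a _ b hb => ?_) fun a b ha hb => ?_
  · rw [← mul_assoc]
    exact Submodule.mul_mem_mul Submodule.mem_top hb
  · rw [mul_add]
    exact add_mem ha hb

lemma pow_mem_of_forall_cut {f : WordAlgebra R X} (hf : (homogenize f).coeff 0 = 0)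
    {S : Submodule R (WordAlgebra R X)} (q c : ℕ) (hcq : c ≤ q)
    (h : ∀ k e, q ≤ k + c → e ≤ (homogenize f).natDegree → ∀ x ∈ letters R X ^ e,
      ∀ y ∈ letters R X ^ c, f ^ k * x * y ∈ S) : f ^ q ∈ S := by
  induction c with
  | zero =>
    have h1 : (1 : WordAlgebra R X) ∈ letters R X ^ 0 :=
      pow_zero (letters R X) ▸ Submodule.one_le.1 le_rfl
    simpa only [mul_one] using h q 0 le_rfl (Nat.zero_le _) 1 h1 1 h1
  | succ c ih =>
    have key : ∀ k e, q ≤ k + c + 1 → e ≤ (homogenize f).natDegree → ∀ x ∈ letters R X ^ (e + 1),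
        ∀ y ∈ letters R X ^ c, f ^ k * x * y ∈ S := by
      intro k e hk he x hx y hy
      rw [pow_succ] at hx
      refine Submodule.mul_induction_on hx (fun x hx l hl => ?_) fun x x' hx hx' => ?_
      · have := h k e hk he x hx (l * y) (by rw [pow_succ']; exact Submodule.mul_mem_mul hl hy)
        simpa only [mul_assoc] using this
      · rw [mul_add, add_mul]
        exact add_mem hx hx'
    refine ih (by omega) fun k e hk he x hx y hy => ?_
    cases e with
    | succ e => exact key k e (by omega) (by omega) x hx y hy
    | zero =>
      rw [pow_zero, Submodule.mem_one] at hx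
      obtain ⟨r, rfl⟩ := hx
      obtain ⟨k, rfl⟩ := Nat.exists_eq_succ_of_ne_zero (n := k) (by omega)
      have hfS : f ^ k * f * y ∈ S := by
        have hsum : f ^ k * f * y = f ^ k * (∑ m ∈ Finset.range ((homogenize f).natDegree + 1),
            (homogenize f).coeff m) * y := by
          rw [sum_coeff_homogenize f (Nat.lt_succ_self _)]
        rw [hsum, Finset.mul_sum, Finset.sum_mul]
        refine sum_mem fun m hm => ?_
        rw [Finset.mem_range] at hm
        cases m with
        | zero => simp [hf]
        | succ m => exact key k m (by omega) (by omega) _ (coeff_homogenize_mem _ _) y hy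
      rw [Nat.succ_eq_add_one, pow_succ, Algebra.algebraMap_eq_smul_one, mul_smul_comm, mul_one,
        smul_mul_assoc]
      exact Submodule.smul_mem _ _ hfS

lemma coeff_mul_word_mem {f : WordAlgebra R X} (hf : (homogenize f).coeff 0 = 0) {L : ℕ}
    (v : FreeMonoid X) (hv : v.length ≤ (homogenize f).natDegree) (k h : ℕ)
    (hh : L - v.length ≤ h) :
    (homogenize (f ^ k)).coeff h * word v ∈ ⊤ * Submodule.span R (Set.range (gate f L)) := by
  have htop : ∀ (x : WordAlgebra R X) {y}, y ∈ ⊤ * Submodule.span R (Set.range (gate f L)) →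
      x * y ∈ ⊤ * Submodule.span R (Set.range (gate f L)) :=
    fun x _ hy => mul_mem_top_mul x hy
  have hgate : ∀ (u : FreeMonoid X) (k : ℕ), u.length ≤ (homogenize f).natDegree →
      word u * (homogenize (f ^ k)).coeff (L - u.length - v.length) * word v ∈
        ⊤ * Submodule.span R (Set.range (gate f L)) := by
    intro u k hu
    by_cases hk : k ≤ L
    · exact mem_top_mul (Submodule.subset_span ⟨((⟨u, hu⟩, ⟨v, hv⟩), ⟨k, by omega⟩), rfl⟩)
    · rw [coeff_homogenize_pow_eq_zero hf _ _ (by omega)]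
      simp
  induction k generalizing h with
  | zero =>
    by_cases h0 : h = 0
    · have := hgate 1 0 (by simp)
      simp only [FreeMonoid.length_one, Nat.sub_zero, word_one, one_mul] at this
      rwa [show L - v.length = h by omega] at this
    · simp [Polynomial.coeff_one, h0]
  | succ k ih =>
    rw [pow_succ', map_mul, Polynomial.coeff_mul, Finset.sum_mul]
    refine sum_mem fun p hp => ?_
    rw [Finset.HasAntidiagonal.mem_antidiagonal] at hp
    rw [mul_assoc]
    by_cases hp2 : L - v.length ≤ p.2
    · exact htop _ (ih _ hp2)
    by_cases hp1 : (homogenize f).natDegree < p.1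
    · rw [Polynomial.coeff_eq_zero_of_natDegree_lt hp1]
      simp
    have hm := coeff_homogenize_mem f p.1
    rw [show p.1 = (h - (L - v.length)) + (L - v.length - p.2) by omega, pow_add] at hm
    rw [← show p.1 = (h - (L - v.length)) + (L - v.length - p.2) by omega] at hm
    refine Submodule.mul_induction_on hm (fun a _ b hb => ?_) fun x y hx hy => ?_
    · rw [mul_assoc]
      refine htop a ?_
      rw [letters_pow_eq_span] at hb
      induction hb using Submodule.span_induction with
      | mem x hx =>
        obtain ⟨u, hu, rfl⟩ := hx
        have := hgate u k (by simp only [Set.mem_ofPred_eq] at hu; omega)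
        simp only [Set.mem_ofPred_eq] at hu
        rwa [show L - u.length - v.length = p.2 by omega, mul_assoc] at this
      | zero => simp
      | add x y _ _ hx hy => rw [add_mul]; exact add_mem hx hy
      | smul r x _ hx => rw [smul_mul_assoc]; exact Submodule.smul_mem _ _ hx
    · rw [add_mul]
      exact add_mem hx hy

lemma pow_mem_top_mul_gate_mul {f : WordAlgebra R X} (hf : (homogenize f).coeff 0 = 0)
    {L c q : ℕ} (hq : c + L ≤ q) :
    f ^ q ∈ ⊤ * Submodule.span R (Set.range (gate f L)) * letters R X ^ c := by
  refine pow_mem_of_forall_cut hf q c (by omega) fun k e hk he x hx y hy => ?_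
  refine Submodule.mul_mem_mul ?_ hy
  rw [letters_pow_eq_span] at hx
  induction hx using Submodule.span_induction with
  | mem x hx =>
    obtain ⟨v, hv, rfl⟩ := hx
    simp only [Set.mem_ofPred_eq] at hv
    rw [← sum_coeff_homogenize (f ^ k) (Nat.lt_succ_self _), Finset.sum_mul]
    refine sum_mem fun h _ => ?_
    by_cases hh : h < k
    · rw [coeff_homogenize_pow_eq_zero hf k h hh]
      simp
    · exact coeff_mul_word_mem hf v (by omega) k h (by omega)
  | zero => simp
  | add x y _ _ hx hy => rw [mul_add]; exact add_mem hx hy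
  | smul r x _ hx => rw [mul_smul_comm]; exact Submodule.smul_mem _ _ hx

end Homogenize

section MapCoeff

variable {R S X : Type} [CommRing R] [CommRing S] (φ : R →+* S)

variable (X) in
/-- Applying a ring homomorphism to all coefficients, as a semilinear map. -/
noncomputable def mapCoeff : WordAlgebra R X →ₛₗ[φ] WordAlgebra S X where
  toFun := MonoidAlgebra.mapRingHom (FreeMonoid X) φ
  map_add' := map_add _
  map_smul' r x := by ext; simp

lemma mapCoeff_mul (x y : WordAlgebra R X) :
    mapCoeff X φ (x * y) = mapCoeff X φ x * mapCoeff X φ y :=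
  map_mul (MonoidAlgebra.mapRingHom (FreeMonoid X) φ) x y

lemma mapCoeff_one : mapCoeff X φ (1 : WordAlgebra R X) = 1 :=
  map_one (MonoidAlgebra.mapRingHom (FreeMonoid X) φ)

lemma mapCoeff_word (w : FreeMonoid X) : mapCoeff X φ (word w) = word w := by
  simp [mapCoeff, word]

lemma mapCoeff_injective (h : Function.Injective φ) : Function.Injective (mapCoeff X φ) := by
  intro x y hxy
  refine MonoidAlgebra.coeff_injective (Finsupp.ext fun w => h ?_)
  have := DFunLike.congr_fun (congrArg MonoidAlgebra.coeff hxy) w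
  simpa [mapCoeff] using this

lemma comap_mul_comap_le (A B : Submodule S (WordAlgebra S X)) :
    A.comap (mapCoeff X φ) * B.comap (mapCoeff X φ) ≤ (A * B).comap (mapCoeff X φ) := by
  refine Submodule.mul_le.2 fun m hm n hn => ?_
  rw [Submodule.mem_comap, mapCoeff_mul]
  exact Submodule.mul_mem_mul hm hn

lemma mul_le_comap {A B : Submodule R (WordAlgebra R X)} {A' B' : Submodule S (WordAlgebra S X)}
    (hA : A ≤ A'.comap (mapCoeff X φ)) (hB : B ≤ B'.comap (mapCoeff X φ)) :
    A * B ≤ (A' * B').comap (mapCoeff X φ) :=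
  (mul_le_mul' hA hB).trans (comap_mul_comap_le φ A' B')

lemma pow_le_comap {A : Submodule R (WordAlgebra R X)} {A' : Submodule S (WordAlgebra S X)}
    (hA : A ≤ A'.comap (mapCoeff X φ)) (n : ℕ) : A ^ n ≤ (A' ^ n).comap (mapCoeff X φ) := by
  induction n with
  | zero =>
    rw [pow_zero, pow_zero, Submodule.one_le, Submodule.mem_comap, mapCoeff_one]
    exact Submodule.one_le.1 le_rfl
  | succ n ih =>
    rw [pow_succ, pow_succ]
    exact mul_le_comap φ ih hA

lemma letters_le_comap : letters R X ≤ (letters S X).comap (mapCoeff X φ) := by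
  rw [letters, Submodule.span_le]
  rintro _ ⟨x, rfl⟩
  rw [SetLike.mem_coe, Submodule.mem_comap, mapCoeff_word]
  exact word_of_mem_letters x

end MapCoeff

section Specialization

variable {F : Type} [Field F]

/-- The alphabet: two families of three letters. -/
abbrev Alphabet : Type := Fin 2 × Option (Fin 2)

/-- The linear form `x₀ + θ₀ x₁ + θ₁ x₂` in the `e`-th family of letters. -/
noncomputable def point (θ : Fin 2 → F) (e : Fin 2) : WordAlgebra F Alphabet :=
  word (FreeMonoid.of (e, none)) + ∑ c, θ c • word (FreeMonoid.of (e, some c))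

/-- The algebra homomorphism sending the two free generators to the two forms `point θ`. -/
noncomputable def specialize (θ : Fin 2 → F) :
    WordAlgebra F (Fin 2) →ₐ[F] WordAlgebra F Alphabet :=
  MonoidAlgebra.lift F _ _ (FreeMonoid.lift (point θ))

@[simp]
lemma specialize_word_of (θ : Fin 2 → F) (e : Fin 2) :
    specialize θ (word (FreeMonoid.of e)) = point θ e := by
  simp [specialize, word]

/-- The forms `point θ` with `θ` on the line where the coordinate `ℓ.1` is equal to `ℓ.2`. -/
noncomputable def lineSpan (ℓ : Fin 2 × F) : Submodule F (WordAlgebra F Alphabet) :=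
  Submodule.span F {y | ∃ θ e, θ ℓ.1 = ℓ.2 ∧ point θ e = y}

lemma point_mem_letters (θ : Fin 2 → F) (e : Fin 2) : point θ e ∈ letters F Alphabet :=
  add_mem (word_of_mem_letters _)
    (sum_mem fun _ _ => Submodule.smul_mem _ _ (word_of_mem_letters _))

lemma lineSpan_le_letters (ℓ : Fin 2 × F) : lineSpan ℓ ≤ letters F Alphabet := by
  rw [lineSpan, Submodule.span_le]
  rintro _ ⟨θ, e, -, rfl⟩
  exact point_mem_letters θ e

lemma specialize_mem_pow {θ : Fin 2 → F} {V : Submodule F (WordAlgebra F Alphabet)}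
    (hV : ∀ e, point θ e ∈ V) {n : ℕ} {p : WordAlgebra F (Fin 2)}
    (hp : p ∈ letters F (Fin 2) ^ n) : specialize θ p ∈ V ^ n := by
  have h : (letters F (Fin 2)).map (specialize θ).toLinearMap ≤ V := by
    rw [letters, Submodule.map_span_le]
    rintro _ ⟨e, rfl⟩
    simpa using hV e
  have hmem := Submodule.mem_map_of_mem (f := (specialize θ).toLinearMap) hp
  rw [Submodule.map_pow] at hmem
  exact pow_le_pow_left' h n hmem

lemma specialize_mem_letters_pow (θ : Fin 2 → F) {n : ℕ} {p : WordAlgebra F (Fin 2)}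
    (hp : p ∈ letters F (Fin 2) ^ n) : specialize θ p ∈ letters F Alphabet ^ n :=
  specialize_mem_pow (point_mem_letters θ) hp

lemma specialize_mem_lineSpan_pow {θ : Fin 2 → F} {ℓ : Fin 2 × F} (h : θ ℓ.1 = ℓ.2) {n : ℕ}
    {p : WordAlgebra F (Fin 2)} (hp : p ∈ letters F (Fin 2) ^ n) :
    specialize θ p ∈ lineSpan ℓ ^ n :=
  specialize_mem_pow (V := lineSpan ℓ) (fun e => Submodule.subset_span ⟨θ, e, h, rfl⟩) hp

lemma mapCoeff_point (σ : F →+* F) (θ : Fin 2 → F) (e : Fin 2) :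
    mapCoeff _ σ (point θ e) = point (σ ∘ θ) e := by
  simp [point, mapCoeff_word]

lemma mapCoeff_specialize (σ : F →+* F) (θ : Fin 2 → F) (p : WordAlgebra F (Fin 2)) :
    mapCoeff _ σ (specialize θ p) = specialize (σ ∘ θ) (mapCoeff _ σ p) := by
  induction p using word_induction with
  | word w =>
    rw [mapCoeff_word]
    induction w using FreeMonoid.inductionOn' with
    | one => rw [word_one, map_one (specialize θ), map_one (specialize (σ ∘ θ)), mapCoeff_one]
    | of_mul e w ih =>
      rw [word_mul, map_mul (specialize θ), map_mul (specialize (σ ∘ θ)), mapCoeff_mul, ih,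
        specialize_word_of, specialize_word_of, mapCoeff_point]
  | zero => simp
  | add x y hx hy => simp [hx, hy]
  | smul r x hx => simp [hx]

lemma lineSpan_le_comap (σ : F →+* F) (c : Fin 2) (τ : F) :
    lineSpan (c, τ) ≤ (lineSpan (c, σ τ)).comap (mapCoeff _ σ) := by
  rw [lineSpan, Submodule.span_le]
  rintro _ ⟨θ, e, h, rfl⟩
  rw [SetLike.mem_coe, Submodule.mem_comap, mapCoeff_point]
  exact Submodule.subset_span ⟨σ ∘ θ, e, congrArg σ h, rfl⟩

/-- There is a left inverse of `specialize θ` in degree `n` which kills `N` and the powers of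
the forms on the line `ℓ`. -/
def Separates (n : ℕ) (N : Submodule F (WordAlgebra F Alphabet)) (θ : Fin 2 → F)
    (ℓ : Fin 2 × F) : Prop :=
  ∃ π : WordAlgebra F Alphabet →ₗ[F] WordAlgebra F (Fin 2),
    (∀ p ∈ letters F (Fin 2) ^ n, π (specialize θ p) = p) ∧
    (∀ y ∈ lineSpan ℓ ^ n, π y = 0) ∧ ∀ y ∈ N, π y = 0

lemma separates_of_forall_eq_zero {n : ℕ} {N : Submodule F (WordAlgebra F Alphabet)}
    {θ : Fin 2 → F} {ℓ : Fin 2 × F}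
    (h : ∀ p ∈ letters F (Fin 2) ^ n, specialize θ p ∈ lineSpan ℓ ^ n ⊔ N → p = 0) :
    Separates n N θ ℓ := by
  let g : ↥(letters F (Fin 2) ^ n) →ₗ[F] (WordAlgebra F Alphabet ⧸ (lineSpan ℓ ^ n ⊔ N)) :=
    Submodule.mkQ _ ∘ₗ (specialize θ).toLinearMap ∘ₗ Submodule.subtype _
  have hg : LinearMap.ker g = ⊥ := by
    rw [LinearMap.ker_eq_bot']
    rintro ⟨p, hp⟩ hgp
    refine Subtype.ext (h p hp ?_)
    simpa [g] using hgp
  obtain ⟨r, hr⟩ := g.exists_leftInverse_of_injective hg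
  refine ⟨Submodule.subtype _ ∘ₗ r ∘ₗ Submodule.mkQ _, fun p hp => ?_, fun y hy => ?_,
    fun y hy => ?_⟩
  · exact congrArg Subtype.val (LinearMap.congr_fun hr ⟨p, hp⟩)
  · have : Submodule.mkQ (lineSpan ℓ ^ n ⊔ N) y = 0 :=
      (Submodule.Quotient.mk_eq_zero _).2 (Submodule.mem_sup_left hy)
    rw [LinearMap.comp_apply, LinearMap.comp_apply, this, map_zero, map_zero]
  · have : Submodule.mkQ (lineSpan ℓ ^ n ⊔ N) y = 0 :=
      (Submodule.Quotient.mk_eq_zero _).2 (Submodule.mem_sup_right hy)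
    rw [LinearMap.comp_apply, LinearMap.comp_apply, this, map_zero, map_zero]

lemma separates_one {θ : Fin 2 → F} {ℓ : Fin 2 × F} (h : θ ℓ.1 ≠ ℓ.2) :
    Separates 1 ⊥ θ ℓ := by
  obtain ⟨c, τ⟩ := ℓ
  have hθ : θ c - τ ≠ 0 := sub_ne_zero.2 h
  let κ : WordAlgebra F Alphabet →ₗ[F] WordAlgebra F (Fin 2) := ofWords fun w =>
    match w.toList with
    | [(e, none)] => (-τ) • word (FreeMonoid.of e)
    | [(e, some c')] => if c' = c then word (FreeMonoid.of e) else 0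
    | _ => 0
  have hκ : ∀ θ' e, κ (point θ' e) = (θ' c - τ) • word (FreeMonoid.of e) := by
    intro θ' e
    simp only [κ, point, map_add, map_sum, map_smul, ofWords_word, FreeMonoid.toList_of]
    simp only [smul_ite, smul_zero, Finset.sum_ite_eq', Finset.mem_univ, if_true]
    rw [← add_smul, neg_add_eq_sub]
  refine ⟨(θ c - τ)⁻¹ • κ, fun p hp => ?_, fun y hy => ?_, by simp⟩
  · refine eqOn_letters_pow (π := ((θ c - τ)⁻¹ • κ) ∘ₗ (specialize θ).toLinearMap)
      (ρ := LinearMap.id) (fun w hw => ?_) hp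
    obtain ⟨e, rfl⟩ := FreeMonoid.length_eq_one.1 hw
    simp [hκ, smul_smul, inv_mul_cancel₀ hθ]
  · rw [pow_one, lineSpan] at hy
    induction hy using Submodule.span_induction with
    | mem x hx =>
      obtain ⟨θ', e, h', rfl⟩ := hx
      simp only at h'
      simp [hκ, h']
    | zero => simp
    | add x y _ _ hx hy => rw [map_add, hx, hy, add_zero]
    | smul r x _ hx => rw [map_smul, hx, smul_zero]

/-- The sum of `N` placed in each of `k` consecutive blocks of length `n`. -/
noncomputable def blocks (n k : ℕ) (N : Submodule F (WordAlgebra F Alphabet)) :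
    Submodule F (WordAlgebra F Alphabet) :=
  ⨆ (s : ℕ) (s' : ℕ) (_ : s' + 1 + s = k),
    letters F Alphabet ^ (n * s') * N * letters F Alphabet ^ (n * s)

lemma exists_slots {n : ℕ} {N : Submodule F (WordAlgebra F Alphabet)}
    (hN : N ≤ letters F Alphabet ^ n) {θ : Fin 2 → F} (l : List (Fin 2 × F))
    (hl : ∀ ℓ ∈ l, Separates n N θ ℓ) :
    ∃ π : WordAlgebra F Alphabet →ₗ[F] WordAlgebra F (Fin 2),
      (∀ p ∈ letters F (Fin 2) ^ (n * l.length), π (specialize θ p) = p) ∧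
      (∀ ℓ ∈ l, ∀ y ∈ lineSpan ℓ ^ (n * l.length), π y = 0) ∧
      ∀ y ∈ blocks n l.length N, π y = 0 := by
  induction l with
  | nil =>
    refine ⟨ofWords fun w => if w.length = 0 then 1 else 0, fun p hp => ?_, by simp, fun y hy => ?_⟩
    · rw [List.length_nil, mul_zero, pow_zero, Submodule.mem_one] at hp
      obtain ⟨r, rfl⟩ := hp
      rw [Algebra.algebraMap_eq_smul_one, map_smul, map_one, map_smul]
      exact congrArg (r • ·) (ofWords_word _ 1)
    · have : blocks n 0 N = ⊥ := by simp [blocks]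
      rw [List.length_nil, this, Submodule.mem_bot] at hy
      rw [hy, map_zero]
  | cons ℓ l ih =>
    obtain ⟨ρ, hρ1, hρ2, hρ3⟩ := ih fun ℓ' h => hl ℓ' (List.mem_cons_of_mem _ h)
    obtain ⟨π, hπ1, hπ2, hπ3⟩ := hl ℓ List.mem_cons_self
    have hlen : n * (ℓ :: l).length = n + n * l.length := by
      rw [List.length_cons, mul_add, mul_one, add_comm]
    have hker : ∀ (A B : Submodule F (WordAlgebra F Alphabet)), A ≤ letters F Alphabet ^ n →
        ((∀ y ∈ A, π y = 0) ∨ ∀ y ∈ B, ρ y = 0) → ∀ y ∈ A * B, splitMul n π ρ y = 0 := by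
      intro A B hA h y hy
      refine Submodule.mul_induction_on hy (fun a ha b hb => ?_) fun a b ha hb => ?_
      · rw [splitMul_mul _ _ (hA ha)]
        rcases h with h | h
        · rw [h a ha, zero_mul]
        · rw [h b hb, mul_zero]
      · rw [map_add, ha, hb, add_zero]
    refine ⟨splitMul n π ρ, fun p hp => ?_, fun ℓ' hℓ' y hy => ?_, fun y hy => ?_⟩
    · rw [hlen, pow_add] at hp
      refine Submodule.mul_induction_on hp (fun a ha b hb => ?_) fun a b ha hb => ?_
      · rw [map_mul, splitMul_mul _ _ (specialize_mem_letters_pow θ ha), hπ1 a ha, hρ1 b hb]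
      · rw [map_add, map_add, ha, hb]
    · rw [hlen, pow_add] at hy
      refine hker _ _ (pow_le_pow_left' (lineSpan_le_letters ℓ') n) ?_ y hy
      rcases List.mem_cons.1 hℓ' with rfl | h
      · exact Or.inl hπ2
      · exact Or.inr (hρ2 ℓ' h)
    · have hle : blocks n (ℓ :: l).length N ≤ LinearMap.ker (splitMul n π ρ) := by
        refine iSup_le fun s => iSup_le fun s' => iSup_le fun hs => ?_
        intro y hy
        rw [LinearMap.mem_ker]
        rcases s' with _ | s'
        · rw [mul_zero, pow_zero, one_mul] at hy
          exact hker _ _ hN (Or.inl hπ3) y hy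
        · rw [mul_add, mul_one, add_comm, pow_add, mul_assoc, mul_assoc, ← mul_assoc (_ ^ (n * s'))]
            at hy
          refine hker _ _ le_rfl (Or.inr fun z hz => hρ3 z ?_) y hy
          rw [List.length_cons] at hs
          exact Submodule.mem_iSup_of_mem s (Submodule.mem_iSup_of_mem s'
            (Submodule.mem_iSup_of_mem (by omega) hz))
      exact hle hy

end Specialization

section Levels

variable {K F : Type} [Field K] [Field F] [Algebra K F]

lemma blocks_le_comap {n : ℕ} {N : Submodule F (WordAlgebra F Alphabet)} {σ : F →+* F}
    (hN : N ≤ N.comap (mapCoeff _ σ)) (k : ℕ) :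
    blocks n k N ≤ (blocks n k N).comap (mapCoeff _ σ) := by
  refine iSup_le fun s => iSup_le fun s' => iSup_le fun hs => ?_
  refine (mul_le_comap σ (mul_le_comap σ (pow_le_comap σ (letters_le_comap σ) _) hN)
    (pow_le_comap σ (letters_le_comap σ) _)).trans (Submodule.comap_mono ?_)
  exact le_iSup_of_le s (le_iSup_of_le s' (le_iSup_of_le hs le_rfl))

lemma blocks_le_letters_pow {n : ℕ} {N : Submodule F (WordAlgebra F Alphabet)}
    (hN : N ≤ letters F Alphabet ^ n) (k : ℕ) : blocks n k N ≤ letters F Alphabet ^ (n * k) := by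
  refine iSup_le fun s => iSup_le fun s' => iSup_le fun hs => ?_
  refine (mul_le_mul' (mul_le_mul' le_rfl hN) le_rfl).trans (le_of_eq ?_)
  rw [← pow_add, ← pow_add, ← hs, mul_add, mul_add, mul_one]

variable (K) in
/-- Any three distinct members of the family `t` can be moved to any three others by an
endomorphism of `F` over `K`. -/
def TriplyTransitive (t : ℕ → F) : Prop :=
  ∀ a b e a' b' e' : ℕ, a ≠ b → a ≠ e → b ≠ e → a' ≠ b' → a' ≠ e' → b' ≠ e' →
    ∃ σ : F →ₐ[K] F, σ (t a) = t a' ∧ σ (t b) = t b' ∧ σ (t e) = t e'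

variable (K) in
/-- A space of homogeneous elements of degree `n`, stable under the endomorphisms of `F` over `K`,
which can be killed together with all the forms on a line without losing the forms at a point,
where the point and the line are given by distinct members of `t`. -/
structure IsLevel (t : ℕ → F) (n : ℕ) (N : Submodule F (WordAlgebra F Alphabet)) : Prop where
  pos : 0 < n
  le_letters_pow : N ≤ letters F Alphabet ^ n
  le_comap : ∀ σ : F →ₐ[K] F, N ≤ N.comap (mapCoeff _ (σ : F →+* F))
  separates : ∀ a b e : ℕ, a ≠ b → a ≠ e → b ≠ e → ∀ c : Fin 2,
    Separates n N ![t a, t b] (c, t e)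

variable {t : ℕ → F}

lemma isLevel_one (ht : Function.Injective t) : IsLevel K t 1 ⊥ where
  pos := one_pos
  le_letters_pow := bot_le
  le_comap _ := bot_le
  separates a b e _ hae hbe c := separates_one <| by
    fin_cases c
    · exact fun h => hae (ht h)
    · exact fun h => hbe (ht h)

lemma separates_blocks_sup (hσ : TriplyTransitive K t) {n g : ℕ}
    {N U : Submodule F (WordAlgebra F Alphabet)} (hN : IsLevel K t n N) [FiniteDimensional F U]
    (hU : Module.finrank F U < g * g)
    (hUσ : ∀ σ : F →ₐ[K] F, U ≤ U.comap (mapCoeff _ (σ : F →+* F)))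
    {a b e : ℕ} (hab : a ≠ b) (hae : a ≠ e) (hbe : b ≠ e) (c : Fin 2) :
    Separates (n * (g + g)) (blocks n (g + g) N ⊔ U) ![t a, t b] (c, t e) := by
  refine separates_of_forall_eq_zero fun p hp hmem => ?_
  by_contra hp0
  have hmove : ∀ z : Fin g × Fin g, ∃ P ∈ letters F (Fin 2) ^ (n * (g + g)), P ≠ 0 ∧ ∃ u : U,
      specialize ![t z.1, t (g + z.2)] P - u ∈
        lineSpan (c, t (g + g)) ^ (n * (g + g)) ⊔ blocks n (g + g) N := by
    rintro ⟨i, j⟩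
    obtain ⟨σ, h1, h2, h3⟩ := hσ a b e i (g + j) (g + g) hab hae hbe (by omega) (by omega)
      (by omega)
    refine ⟨mapCoeff _ (σ : F →+* F) p, pow_le_comap _ (letters_le_comap _) _ hp, ?_, ?_⟩
    · rwa [Ne, map_eq_zero_iff _ (mapCoeff_injective _ (σ : F →+* F).injective)]
    · have hθ : ![t i, t (g + j)] = (σ : F →+* F) ∘ ![t a, t b] := by
        ext x
        fin_cases x
        · exact h1.symm
        · exact h2.symm
      rw [← sup_assoc] at hmem
      obtain ⟨v, hv, u, hu, huv⟩ := Submodule.mem_sup.1 hmem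
      refine ⟨⟨mapCoeff _ (σ : F →+* F) u, hUσ σ hu⟩, ?_⟩
      rw [hθ, ← mapCoeff_specialize, ← huv, map_add, add_sub_cancel_right]
      obtain ⟨q, hq, ν, hν, rfl⟩ := Submodule.mem_sup.1 hv
      rw [map_add]
      refine Submodule.add_mem_sup ?_ (blocks_le_comap (hN.le_comap σ) _ hν)
      have := pow_le_comap _ (lineSpan_le_comap (σ : F →+* F) c (t e)) _ hq
      rwa [show (σ : F →+* F) (t e) = t (g + g) from h3] at this
  choose P hP hP0 u hu using hmove
  have hdep : ¬ LinearIndependent F u := fun h => by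
    have := h.fintype_card_le_finrank
    rw [Fintype.card_prod, Fintype.card_fin] at this
    omega
  obtain ⟨r, hr, z, hz⟩ := Fintype.not_linearIndependent_iff.1 hdep
  let l : List (Fin 2 × F) :=
    (List.finRange g).map (fun i => if i = z.1 then (c, t (g + g)) else (0, t i)) ++
      (List.finRange g).map fun j => if j = z.2 then (c, t (g + g)) else (1, t (g + j))
  have hlen : l.length = g + g := by simp [l]
  have hl : ∀ ℓ ∈ l, Separates n N ![t z.1, t (g + z.2)] ℓ := by
    intro ℓ hℓ
    have hsep := hN.separates z.1 (g + z.2) (g + g) (by omega) (by omega) (by omega) c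
    simp only [l, List.mem_append, List.mem_map, List.mem_finRange, true_and] at hℓ
    obtain ⟨i, rfl⟩ | ⟨j, rfl⟩ := hℓ
    · split_ifs with h
      · exact hsep
      · exact hN.separates _ _ _ (by omega) (by omega) (by omega) _
    · split_ifs with h
      · exact hsep
      · exact hN.separates _ _ _ (by omega) (by omega) (by omega) _
  obtain ⟨π, hπ1, hπ2, hπ3⟩ := exists_slots hN.le_letters_pow l hl
  rw [hlen] at hπ1 hπ2 hπ3
  have hline : (c, t (g + g)) ∈ l :=
    List.mem_append_left _ (List.mem_map.2 ⟨z.1, List.mem_finRange _, if_pos rfl⟩)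
  have hπu : ∀ y, π (u y) = π (specialize ![t y.1, t (g + y.2)] (P y)) := by
    intro y
    obtain ⟨q, hq, ν, hν, h⟩ := Submodule.mem_sup.1 (hu y)
    rw [eq_comm, ← sub_eq_zero, ← map_sub, ← h, map_add, hπ2 _ hline q hq, hπ3 ν hν, add_zero]
  have hother : ∀ y, y ≠ z → π (u y) = 0 := by
    rintro ⟨i, j⟩ hy
    rw [hπu]
    by_cases hi : i = z.1
    · have hj : j ≠ z.2 := fun h => hy (Prod.ext hi h)
      refine hπ2 (1, t (g + j)) ?_ _ (specialize_mem_lineSpan_pow rfl (hP _))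
      refine List.mem_append_right _ (List.mem_map.2 ⟨j, List.mem_finRange j, if_neg hj⟩)
    · refine hπ2 (0, t i) ?_ _ (specialize_mem_lineSpan_pow rfl (hP _))
      refine List.mem_append_left _ (List.mem_map.2 ⟨i, List.mem_finRange i, if_neg hi⟩)
  have hsum := congrArg (fun y : U => π y) hr
  simp only [Submodule.coe_sum, Submodule.coe_smul, map_sum, map_smul, Submodule.coe_zero,
    map_zero] at hsum
  rw [Finset.sum_eq_single z (fun y _ hy => by rw [hother y hy, smul_zero])
    (fun h => absurd (Finset.mem_univ z) h), hπu, hπ1 _ (hP z)] at hsum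
  exact (smul_ne_zero hz (hP0 z)) hsum

lemma exists_next_level (hσ : TriplyTransitive K t) {n : ℕ}
    {N : Submodule F (WordAlgebra F Alphabet)} (hN : IsLevel K t n N)
    (f : WordAlgebra K Alphabet) :
    ∃ k N', 1 < k ∧ IsLevel K t (n * k) N' ∧ blocks n k N ≤ N' ∧
      ∀ p, mapCoeff _ (algebraMap K F) (gate f (n * k) p) ∈ N' := by
  set W := {w : FreeMonoid Alphabet | w.length ≤ (homogenize f).natDegree}
  have hW : Finite W := List.finite_length_le Alphabet _
  have := Fintype.ofFinite W
  set C := Fintype.card W * Fintype.card W + 2 * (homogenize f).natDegree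
  set g := C * (2 * n + 1) + 1
  set L := n * (g + g)
  have hn := hN.pos
  let G : (W × W) × Fin (L + 1) → WordAlgebra F Alphabet :=
    fun p => mapCoeff _ (algebraMap K F) (gate f L p)
  have hfin : Module.finrank F (Submodule.span F (Set.range G)) < g * g := by
    refine (finrank_range_le_card G).trans_lt ?_
    rw [Fintype.card_prod, Fintype.card_prod, Fintype.card_fin]
    have h1 : Fintype.card W * Fintype.card W ≤ C := Nat.le_add_right _ _
    have h2 : C * (L + 1) ≤ C * ((2 * n + 1) * g) := by
      refine Nat.mul_le_mul_left _ ?_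
      simp only [L, g]
      nlinarith
    calc _ ≤ C * (L + 1) := Nat.mul_le_mul_right _ h1
      _ ≤ C * ((2 * n + 1) * g) := h2
      _ < g * g := by
        rw [← mul_assoc]
        exact Nat.mul_lt_mul_of_pos_right (Nat.lt_succ_self _) (Nat.succ_pos _)
  have hCg : C ≤ g := by
    simp only [g]
    nlinarith
  have hdL : 2 * (homogenize f).natDegree ≤ L := by
    have : 2 * (homogenize f).natDegree ≤ C := Nat.le_add_left _ _
    simp only [L]
    nlinarith
  have hUσ : ∀ σ : F →ₐ[K] F, Submodule.span F (Set.range G) ≤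
      (Submodule.span F (Set.range G)).comap (mapCoeff _ (σ : F →+* F)) := by
    intro σ
    rw [Submodule.span_le]
    rintro _ ⟨p, rfl⟩
    refine Submodule.subset_span ⟨p, ?_⟩
    simp only [G]
    generalize gate f L p = x
    refine MonoidAlgebra.coeff_injective (Finsupp.ext fun w => ?_)
    simp [mapCoeff]
  have hUL : Submodule.span F (Set.range G) ≤ letters F Alphabet ^ L := by
    rw [Submodule.span_le]
    rintro _ ⟨p, rfl⟩
    exact pow_le_comap _ (letters_le_comap _) _ (gate_mem hdL p)
  have hfd : FiniteDimensional F (Submodule.span F (Set.range G)) :=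
    FiniteDimensional.span_of_finite F (Set.finite_range G)
  refine ⟨g + g, blocks n (g + g) N ⊔ Submodule.span F (Set.range G), by simp only [g]; omega, ?_,
    le_sup_left,
    fun p => Submodule.mem_sup_right (Submodule.subset_span ⟨p, rfl⟩)⟩
  exact
    { pos := Nat.mul_pos hn (by simp only [g]; omega)
      le_letters_pow := sup_le (blocks_le_letters_pow hN.le_letters_pow _) hUL
      le_comap := fun σ => sup_le
        ((blocks_le_comap (hN.le_comap σ) _).trans (Submodule.comap_mono le_sup_left))
        ((hUσ σ).trans (Submodule.comap_mono le_sup_right))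
      separates := fun a b e hab hae hbe c =>
        separates_blocks_sup hσ hN hfin hUσ hab hae hbe c }

end Levels

section Tower

variable {K F : Type} [Field K] [Field F] [Algebra K F]

/-- A sequence of levels, each containing the previous one in all its blocks, such that high powers
of `f j` factor through the level `j + 1`. -/
structure IsTower (t : ℕ → F) (f : ℕ → WordAlgebra K Alphabet) (n : ℕ → ℕ)
    (N : ℕ → Submodule F (WordAlgebra F Alphabet)) : Prop where
  isLevel : ∀ j, IsLevel K t (n j) (N j)
  exists_blocks_le : ∀ j, ∃ k, 1 < k ∧ n (j + 1) = n j * k ∧ blocks (n j) k (N j) ≤ N (j + 1)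
  gate_mem : ∀ j p, mapCoeff _ (algebraMap K F) (gate (f j) (n (j + 1)) p) ∈ N (j + 1)

variable {t : ℕ → F}

lemma exists_isTower (ht : Function.Injective t) (hσ : TriplyTransitive K t)
    (f : ℕ → WordAlgebra K Alphabet) : ∃ n N, IsTower t f n N := by
  let Level := {x : ℕ × Submodule F (WordAlgebra F Alphabet) // IsLevel K t x.1 x.2}
  have hnext : ∀ (j : ℕ) (x : Level), ∃ y : Level,
      (∃ k, 1 < k ∧ y.1.1 = x.1.1 * k ∧ blocks x.1.1 k x.1.2 ≤ y.1.2) ∧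
      ∀ p, mapCoeff _ (algebraMap K F) (gate (f j) y.1.1 p) ∈ y.1.2 := by
    rintro j ⟨⟨n, N⟩, h⟩
    obtain ⟨k, N', hk, h1, h2, h3⟩ := exists_next_level hσ h (f j)
    exact ⟨⟨⟨n * k, N'⟩, h1⟩, ⟨k, hk, rfl, h2⟩, h3⟩
  choose next hnext1 hnext2 using hnext
  let x : ℕ → Level := Nat.rec ⟨⟨1, ⊥⟩, isLevel_one ht⟩ next
  exact ⟨fun j => (x j).1.1, fun j => (x j).1.2, fun j => (x j).2,
    fun j => hnext1 j (x j), fun j => hnext2 j (x j)⟩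

variable {f : ℕ → WordAlgebra K Alphabet} {n : ℕ → ℕ}
  {N : ℕ → Submodule F (WordAlgebra F Alphabet)}

namespace IsTower

lemma strictMono (h : IsTower t f n N) : StrictMono n := by
  refine strictMono_nat_of_lt_succ fun j => ?_
  obtain ⟨k, hk, hnk, -⟩ := h.exists_blocks_le j
  rw [hnk]
  exact lt_mul_of_one_lt_right (h.isLevel j).pos hk

lemma dvd (h : IsTower t f n N) {i j : ℕ} (hij : i ≤ j) : n i ∣ n j := by
  induction j, hij using Nat.le_induction with
  | base => exact dvd_rfl
  | succ j _ ih =>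
    obtain ⟨k, -, hnk, -⟩ := h.exists_blocks_le j
    exact ih.trans ⟨k, hnk⟩

lemma letters_pow_mul_le (h : IsTower t f n N) {i j : ℕ} (hij : i ≤ j) {m s : ℕ}
    (hm : m + n i + n i * s = n j) :
    letters F Alphabet ^ m * N i * letters F Alphabet ^ (n i * s) ≤ N j := by
  induction j, hij using Nat.le_induction generalizing m s with
  | base =>
    rw [show m = 0 by omega, show n i * s = 0 by omega, pow_zero, one_mul, mul_one]
  | succ j hij ih =>
    obtain ⟨k, -, hnk, hle⟩ := h.exists_blocks_le j
    obtain ⟨d, hd⟩ := h.dvd hij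
    have hi := (h.isLevel i).pos
    have hj := (h.isLevel j).pos
    have hd0 : 0 < d := Nat.pos_of_mul_pos_left (hd ▸ hj)
    have hs := Nat.div_add_mod s d
    have hs0 := Nat.mod_lt s hd0
    set s₁ := s / d
    set s₀ := s % d
    obtain ⟨r, hr⟩ : ∃ r, d = s₀ + 1 + r := Nat.exists_eq_add_of_le hs0
    have hlen : n i * s = n i * s₀ + n j * s₁ := by
      rw [← hs, hd]
      ring
    have hnj : n i * r + n i + n i * s₀ = n j := by
      rw [hd]
      conv_rhs => rw [hr]
      ring
    have hs₁ : s₁ < k := by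
      refine Nat.lt_of_mul_lt_mul_left (a := n j) ?_
      omega
    obtain ⟨s', hs'⟩ : ∃ s', k = s₁ + 1 + s' := Nat.exists_eq_add_of_le hs₁
    have hmm : m = n j * s' + n i * r := by
      have : n j * k = n j * s₁ + n j + n j * s' := by
        rw [hs']
        ring
      omega
    rw [hlen, hmm, add_comm (n i * s₀), add_comm (n j * s₁), pow_add, pow_add]
    calc _ = letters F Alphabet ^ (n j * s') *
          (letters F Alphabet ^ (n i * r) * N i * letters F Alphabet ^ (n i * s₀)) *
          letters F Alphabet ^ (n j * s₁) := by simp only [mul_assoc]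
      _ ≤ letters F Alphabet ^ (n j * s') * N j * letters F Alphabet ^ (n j * s₁) :=
        mul_le_mul' (mul_le_mul' le_rfl (ih hnj)) le_rfl
      _ ≤ blocks (n j) k (N j) := le_iSup_of_le s₁ (le_iSup_of_le s'
        (le_iSup_of_le (by omega) le_rfl))
      _ ≤ N (j + 1) := hle

end IsTower

/-- The left ideal generated by the levels at positions divisible by their degrees from the
right. -/
noncomputable def towerIdeal (n : ℕ → ℕ) (N : ℕ → Submodule F (WordAlgebra F Alphabet)) :
    Ideal (WordAlgebra F Alphabet) :=
  Ideal.span {y | ∃ j s, y ∈ N j * letters F Alphabet ^ (n j * s)}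

lemma top_mul_le_towerIdeal (j s : ℕ) :
    ⊤ * N j * letters F Alphabet ^ (n j * s) ≤ (towerIdeal n N).restrictScalars F := by
  rw [mul_assoc, Submodule.mul_le]
  exact fun x _ y hy => Ideal.mul_mem_left _ x (Ideal.subset_span ⟨j, s, hy⟩)

namespace IsTower

lemma restrict_eq_zero (h : IsTower t f n N) {j : ℕ}
    {π : WordAlgebra F Alphabet →ₗ[F] WordAlgebra F (Fin 2)} (hπ : ∀ y ∈ N j, π y = 0)
    {y : WordAlgebra F Alphabet} (hy : y ∈ towerIdeal n N) : restrict (n j) π y = 0 := by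
  suffices ∀ x, restrict (n j) π (x * y) = 0 by simpa using this 1
  induction hy using Submodule.span_induction with
  | zero => simp
  | add y z _ _ hy hz => exact fun x => by rw [mul_add, map_add, hy, hz, add_zero]
  | smul a y _ hy => exact fun x => by rw [smul_eq_mul, ← mul_assoc, hy]
  | mem y hy =>
    obtain ⟨i, s, hy⟩ := hy
    intro x
    induction x using word_induction with
    | zero => simp
    | add x z hx hz => rw [add_mul, map_add, hx, hz, add_zero]
    | smul r x hx => rw [smul_mul_assoc, map_smul, hx, smul_zero]
    | word w =>
      have hwy : word w * y ∈ letters F Alphabet ^ w.length * N i *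
          letters F Alphabet ^ (n i * s) := by
        rw [mul_assoc]
        exact Submodule.mul_mem_mul (word_mem_letters_pow w) hy
      have hdeg : word w * y ∈ letters F Alphabet ^ (w.length + n i + n i * s) := by
        rw [pow_add, pow_add]
        exact mul_le_mul' (mul_le_mul' le_rfl (h.isLevel i).le_letters_pow) le_rfl hwy
      rw [restrict_apply π hdeg]
      split_ifs with hw
      · have hij : i ≤ j := h.strictMono.le_iff_le.1 (by omega)
        exact hπ _ (h.letters_pow_mul_le hij hw hwy)
      · rfl

lemma eq_zero_of_specialize_mem (h : IsTower t f n N) {p : WordAlgebra F (Fin 2)}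
    (hp : specialize ![t 0, t 1] p ∈ towerIdeal n N) : p = 0 := by
  have hcoeff : ∀ m, (homogenize p).coeff m = 0 := by
    intro m
    obtain ⟨π, hπ1, -, hπ2⟩ := (h.isLevel m).separates 0 1 2 (by simp) (by simp) (by simp) 0
    obtain ⟨l, hl⟩ := Nat.exists_eq_add_of_le' (h.strictMono.le_apply (x := m))
    let w : FreeMonoid (Fin 2) := FreeMonoid.ofList (List.replicate l 0)
    have hw : w.length = l := List.length_replicate
    have hR : ∀ q, restrict (n m) π (specialize ![t 0, t 1] (word w * q)) =
        word w * (homogenize q).coeff m := by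
      intro q
      induction q using word_induction with
      | zero => simp
      | add x z hx hz => rw [mul_add, map_add, map_add, hx, hz, map_add, Polynomial.coeff_add,
          mul_add]
      | smul r x hx => rw [mul_smul_comm, map_smul, map_smul, hx, map_smul, Polynomial.coeff_smul,
          mul_smul_comm]
      | word v =>
        have hv := word_mem_letters_pow (R := F) (w * v)
        rw [← word_mul, restrict_apply π (specialize_mem_letters_pow _ hv), homogenize_word,
          Polynomial.coeff_monomial]
        rw [FreeMonoid.length_mul, hw] at hv ⊢
        by_cases hvm : v.length = m
        · rw [if_pos (by omega), if_pos hvm, ← word_mul, hπ1]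
          rwa [hvm, ← hl] at hv
        · rw [if_neg (by omega), if_neg hvm, mul_zero]
    have h0 : word w * (homogenize p).coeff m = 0 := by
      rw [← hR, map_mul]
      exact h.restrict_eq_zero hπ2 (Ideal.mul_mem_left _ _ hp)
    have := splitMul_mul (ofWords fun _ => 1) LinearMap.id (word_mem_letters_pow (R := F) w)
      ((homogenize p).coeff m)
    simpa [h0] using this.symm
  rw [← sum_coeff_homogenize p (Nat.lt_succ_self _)]
  exact Finset.sum_eq_zero fun m _ => hcoeff m

lemma mapCoeff_pow_mul_mem (h : IsTower t f n N) {j : ℕ} (hf : (homogenize (f j)).coeff 0 = 0)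
    (x : WordAlgebra F Alphabet) :
    mapCoeff _ (algebraMap K F) (f j ^ (n (j + 1) + n (j + 1))) * x ∈ towerIdeal n N := by
  induction x using word_induction with
  | zero => simp
  | add x z hx hz => rw [mul_add]; exact add_mem hx hz
  | smul r x hx =>
    rw [mul_smul_comm]
    exact Submodule.smul_mem ((towerIdeal n N).restrictScalars F) r hx
  | word u =>
    set L := n (j + 1)
    have hmod : u.length % L < L := Nat.mod_lt u.length (h.isLevel (j + 1)).pos
    have hdiv := Nat.div_add_mod u.length L
    have hmem := pow_mem_top_mul_gate_mul hf (L := L) (c := L - u.length % L) (q := L + L)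
      (by omega)
    have hspan : Submodule.span K (Set.range (gate (f j) L)) ≤
        (N (j + 1)).comap (mapCoeff _ (algebraMap K F)) := by
      rw [Submodule.span_le]
      rintro _ ⟨p, rfl⟩
      exact h.gate_mem j p
    have hmem' := mul_le_comap _ (mul_le_comap (A := ⊤) (A' := ⊤) _
      (fun _ _ => Submodule.mem_top) hspan)
      (pow_le_comap _ (letters_le_comap (algebraMap K F)) _) hmem
    refine top_mul_le_towerIdeal (j + 1) (u.length / L + 1) ?_
    rw [show n (j + 1) * (u.length / L + 1) = L - u.length % L + u.length by
      change L * _ = _; rw [mul_add, mul_one]; omega, pow_add, ← mul_assoc]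
    exact Submodule.mul_mem_mul hmem' (word_mem_letters_pow u)

end IsTower

end Tower

section ScalarExtension

variable {K F M : Type} [Field K] [Field F] [Algebra K F] [AddCommGroup M]

lemma not_hasFreeRankTwo_of_isNilpotent {E : Type} [Ring E] [Algebra K E]
    (A : NonUnitalSubalgebra K E) (hA : ∀ a ∈ A, IsNilpotent a) : ¬ HasFreeRankTwo K A := by
  rintro ⟨a, b, hab⟩
  obtain ⟨q, hq⟩ := hA a a.2
  have hw : ∀ q : ℕ, ∃ w : FreeSemigroup (Fin 2),
      (FreeSemigroup.lift (fun i : Fin 2 => if i = 0 then a else b) w : E) = a ^ (q + 1) := by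
    intro q
    induction q with
    | zero => exact ⟨FreeSemigroup.of 0, by simp⟩
    | succ q ih =>
      obtain ⟨w, hw⟩ := ih
      exact ⟨FreeSemigroup.of 0 * w, by simp [hw, pow_succ' _ (q + 1)]⟩
  obtain ⟨w, hw⟩ := hw q
  refine hab.ne_zero w (Subtype.ext ?_)
  rw [hw, pow_succ, hq, zero_mul]
  rfl

/-- A nonempty word as an element of the free monoid. -/
def toFreeMonoid {X : Type} (w : FreeSemigroup X) : FreeMonoid X :=
  FreeMonoid.ofList (w.head :: w.tail)

lemma toFreeMonoid_injective {X : Type} : Function.Injective (toFreeMonoid (X := X)) := by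
  intro v w h
  have h' : v.head :: v.tail = w.head :: w.tail := h
  exact FreeSemigroup.ext (List.cons.inj h').1 (List.cons.inj h').2

variable [Module K M] [Module (WordAlgebra F Alphabet) M]
  [IsScalarTower K (WordAlgebra F Alphabet) M]

variable (K F M) in
/-- The non-unital algebra of endomorphisms of `M` generated over `K` by the letters. -/
noncomputable def letterAlgebra : NonUnitalSubalgebra K (Module.End K M) :=
  NonUnitalAlgebra.adjoin K (Set.range fun x : Alphabet =>
    Algebra.lsmul K K M (word (FreeMonoid.of x) : WordAlgebra F Alphabet))

lemma exists_of_mem_letterAlgebra {a : Module.End K M} (ha : a ∈ letterAlgebra K F M) :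
    ∃ f : WordAlgebra K Alphabet, (homogenize f).coeff 0 = 0 ∧
      a = Algebra.lsmul K K M (mapCoeff _ (algebraMap K F) f) := by
  induction ha using NonUnitalAlgebra.adjoin_induction with
  | mem a ha =>
    obtain ⟨x, rfl⟩ := ha
    exact ⟨word (FreeMonoid.of x), by simp [homogenize_word, Polynomial.coeff_monomial],
      by rw [mapCoeff_word]⟩
  | add a b _ _ ha hb =>
    obtain ⟨f, hf, rfl⟩ := ha
    obtain ⟨g, hg, rfl⟩ := hb
    exact ⟨f + g, by simp [hf, hg], by rw [map_add, map_add]⟩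
  | zero => exact ⟨0, by simp, by rw [map_zero, map_zero]⟩
  | mul a b _ _ ha hb =>
    obtain ⟨f, hf, rfl⟩ := ha
    obtain ⟨g, hg, rfl⟩ := hb
    exact ⟨f * g, by simp [Polynomial.mul_coeff_zero, hf], by rw [mapCoeff_mul, map_mul]⟩
  | smul r a _ ha =>
    obtain ⟨f, hf, rfl⟩ := ha
    exact ⟨r • f, by simp [hf], by rw [map_smulₛₗ, algebraMap_smul, map_smul]⟩

lemma not_hasFreeRankTwo_letterAlgebra
    (h : ∀ f : WordAlgebra K Alphabet, (homogenize f).coeff 0 = 0 →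
      ∃ q, ∀ m : M, mapCoeff _ (algebraMap K F) (f ^ q) • m = 0) :
    ¬ HasFreeRankTwo K (letterAlgebra K F M) := by
  refine not_hasFreeRankTwo_of_isNilpotent _ fun a ha => ?_
  obtain ⟨f, hf, rfl⟩ := exists_of_mem_letterAlgebra ha
  obtain ⟨q, hq⟩ := h f hf
  refine ⟨q, LinearMap.ext fun m => ?_⟩
  have hpow : ∀ q, mapCoeff _ (algebraMap K F) (f ^ q) =
      mapCoeff _ (algebraMap K F) f ^ q := by
    intro q
    induction q with
    | zero => rw [pow_zero, pow_zero, mapCoeff_one]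
    | succ q ih => rw [pow_succ, pow_succ, mapCoeff_mul, ih]
  rw [← map_pow, ← hpow]
  exact hq m

variable (K F M) in
/-- A letter as a generator of the algebra. -/
noncomputable def letterGen (x : Alphabet) : letterAlgebra K F M :=
  ⟨_, NonUnitalAlgebra.subset_adjoin K ⟨x, rfl⟩⟩

lemma letterGen_apply (x : Alphabet) (m : M) :
    (letterGen K F M x : Module.End K M) m =
      (word (FreeMonoid.of x) : WordAlgebra F Alphabet) • m := rfl

variable [Module F M] [IsScalarTower K F M]

variable (K F) in
/-- The evaluation of the extended algebra at a vector. -/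
noncomputable def evalAt (v : M) : letterAlgebra K F M ⊗[K] F →ₗ[K] M :=
  TensorProduct.lift <| LinearMap.mk₂ K (fun a c => c • (a : Module.End K M) v)
    (fun a b c => by simp) (fun r a c => smul_comm c r _)
    (fun a c d => add_smul c d _)
    (fun r a c => smul_assoc r c _)

@[simp]
lemma evalAt_tmul (v : M) (a : letterAlgebra K F M) (c : F) :
    evalAt K F v (a ⊗ₜ c) = c • (a : Module.End K M) v := rfl

variable (K M) in
/-- The form `point θ e` in the extended algebra. -/
noncomputable def pointGen (θ : Fin 2 → F) (e : Fin 2) : letterAlgebra K F M ⊗[K] F :=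
  letterGen K F M (e, none) ⊗ₜ 1 + ∑ c, letterGen K F M (e, some c) ⊗ₜ θ c

variable [IsScalarTower F (WordAlgebra F Alphabet) M]

lemma evalAt_pointGen (θ : Fin 2 → F) (e : Fin 2) (v : M) :
    evalAt K F v (pointGen K M θ e) = point θ e • v := by
  simp [pointGen, point, letterGen_apply, add_smul]

lemma evalAt_pointGen_mul (θ : Fin 2 → F) (e : Fin 2) (v : M) (z : letterAlgebra K F M ⊗[K] F) :
    evalAt K F v (pointGen K M θ e * z) = point θ e • evalAt K F v z := by
  have := IsScalarTower.to_smulCommClass (R := F) (A := WordAlgebra F Alphabet) (M := M)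
  induction z with
  | zero => simp
  | add x y hx hy => rw [mul_add, map_add, map_add, hx, hy, smul_add]
  | tmul b d =>
    simp [pointGen, point, letterGen_apply, add_mul, add_smul, Algebra.TensorProduct.tmul_mul_tmul,
      mul_smul, smul_comm d]

lemma hasFreeRankTwo_letterAlgebra_tensor (θ : Fin 2 → F) (v : M)
    (h : ∀ p, specialize θ p • v = 0 → p = 0) :
    HasFreeRankTwo K (letterAlgebra K F M ⊗[K] F) := by
  refine ⟨pointGen K M θ 0, pointGen K M θ 1, LinearIndependent.of_comp (evalAt K F v) ?_⟩
  have hgen : (fun i : Fin 2 => if i = 0 then pointGen K M θ 0 else pointGen K M θ 1) =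
      pointGen K M θ := by
    ext i
    fin_cases i <;> rfl
  let ψ : WordAlgebra F (Fin 2) →ₗ[F] M :=
    LinearMap.toSpanSingleton (WordAlgebra F Alphabet) M v |>.restrictScalars F |>.comp
      (specialize θ).toLinearMap
  have hψ : LinearMap.ker ψ = ⊥ := LinearMap.ker_eq_bot'.2 h
  have hword : evalAt K F v ∘ (fun w => FreeSemigroup.lift
      (fun i : Fin 2 => if i = 0 then pointGen K M θ 0 else pointGen K M θ 1) w) =
      ψ ∘ word ∘ toFreeMonoid := by
    rw [hgen]
    ext w
    induction w using FreeSemigroup.recOnMul with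
    | ih1 e =>
      have : toFreeMonoid (FreeSemigroup.of e) = FreeMonoid.of e := rfl
      simp [ψ, this, evalAt_pointGen]
    | ih2 e w _ ih =>
      have : toFreeMonoid (FreeSemigroup.of e * w) = FreeMonoid.of e * toFreeMonoid w := rfl
      simp only [Function.comp_apply, this, map_mul, FreeSemigroup.lift_of, word_mul,
        evalAt_pointGen_mul] at ih ⊢
      rw [ih]
      simp [ψ, mul_smul]
  rw [hword]
  have hli : LinearIndependent F (word : FreeMonoid (Fin 2) → WordAlgebra F (Fin 2)) :=
    LinearIndependent.of_comp (MonoidAlgebra.coeffLinearEquiv F).toLinearMap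
      (Finsupp.linearIndependent_single_one F _)
  have hF := (hli.comp _ toFreeMonoid_injective).map' ψ hψ
  refine hF.restrict_scalars (R := K) ?_
  simpa [Algebra.smul_def] using (algebraMap K F).injective

end ScalarExtension

section Assembly

lemma triplyTransitive_X (K : Type) [Field K] :
    TriplyTransitive K fun i : ℕ => algebraMap (MvPolynomial ℕ K)
      (FractionRing (MvPolynomial ℕ K)) (MvPolynomial.X i) := by
  intro a b e a' b' e' hab hae hbe hab' hae' hbe'
  have hinj : ∀ x y z : ℕ, x ≠ y → x ≠ z → y ≠ z → Function.Injective ![x, y, z] := by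
    intro x y z hxy hxz hyz i j hij
    fin_cases i <;> fin_cases j <;> simp_all
  have := Equiv.Perm.isMultiplyPretransitive ℕ 3
  obtain ⟨τ, hτ⟩ := MulAction.exists_smul_eq (Equiv.Perm ℕ)
    (⟨_, hinj a b e hab hae hbe⟩ : Fin 3 ↪ ℕ) ⟨_, hinj a' b' e' hab' hae' hbe'⟩
  have hτ' : ∀ i, τ (![a, b, e] i) = ![a', b', e'] i := fun i => DFunLike.congr_fun hτ i
  let σ : FractionRing (MvPolynomial ℕ K) ≃ₐ[K] FractionRing (MvPolynomial ℕ K) :=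
    IsFractionRing.algEquivOfAlgEquiv (MvPolynomial.renameEquiv K τ)
  have hσ : ∀ i, σ (algebraMap (MvPolynomial ℕ K) _ (MvPolynomial.X i)) =
      algebraMap (MvPolynomial ℕ K) _ (MvPolynomial.X (τ i)) := by
    intro i
    rw [IsFractionRing.algEquivOfAlgEquiv_algebraMap]
    simp
  refine ⟨σ, (hσ a).trans ?_, (hσ b).trans ?_, (hσ e).trans ?_⟩
  · rw [show τ a = a' from hτ' 0]
  · rw [show τ b = b' from hτ' 1]
  · rw [show τ e = e' from hτ' 2]

lemma exists_forall_constantFree (K : Type) [Field K] [Countable K] :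
    ∃ f : ℕ → WordAlgebra K Alphabet,
      ∀ g : WordAlgebra K Alphabet, (homogenize g).coeff 0 = 0 → ∃ j, f j = g := by
  have : Countable (FreeMonoid Alphabet) := inferInstanceAs (Countable (List Alphabet))
  have : Countable (WordAlgebra K Alphabet) :=
    MonoidAlgebra.coeff_injective.countable
  have : Nonempty {g : WordAlgebra K Alphabet // (homogenize g).coeff 0 = 0} := ⟨⟨0, by simp⟩⟩
  obtain ⟨f, hf⟩ := exists_surjective_nat {g : WordAlgebra K Alphabet // (homogenize g).coeff 0 = 0}
  refine ⟨fun j => f j, fun g hg => ?_⟩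
  obtain ⟨j, hj⟩ := hf ⟨g, hg⟩
  exact ⟨j, congrArg Subtype.val hj⟩

end Assembly

end WordAlgebra

/-- Over every countable field `K` there are a field extension `F` of `K` and an associative
`K`-algebra `A` without free noncommutative subalgebras of rank two such that `A ⊗[K] F`
contains a free noncommutative `K`-subalgebra of rank two. -/
theorem stmt1 (K : Type) [Field K] [Countable K] :
    ∃ (F : Type) (_ : Field F) (_ : Algebra K F)
      (A : Type) (i₁ : NonUnitalRing A),
      letI := i₁
      ∃ (i₂ : Module K A),
        letI := i₂
        ∃ (_ : SMulCommClass K A A) (_ : IsScalarTower K A A),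
          ¬ HasFreeRankTwo K A ∧ HasFreeRankTwo K (A ⊗[K] F) := by
  let F := FractionRing (MvPolynomial ℕ K)
  let t : ℕ → F := fun i => algebraMap (MvPolynomial ℕ K) F (MvPolynomial.X i)
  have ht : Function.Injective t :=
    (IsFractionRing.injective (MvPolynomial ℕ K) F).comp MvPolynomial.X_injective
  obtain ⟨f, hf⟩ := WordAlgebra.exists_forall_constantFree K
  obtain ⟨n, N, h⟩ := WordAlgebra.exists_isTower ht (WordAlgebra.triplyTransitive_X K) f
  let M := WordAlgebra F WordAlgebra.Alphabet ⧸ WordAlgebra.towerIdeal n N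
  refine ⟨F, inferInstance, inferInstance, WordAlgebra.letterAlgebra K F M, inferInstance,
    inferInstance, inferInstance, inferInstance, ?_, ?_⟩
  · refine WordAlgebra.not_hasFreeRankTwo_letterAlgebra fun g hg => ?_
    obtain ⟨j, rfl⟩ := hf g hg
    refine ⟨n (j + 1) + n (j + 1), fun m => ?_⟩
    obtain ⟨x, rfl⟩ := Submodule.Quotient.mk_surjective _ m
    exact (Submodule.Quotient.mk_eq_zero _).2 (h.mapCoeff_pow_mul_mem hg x)
  · refine WordAlgebra.hasFreeRankTwo_letterAlgebra_tensor ![t 0, t 1]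
      (Submodule.Quotient.mk 1 : M) fun p hp => h.eq_zero_of_specialize_mem ?_
    rw [← mul_one (WordAlgebra.specialize ![t 0, t 1] p)]
    exact (Submodule.Quotient.mk_eq_zero _).1 hp
end

section
/- For every countable field K there exist a field extension F of K and a nil associative K-algebra R (every element of R is nilpotent) such that the K-algebra R ⊗_K F obtained by extending scalars contains a free noncommutative K-subalgebra of rank two. -/
open scoped TensorProduct

/-- `powSucc a n = a ^ (n + 1)`, defined without reference to a multiplicative unit. -/
def powSucc {B : Type} [Mul B] (a : B) : ℕ → B
  | 0 => a
  | n + 1 => powSucc a n * a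

/-- A (possibly non-unital) ring is nil if every element has a positive power equal to zero. -/
def IsNilRing (B : Type) [Mul B] [Zero B] : Prop := ∀ a : B, ∃ n : ℕ, powSucc a n = 0

section WordFunctionals

variable {K X : Type} [Field K]

/-- The word `l`, as an element of the free unital algebra `K⟨X⟩`. -/
noncomputable def wordMonomial (K : Type) {X : Type} [Field K] (l : List X) :
    MonoidAlgebra K (FreeMonoid X) :=
  MonoidAlgebra.single (FreeMonoid.ofList l) 1

lemma wordMonomial_nil : wordMonomial K ([] : List X) = 1 := rfl

lemma wordMonomial_append (s t : List X) :
    wordMonomial K (s ++ t) = wordMonomial K s * wordMonomial K t := by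
  simp [wordMonomial, MonoidAlgebra.single_mul_single]

lemma wordMonomial_cons (x : X) (t : List X) :
    wordMonomial K (x :: t) = wordMonomial K [x] * wordMonomial K t :=
  wordMonomial_append [x] t

/-- The linear extension to `K⟨X⟩` of a function on words. -/
noncomputable def wordPairing (φ : List X → K) : MonoidAlgebra K (FreeMonoid X) →ₗ[K] K :=
  Finsupp.linearCombination K (fun m : FreeMonoid X => φ m.toList) ∘ₗ
    (MonoidAlgebra.coeffLinearEquiv K).toLinearMap

@[simp] lemma wordPairing_wordMonomial (φ : List X → K) (l : List X) :
    wordPairing φ (wordMonomial K l) = φ l := by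
  simp [wordPairing, wordMonomial]

lemma mem_span_wordMonomial (x : MonoidAlgebra K (FreeMonoid X)) :
    x ∈ Submodule.span K (wordMonomial K '' {l : List X | x.coeff (FreeMonoid.ofList l) ≠ 0}) := by
  refine Submodule.span_mono ?_ (MonoidAlgebra.mem_span_support_coeff x)
  rintro _ ⟨m, hm, rfl⟩
  exact ⟨m.toList, by simpa using hm, rfl⟩

lemma wordLinearMap_ext {M : Type*} [AddCommMonoid M] [Module K M]
    {f g : MonoidAlgebra K (FreeMonoid X) →ₗ[K] M}
    (h : ∀ l, f (wordMonomial K l) = g (wordMonomial K l)) : f = g := by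
  refine LinearMap.ext fun x => ?_
  have hx := Submodule.span_mono (Set.image_subset_range _ _) (mem_span_wordMonomial x)
  induction hx using Submodule.span_induction with
  | mem x hx => obtain ⟨l, rfl⟩ := hx; exact h l
  | zero => simp
  | add x y _ _ hx hy => simp [hx, hy]
  | smul a x _ hx => simp [hx]

lemma wordPairing_add (φ ψ : List X → K) :
    wordPairing (φ + ψ) = wordPairing φ + wordPairing ψ :=
  wordLinearMap_ext fun l => by simp

lemma wordPairing_smul (c : K) (φ : List X → K) :
    wordPairing (c • φ) = c • wordPairing φ :=
  wordLinearMap_ext fun l => by simp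

@[simp] lemma wordPairing_zero : wordPairing (0 : List X → K) = 0 :=
  wordLinearMap_ext fun l => by simp

/-- The functional `y ↦ φ (x * y)`. -/
noncomputable def leftShift (φ : List X → K) (x : MonoidAlgebra K (FreeMonoid X)) : List X → K :=
  fun l => wordPairing φ (x * wordMonomial K l)

lemma wordPairing_leftShift (φ : List X → K) (x y : MonoidAlgebra K (FreeMonoid X)) :
    wordPairing (leftShift φ x) y = wordPairing φ (x * y) := by
  suffices wordPairing (leftShift φ x) = wordPairing φ ∘ₗ LinearMap.mulLeft K x from
    congrArg (· y) this
  exact wordLinearMap_ext fun l => by simp [leftShift]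

lemma leftShift_leftShift (φ : List X → K) (x y : MonoidAlgebra K (FreeMonoid X)) :
    leftShift (leftShift φ x) y = leftShift φ (x * y) := by
  ext l
  simp only [leftShift, mul_assoc]
  exact wordPairing_leftShift φ x _

@[simp] lemma leftShift_one (φ : List X → K) : leftShift φ 1 = φ := by
  ext l; simp [leftShift]

lemma leftShift_add (φ : List X → K) (x y : MonoidAlgebra K (FreeMonoid X)) :
    leftShift φ (x + y) = leftShift φ x + leftShift φ y := by
  ext l; simp [leftShift, add_mul]

lemma leftShift_smul (φ : List X → K) (c : K) (x : MonoidAlgebra K (FreeMonoid X)) :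
    leftShift φ (c • x) = c • leftShift φ x := by
  ext l; simp [leftShift]

@[simp] lemma leftShift_zero (φ : List X → K) : leftShift φ 0 = 0 := by
  ext l; simp [leftShift]

lemma leftShift_wordMonomial (φ : List X → K) (s t : List X) :
    leftShift φ (wordMonomial K s) t = φ (s ++ t) := by
  simp [leftShift, ← wordMonomial_append]

/-- The product of functions on words dual to deconcatenation:
`wordConv φ ρ l` is the sum of `φ s * ρ t` over all factorizations `l = s ++ t`. -/
def wordConv : (List X → K) → (List X → K) → List X → K
  | φ, ρ, [] => φ [] * ρ []
  | φ, ρ, x :: l => φ [] * ρ (x :: l) + wordConv (fun t => φ (x :: t)) ρ l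

/-- The indicator function of the empty word, which is the unit for `wordConv`. -/
def wordUnit (K X : Type) [Field K] : List X → K
  | [] => 1
  | _ :: _ => 0

lemma wordConv_add_left (φ ψ ρ : List X → K) :
    wordConv (φ + ψ) ρ = wordConv φ ρ + wordConv ψ ρ := by
  ext l
  induction l generalizing φ ψ with
  | nil => simp [wordConv, add_mul]
  | cons x l ih =>
    have := ih (fun t => φ (x :: t)) (fun t => ψ (x :: t))
    simp only [Pi.add_apply] at this ⊢
    simp only [wordConv, Pi.add_apply]
    rw [show (fun t => φ (x :: t) + ψ (x :: t)) = (fun t => φ (x :: t)) + fun t => ψ (x :: t)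
      from rfl, this]
    ring

lemma wordConv_smul_left (c : K) (φ ρ : List X → K) :
    wordConv (c • φ) ρ = c • wordConv φ ρ := by
  ext l
  induction l generalizing φ with
  | nil => simp [wordConv, mul_assoc]
  | cons x l ih =>
    have := ih (fun t => φ (x :: t))
    simp only [Pi.smul_apply, smul_eq_mul] at this ⊢
    simp only [wordConv, Pi.smul_apply, smul_eq_mul]
    rw [show (fun t => c * φ (x :: t)) = c • fun t => φ (x :: t) from rfl, this]
    ring

lemma wordConv_zero_left (ρ : List X → K) : wordConv 0 ρ = 0 := by
  simpa using wordConv_smul_left (0 : K) 0 ρ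

lemma wordConv_unit_left (ρ : List X → K) : wordConv (wordUnit K X) ρ = ρ := by
  ext l
  cases l with
  | nil => simp [wordConv, wordUnit]
  | cons x l =>
    have h : (fun t => wordUnit K X (x :: t)) = 0 := rfl
    rw [wordConv, h, wordConv_zero_left]
    simp [wordUnit]

lemma wordConv_unit_right (φ : List X → K) : wordConv φ (wordUnit K X) = φ := by
  ext l
  induction l generalizing φ with
  | nil => simp [wordConv, wordUnit]
  | cons x l ih => simp [wordConv, wordUnit, ih]

lemma wordConv_assoc (φ ρ σ : List X → K) :
    wordConv (wordConv φ ρ) σ = wordConv φ (wordConv ρ σ) := by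
  ext l
  induction l generalizing φ ρ with
  | nil => simp [wordConv, mul_assoc]
  | cons x l ih =>
    have h : (fun t => wordConv φ ρ (x :: t)) =
        φ [] • (fun t => ρ (x :: t)) + wordConv (fun t => φ (x :: t)) ρ := by
      ext t; simp [wordConv]
    rw [wordConv, h, wordConv_add_left, wordConv_smul_left, Pi.add_apply, Pi.smul_apply, ih,
      wordConv, wordConv, wordConv, smul_eq_mul]
    ring

lemma exists_append_of_wordConv_ne_zero {φ ρ : List X → K} {l : List X}
    (h : wordConv φ ρ l ≠ 0) : ∃ s t, l = s ++ t ∧ φ s ≠ 0 ∧ ρ t ≠ 0 := by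
  induction l generalizing φ with
  | nil =>
    have := mul_ne_zero_iff.1 (show φ [] * ρ [] ≠ 0 from h)
    exact ⟨[], [], rfl, this⟩
  | cons x l ih =>
    by_cases h0 : φ [] * ρ (x :: l) = 0
    · rw [wordConv, h0, zero_add] at h
      obtain ⟨s, t, rfl, hs, ht⟩ := ih h
      exact ⟨x :: s, t, rfl, hs, ht⟩
    · exact ⟨[], x :: l, rfl, mul_ne_zero_iff.1 h0⟩

lemma wordPairing_wordConv_letter_mul (φ ρ : List X → K) (x : X)
    (y : MonoidAlgebra K (FreeMonoid X)) :
    wordPairing (wordConv φ ρ) (wordMonomial K [x] * y) =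
      φ [] * wordPairing ρ (wordMonomial K [x] * y) +
        wordPairing (wordConv (leftShift φ (wordMonomial K [x])) ρ) y := by
  have h : leftShift φ (wordMonomial K [x]) = fun t => φ (x :: t) := by
    ext t; simp [leftShift_wordMonomial]
  rw [← wordPairing_leftShift, ← wordPairing_leftShift ρ, ← smul_eq_mul, ← LinearMap.smul_apply,
    ← LinearMap.add_apply, ← wordPairing_smul, ← wordPairing_add]
  congr 2
  ext t
  simp [leftShift_wordMonomial, wordConv, h]

lemma wordPairing_wordConv_word_mul (φ ρ : List X → K) (l : List X)
    (y : MonoidAlgebra K (FreeMonoid X))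
    (h : ∀ s t, l = s ++ t → t ≠ [] → φ s * wordPairing ρ (wordMonomial K t * y) = 0) :
    wordPairing (wordConv φ ρ) (wordMonomial K l * y) =
      wordPairing (wordConv (leftShift φ (wordMonomial K l)) ρ) y := by
  induction l generalizing φ with
  | nil => simp [wordMonomial_nil]
  | cons x l ih =>
    have h0 := h [] (x :: l) rfl (by simp)
    rw [wordMonomial_cons, mul_assoc] at h0
    rw [wordMonomial_cons, mul_assoc, wordPairing_wordConv_letter_mul, h0, zero_add, ih,
      leftShift_leftShift]
    intro s t hst ht
    rw [leftShift_wordMonomial]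
    exact h (x :: s) t (by simp [hst]) ht

/-- If no factorization cutting inside `x` contributes, a factor `x` can be absorbed into the left
functional of a product. -/
lemma wordPairing_wordConv_mul (φ ρ : List X → K) (x y : MonoidAlgebra K (FreeMonoid X))
    (h : ∀ s t, x.coeff (FreeMonoid.ofList (s ++ t)) ≠ 0 → t ≠ [] →
      φ s * wordPairing ρ (wordMonomial K t * y) = 0) :
    wordPairing (wordConv φ ρ) (x * y) = wordPairing (wordConv (leftShift φ x) ρ) y := by
  have hx := mem_span_wordMonomial x
  suffices ∀ z ∈ Submodule.span K
      (wordMonomial K '' {l : List X | x.coeff (FreeMonoid.ofList l) ≠ 0}),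
      wordPairing (wordConv φ ρ) (z * y) = wordPairing (wordConv (leftShift φ z) ρ) y from
    this x hx
  intro z hz
  induction hz using Submodule.span_induction with
  | mem z hz =>
    obtain ⟨l, hl, rfl⟩ := hz
    exact wordPairing_wordConv_word_mul φ ρ l y fun s t hst ht => h s t (hst ▸ hl) ht
  | zero => simp [wordConv_zero_left]
  | add a b _ _ ha hb =>
    simp [add_mul, leftShift_add, wordConv_add_left, wordPairing_add, ha, hb]
  | smul c a _ ha => simp [leftShift_smul, wordConv_smul_left, wordPairing_smul, ha]

/-- The closure of a set of functions on words under linear combinations and products. -/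
inductive WordGenerated (S : Set (List X → K)) : (List X → K) → Prop
  | unit : WordGenerated S (wordUnit K X)
  | add {φ ψ} : WordGenerated S φ → WordGenerated S ψ → WordGenerated S (φ + ψ)
  | smul (c : K) {φ} : WordGenerated S φ → WordGenerated S (c • φ)
  | conv {φ ρ} : φ ∈ S → WordGenerated S ρ → WordGenerated S (wordConv φ ρ)

namespace WordGenerated

variable {S T : Set (List X → K)} {φ ρ : List X → K}

lemma of_mem (h : φ ∈ S) : WordGenerated S φ := by
  simpa [wordConv_unit_right] using conv h unit

lemma wordConv (hφ : WordGenerated S φ) (hρ : WordGenerated S ρ) :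
    WordGenerated S (wordConv φ ρ) := by
  induction hφ with
  | unit => rwa [wordConv_unit_left]
  | add _ _ h₁ h₂ => rw [wordConv_add_left]; exact h₁.add h₂
  | smul c _ h => rw [wordConv_smul_left]; exact h.smul c
  | conv h _ ih => rw [wordConv_assoc]; exact conv h ih

lemma trans (hST : ∀ ψ ∈ S, WordGenerated T ψ) (h : WordGenerated S φ) : WordGenerated T φ := by
  induction h with
  | unit => exact unit
  | add _ _ h₁ h₂ => exact h₁.add h₂
  | smul c _ h => exact h.smul c
  | conv h _ ih => exact (hST _ h).wordConv ih

lemma sum {ι : Type*} (s : Finset ι) (f : ι → List X → K) (h : ∀ i ∈ s, WordGenerated S (f i)) :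
    WordGenerated S (∑ i ∈ s, f i) :=
  Finset.sum_induction f (WordGenerated S) (fun _ _ => add)
    (by simpa using unit.smul (0 : K)) h

end WordGenerated

/-- `φ` is supported on words of length `L` and kills the words of the form `u * f ^ m * s` with
`u` and `s` of length at most `D`. -/
structure KillsPowers (f : MonoidAlgebra K (FreeMonoid X)) (D L : ℕ) (φ : List X → K) : Prop where
  length_eq : ∀ l, φ l ≠ 0 → l.length = L
  kills : ∀ m ≤ L, ∀ u s : List X, u.length ≤ D → s.length ≤ D →
    wordPairing φ (wordMonomial K u * f ^ m * wordMonomial K s) = 0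

/-- The span of the words of length at least `n`. -/
noncomputable def longWords (K X : Type) [Field K] (n : ℕ) :
    Submodule K (MonoidAlgebra K (FreeMonoid X)) :=
  Submodule.span K (wordMonomial K '' {l : List X | n ≤ l.length})

lemma wordMonomial_mem_longWords {n : ℕ} {l : List X} (h : n ≤ l.length) :
    wordMonomial K l ∈ longWords K X n :=
  Submodule.subset_span ⟨l, h, rfl⟩

lemma mul_mem_longWords {m n : ℕ} {x y : MonoidAlgebra K (FreeMonoid X)}
    (hx : x ∈ longWords K X m) (hy : y ∈ longWords K X n) : x * y ∈ longWords K X (m + n) := by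
  have h := Submodule.mul_mem_mul hx hy
  rw [longWords, longWords, Submodule.span_mul_span] at h
  refine Submodule.span_mono ?_ h
  rintro _ ⟨_, ⟨s, hs, rfl⟩, _, ⟨t, ht, rfl⟩, rfl⟩
  refine ⟨s ++ t, ?_, wordMonomial_append s t⟩
  simp only [Set.mem_ofPred_eq, List.length_append] at *
  omega

lemma mem_longWords_zero (x : MonoidAlgebra K (FreeMonoid X)) : x ∈ longWords K X 0 :=
  Submodule.span_mono (Set.image_mono fun l _ => Nat.zero_le l.length) (mem_span_wordMonomial x)

lemma pow_mem_longWords {f : MonoidAlgebra K (FreeMonoid X)} (hf : f.coeff 1 = 0) (n : ℕ) :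
    f ^ n ∈ longWords K X n := by
  induction n with
  | zero => exact mem_longWords_zero _
  | succ n ih =>
    rw [pow_succ]
    refine mul_mem_longWords ih (Submodule.span_mono (Set.image_mono fun l hl => ?_)
      (mem_span_wordMonomial f))
    cases l with
    | nil => exact absurd hf hl
    | cons x l => simp

lemma wordPairing_eq_zero_of_mem_longWords {φ : List X → K} {n : ℕ}
    (hφ : ∀ l, φ l ≠ 0 → l.length < n) {x : MonoidAlgebra K (FreeMonoid X)}
    (hx : x ∈ longWords K X n) : wordPairing φ x = 0 := by
  refine Submodule.span_induction (p := fun x _ => wordPairing φ x = 0) ?_ (by simp) ?_ ?_ hx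
  · rintro _ ⟨l, hl, rfl⟩
    rw [wordPairing_wordMonomial]
    by_contra h
    exact absurd (hφ l h) (not_lt.2 hl)
  · intro x y _ _ hx hy; simp [hx, hy]
  · intro c x _ hx; simp [hx]

lemma wordPairing_mul_pow_mul_eq_zero {φ : List X → K} {n : ℕ}
    (hφ : ∀ l, φ l ≠ 0 → l.length < n) {f : MonoidAlgebra K (FreeMonoid X)} (hf : f.coeff 1 = 0)
    (x y : MonoidAlgebra K (FreeMonoid X)) : wordPairing φ (x * (f ^ n * y)) = 0 := by
  refine wordPairing_eq_zero_of_mem_longWords hφ ?_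
  simpa using mul_mem_longWords (mem_longWords_zero x)
    (mul_mem_longWords (pow_mem_longWords hf n) (mem_longWords_zero y))

variable {f : MonoidAlgebra K (FreeMonoid X)} {D L : ℕ} {φ ρ : List X → K}

lemma KillsPowers.leftShift_eq_zero (hφ : KillsPowers f D L φ) (hf : f.coeff 1 = 0)
    (x : MonoidAlgebra K (FreeMonoid X)) {n : ℕ} (hn : L < n) : leftShift φ (x * f ^ n) = 0 := by
  ext l
  rw [leftShift, mul_assoc]
  exact wordPairing_mul_pow_mul_eq_zero (fun l hl => (hφ.length_eq l hl).trans_lt hn) hf _ _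

lemma KillsPowers.leftShift_apply (hφ : KillsPowers f D L φ) (hf : f.coeff 1 = 0) (m : ℕ)
    {u s : List X} (hu : u.length ≤ D) (hs : s.length ≤ D) :
    leftShift φ (wordMonomial K u * f ^ m) s = 0 := by
  rcases le_or_gt m L with h | h
  · exact hφ.kills m h u s hu hs
  · simp [hφ.leftShift_eq_zero hf _ h]

/-- A two-step vanishing condition on powers of `f`, stable under products with functionals
satisfying `KillsPowers f D L`. -/
structure KillsHighPowers (f : MonoidAlgebra K (FreeMonoid X)) (D L : ℕ) (ρ : List X → K) :
    Prop where
  short : ∀ u : List X, u.length ≤ D → ∀ n, L < n → ∀ y,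
    wordPairing ρ (wordMonomial K u * (f ^ n * y)) = 0
  all : ∀ n, 2 * L + 2 ≤ n → ∀ x y, wordPairing ρ (x * (f ^ n * y)) = 0

lemma KillsPowers.wordConv (hf : f.coeff 1 = 0)
    (hD : ∀ l, f.coeff (FreeMonoid.ofList l) ≠ 0 → l.length ≤ D)
    (hφ : KillsPowers f D L φ) (hρ : KillsHighPowers f D L ρ) :
    KillsHighPowers f D L (wordConv φ ρ) where
  short u hu n hn y := by
    have key : ∀ i j, i + j = n → wordPairing (_root_.wordConv φ ρ)
        (wordMonomial K u * (f ^ n * y)) =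
        wordPairing (_root_.wordConv (leftShift φ (wordMonomial K u * f ^ i)) ρ) (f ^ j * y) := by
      intro i
      induction i with
      | zero =>
        intro j hj
        obtain rfl : j = n := by omega
        rw [pow_zero, mul_one]
        refine wordPairing_wordConv_word_mul _ _ _ _ fun s t hst _ => ?_
        have hs : s.length ≤ D := by
          rw [hst, List.length_append] at hu; omega
        have := hφ.leftShift_apply hf 0 (u := []) (by simp) hs
        simp only [wordMonomial_nil, one_mul, pow_zero, leftShift_one] at this
        rw [this, zero_mul]
      | succ i ih =>
        intro j hj
        rw [ih (j + 1) (by omega), pow_succ' f j, mul_assoc f, wordPairing_wordConv_mul,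
          leftShift_leftShift, mul_assoc, ← pow_succ]
        intro s t hst _
        have hs : s.length ≤ D := by
          have := hD _ hst
          rw [List.length_append] at this; omega
        rw [hφ.leftShift_apply hf i hu hs, zero_mul]
    rw [key n 0 rfl, hφ.leftShift_eq_zero hf _ hn, wordConv_zero_left, wordPairing_zero,
      LinearMap.zero_apply]
  all n hn x y := by
    have key : ∀ i ≤ L + 1, ∀ j, i + j = n → wordPairing (_root_.wordConv φ ρ)
        (x * (f ^ n * y)) =
        wordPairing (_root_.wordConv (leftShift φ (x * f ^ i)) ρ) (f ^ j * y) := by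
      intro i
      induction i with
      | zero =>
        intro _ j hj
        obtain rfl : j = n := by omega
        rw [pow_zero, mul_one]
        refine wordPairing_wordConv_mul _ _ _ _ fun s t _ _ => ?_
        rw [hρ.all j hn, mul_zero]
      | succ i ih =>
        intro hi j hj
        rw [ih (by omega) (j + 1) (by omega), pow_succ' f j, mul_assoc f, wordPairing_wordConv_mul,
          leftShift_leftShift, mul_assoc, ← pow_succ]
        intro s t hst _
        have ht : t.length ≤ D := by
          have := hD _ hst
          rw [List.length_append] at this; omega
        rw [hρ.short t ht j (by omega), mul_zero]
    rw [key (L + 1) le_rfl (n - (L + 1)) (by omega), hφ.leftShift_eq_zero hf _ (by omega),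
      wordConv_zero_left, wordPairing_zero, LinearMap.zero_apply]

lemma WordGenerated.killsHighPowers {S : Set (List X → K)} (hf : f.coeff 1 = 0)
    (hD : ∀ l, f.coeff (FreeMonoid.ofList l) ≠ 0 → l.length ≤ D)
    (hS : ∀ φ ∈ S, KillsPowers f D L φ) (h : WordGenerated S ρ) : KillsHighPowers f D L ρ := by
  induction h with
  | unit =>
    have h1 : ∀ n, 0 < n → ∀ l, wordUnit K X l ≠ 0 → l.length < n := by
      intro n hn l hl
      cases l with
      | nil => exact hn
      | cons x l => exact absurd rfl hl
    exact ⟨fun u _ n hn y => wordPairing_mul_pow_mul_eq_zero (h1 n (by omega)) hf _ y,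
      fun n hn x y => wordPairing_mul_pow_mul_eq_zero (h1 n (by omega)) hf x y⟩
  | add _ _ h₁ h₂ =>
    exact ⟨fun u hu n hn y => by simp [wordPairing_add, h₁.short u hu n hn, h₂.short u hu n hn],
      fun n hn x y => by simp [wordPairing_add, h₁.all n hn, h₂.all n hn]⟩
  | smul c _ h =>
    exact ⟨fun u hu n hn y => by simp [wordPairing_smul, h.short u hu n hn],
      fun n hn x y => by simp [wordPairing_smul, h.all n hn]⟩
  | conv h _ ih => exact (hS _ h).wordConv hf hD ih

end WordFunctionals

section WordValues

variable {K : Type} [Field K] {F : Type} [Field F] [Algebra K F]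

/-- Given a function `φ` on words in the letters `(c, i)`, the value of its linear extension at
the product of the elements `∑ i, t i • (c, i)`, for `c` running over `w`. -/
noncomputable def wordValue (t : Fin 3 → F) : List (Fin 2) → (List (Fin 2 × Fin 3) → K) →ₗ[K] F
  | [] => Algebra.linearMap K F ∘ₗ LinearMap.proj []
  | c :: w => ∑ i, LinearMap.mulLeft K (t i) ∘ₗ wordValue t w ∘ₗ
      LinearMap.funLeft K K (List.cons (c, i))

lemma wordValue_nil (t : Fin 3 → F) (φ : List (Fin 2 × Fin 3) → K) :
    wordValue t [] φ = algebraMap K F (φ []) := rfl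

lemma wordValue_cons (t : Fin 3 → F) (c : Fin 2) (w : List (Fin 2))
    (φ : List (Fin 2 × Fin 3) → K) : wordValue t (c :: w) φ =
      ∑ i, t i * wordValue t w (fun l => φ ((c, i) :: l)) := by
  simp only [wordValue, LinearMap.sum_apply]
  rfl

lemma wordValue_eq_zero (t : Fin 3 → F) {w : List (Fin 2)} {φ : List (Fin 2 × Fin 3) → K}
    (h : ∀ l, l.map Prod.fst = w → φ l = 0) : wordValue t w φ = 0 := by
  induction w generalizing φ with
  | nil => simp [wordValue_nil, h [] rfl]
  | cons c w ih =>
    rw [wordValue_cons]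
    refine Finset.sum_eq_zero fun i _ => ?_
    rw [ih fun l hl => h _ (by simp [hl]), mul_zero]

lemma wordValue_append_wordConv (t : Fin 3 → F) (w₁ w₂ : List (Fin 2))
    (φ ρ : List (Fin 2 × Fin 3) → K) (hφ : ∀ l, φ l ≠ 0 → l.length = w₁.length) :
    wordValue t (w₁ ++ w₂) (wordConv φ ρ) = wordValue t w₁ φ * wordValue t w₂ ρ := by
  induction w₁ generalizing φ with
  | nil =>
    have h : φ = φ [] • wordUnit K _ := by
      ext l
      cases l with
      | nil => simp [wordUnit]
      | cons x l =>
        by_contra hne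
        have hx : φ (x :: l) ≠ 0 := by simpa [wordUnit] using hne
        simpa using hφ _ hx
    rw [List.nil_append, h, wordConv_smul_left, wordConv_unit_left, map_smul, wordValue_nil,
      Algebra.smul_def]
    simp [wordUnit]
  | cons c w ih =>
    have h0 : φ [] = 0 := by
      by_contra h
      simpa using hφ _ h
    rw [List.cons_append, wordValue_cons, wordValue_cons, Finset.sum_mul]
    refine Finset.sum_congr rfl fun i _ => ?_
    have h1 : (fun l => wordConv φ ρ ((c, i) :: l)) = wordConv (fun l => φ ((c, i) :: l)) ρ := by
      ext l
      simp [wordConv, h0]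
    rw [h1, ih, mul_assoc]
    intro l hl
    simpa using hφ _ hl

end WordValues

section LeadingExponents

/-- The field of Hahn series over `K` with exponents in `ℤ × ℤ`, ordered lexicographically. -/
abbrev LexSeries (K : Type) [Field K] : Type := HahnSeries (ℤ ×ₗ ℤ) K

variable {K : Type} [Field K]

/-- `α` is the smallest exponent of `x`. -/
def HasLeadingExponent (x : LexSeries K) (α : ℤ ×ₗ ℤ) : Prop :=
  x.coeff α ≠ 0 ∧ ∀ β < α, x.coeff β = 0

lemma HasLeadingExponent.ne_zero {x : LexSeries K} {α : ℤ ×ₗ ℤ} (h : HasLeadingExponent x α) :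
    x ≠ 0 := by
  rintro rfl
  exact h.1 rfl

lemma hasLeadingExponent_iff {x : LexSeries K} {α : ℤ ×ₗ ℤ} :
    HasLeadingExponent x α ↔ x ≠ 0 ∧ x.order = α := by
  constructor
  · intro h
    refine ⟨h.ne_zero, le_antisymm (HahnSeries.order_le_of_coeff_ne_zero h.1) ?_⟩
    by_contra! hlt
    exact HahnSeries.coeff_order_eq_zero.not.2 h.ne_zero (h.2 _ hlt)
  · rintro ⟨hx, rfl⟩
    exact ⟨HahnSeries.coeff_order_eq_zero.not.2 hx,
      fun β => HahnSeries.coeff_eq_zero_of_lt_order⟩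

lemma HasLeadingExponent.mul {x y : LexSeries K} {α β : ℤ ×ₗ ℤ} (hx : HasLeadingExponent x α)
    (hy : HasLeadingExponent y β) : HasLeadingExponent (x * y) (α + β) := by
  rw [hasLeadingExponent_iff] at *
  refine ⟨mul_ne_zero hx.1 hy.1, ?_⟩
  rw [HahnSeries.order_mul hx.1 hy.1, hx.2, hy.2]

lemma hasLeadingExponent_single (α : ℤ ×ₗ ℤ) :
    HasLeadingExponent (HahnSeries.single α (1 : K)) α :=
  ⟨by simp, fun β hβ => HahnSeries.coeff_single_of_ne hβ.ne⟩

lemma HasLeadingExponent.sum {ι : Type*} [Fintype ι] [LinearOrder ι] {x : ι → LexSeries K}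
    {e : ι → ℤ ×ₗ ℤ} (he : StrictMono e) (hx : ∀ i, HasLeadingExponent (x i) (e i)) {v : ι → K}
    {i : ι} (hi : v i ≠ 0) (hv : ∀ j < i, v j = 0) :
    HasLeadingExponent (∑ j, v j • x j) (e i) := by
  have hcoeff : ∀ β, (∑ j, v j • x j).coeff β = ∑ j, v j * (x j).coeff β := by
    intro β
    simp [HahnSeries.coeff_sum]
  refine ⟨?_, fun β hβ => ?_⟩
  · rw [hcoeff, Finset.sum_eq_single i]
    · exact mul_ne_zero hi (hx i).1
    · intro j _ hj
      rcases lt_or_gt_of_ne hj with h | h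
      · rw [hv j h, zero_mul]
      · rw [(hx j).2 _ (he h), mul_zero]
    · simp
  · rw [hcoeff]
    refine Finset.sum_eq_zero fun j _ => ?_
    rcases lt_or_ge j i with h | h
    · rw [hv j h, zero_mul]
    · rw [(hx j).2 _ (hβ.trans_le (he.monotone h)), mul_zero]

/-- A subspace of `ι → K` has dimension at most the number of leading positions of its elements. -/
lemma finrank_le_card_leading {ι : Type*} [Fintype ι] [LinearOrder ι] (V : Submodule K (ι → K))
    (E : Finset ι) (hE : ∀ v ∈ V, ∀ i, v i ≠ 0 → (∀ j < i, v j = 0) → i ∈ E) :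
    Module.finrank K V ≤ E.card := by
  classical
  let T : V →ₗ[K] (E → K) := LinearMap.funLeft K K (Subtype.val : E → ι) ∘ₗ V.subtype
  have hT : Function.Injective T := by
    rw [← LinearMap.ker_eq_bot, LinearMap.ker_eq_bot']
    rintro ⟨v, hv⟩ h
    by_contra hne
    have hex : (Finset.univ.filter fun i => v i ≠ 0).Nonempty := by
      by_contra hempty
      apply hne
      ext i
      by_contra hi
      exact hempty ⟨i, by simpa using hi⟩
    have hmem := Finset.min'_mem _ hex
    set i := Finset.min' _ hex with hi
    have hvi : v i ≠ 0 := by simpa using hmem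
    have hiE : i ∈ E := by
      refine hE v hv i hvi fun j hj => ?_
      by_contra hvj
      exact absurd (Finset.min'_le _ j (by simpa using hvj)) (not_le.2 hj)
    exact hvi (congrFun h ⟨i, hiE⟩)
  simpa using LinearMap.finrank_le_finrank_of_injective hT

lemma exists_corner_notMem (B : Finset (ℕ × ℕ)) (m : ℕ) (h : 3 * B.card < m * m) :
    ∃ a b, a < m ∧ b < m ∧ (a, b) ∉ B ∧ (a + 1, b) ∉ B ∧ (a, b + 1) ∉ B := by
  by_contra! hcon
  have hsub : Finset.range m ×ˢ Finset.range m ⊆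
      B ∪ B.image (fun p => (p.1 - 1, p.2)) ∪ B.image (fun p => (p.1, p.2 - 1)) := by
    rintro ⟨a, b⟩ hab
    simp only [Finset.mem_product, Finset.mem_range] at hab
    simp only [Finset.mem_union, Finset.mem_image]
    by_cases h1 : (a, b) ∈ B
    · exact Or.inl (Or.inl h1)
    by_cases h2 : (a + 1, b) ∈ B
    · exact Or.inl (Or.inr ⟨_, h2, by simp⟩)
    · exact Or.inr ⟨_, hcon a b hab.1 hab.2 h1 h2, by simp⟩
  have h1 := Finset.card_le_card hsub
  have h2 := Finset.card_union_le (B ∪ B.image (fun p => (p.1 - 1, p.2)))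
    (B.image (fun p => (p.1, p.2 - 1)))
  have h3 := Finset.card_union_le B (B.image (fun p => (p.1 - 1, p.2)))
  have h4 : (B.image (fun p : ℕ × ℕ => (p.1 - 1, p.2))).card ≤ B.card := Finset.card_image_le
  have h5 : (B.image (fun p : ℕ × ℕ => (p.1, p.2 - 1))).card ≤ B.card := Finset.card_image_le
  rw [Finset.card_product, Finset.card_range] at h1
  omega

/-- The three scalars `1`, `s`, `t` used to combine the letters with a given label. -/
noncomputable def letterScalar (K : Type) [Field K] (i : Fin 3) : LexSeries K :=
  HahnSeries.single (toLex (if i = 1 then 1 else 0, if i = 2 then 1 else 0)) 1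

/-- A set of functionals supported on words of length `L` which takes, on each product of `L`
generic letters, values with leading exponents forming a translate of `{(0,0), (1,0), (0,1)}`. -/
structure IsStage (L : ℕ) (S : Set (List (Fin 2 × Fin 3) → K)) : Prop where
  pos : 0 < L
  length_eq : ∀ φ ∈ S, ∀ l, φ l ≠ 0 → l.length = L
  leading : ∀ w : List (Fin 2), w.length = L → ∃ α : ℤ ×ₗ ℤ, ∀ a b : ℕ, a + b ≤ 1 →
    ∃ φ ∈ S, (∀ l, φ l ≠ 0 → l.map Prod.fst = w) ∧
      HasLeadingExponent (wordValue (letterScalar K) w φ) (α + toLex ((a : ℤ), (b : ℤ)))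

lemma IsStage.exists_wordGenerated {L : ℕ} {S : Set (List (Fin 2 × Fin 3) → K)} (h : IsStage L S)
    (N : ℕ) (w : List (Fin 2)) (hw : w.length = N * L) :
    ∃ α : ℤ ×ₗ ℤ, ∀ a b : ℕ, a + b ≤ N → ∃ θ, WordGenerated S θ ∧
      (∀ l, θ l ≠ 0 → l.map Prod.fst = w) ∧
      HasLeadingExponent (wordValue (letterScalar K) w θ) (α + toLex ((a : ℤ), (b : ℤ))) := by
  induction N generalizing w with
  | zero =>
    obtain rfl : w = [] := by simpa using hw
    refine ⟨0, fun a b hab => ⟨wordUnit K _, .unit, ?_, ?_⟩⟩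
    · intro l hl
      cases l with
      | nil => rfl
      | cons x l => exact absurd rfl hl
    · obtain ⟨rfl, rfl⟩ : a = 0 ∧ b = 0 := by omega
      rw [wordValue_nil, wordUnit, map_one, zero_add]
      exact hasLeadingExponent_single 0
  | succ N ih =>
    have hw1 : (w.take L).length = L := by
      rw [List.length_take, hw, Nat.succ_mul]; omega
    have hw2 : (w.drop L).length = N * L := by
      rw [List.length_drop, hw, Nat.succ_mul]; omega
    obtain ⟨α₁, h₁⟩ := h.leading _ hw1
    obtain ⟨α₂, h₂⟩ := ih _ hw2
    refine ⟨α₁ + α₂, fun a b hab => ?_⟩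
    obtain ⟨a₁, a₂, b₁, b₂, rfl, rfl, hab₁, hab₂⟩ : ∃ a₁ a₂ b₁ b₂, a₁ + a₂ = a ∧ b₁ + b₂ = b ∧
        a₁ + b₁ ≤ 1 ∧ a₂ + b₂ ≤ N := by
      rcases Nat.eq_zero_or_pos a with ha | ha
      · rcases Nat.eq_zero_or_pos b with hb | hb
        · exact ⟨0, a, 0, b, by omega⟩
        · exact ⟨0, a, 1, b - 1, by omega⟩
      · exact ⟨1, a - 1, 0, b, by omega⟩
    obtain ⟨φ, hφS, hφw, hφ⟩ := h₁ a₁ b₁ hab₁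
    obtain ⟨θ, hθS, hθw, hθ⟩ := h₂ a₂ b₂ hab₂
    refine ⟨wordConv φ θ, .conv hφS hθS, fun l hl => ?_, ?_⟩
    · obtain ⟨s, t, rfl, hs, ht⟩ := exists_append_of_wordConv_ne_zero hl
      rw [List.map_append, hφw s hs, hθw t ht, List.take_append_drop]
    · have hval := wordValue_append_wordConv (letterScalar K) (w.take L) (w.drop L) φ θ
        fun l hl => (h.length_eq φ hφS l hl).trans hw1.symm
      rw [List.take_append_drop] at hval
      rw [hval]
      convert hφ.mul hθ using 1
      rw [add_add_add_comm, ← toLex_add, Prod.mk_add_mk]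
      push_cast
      rfl

lemma card_add_le_of_card_le_finrank {ι κ : Type*} [Fintype ι] [Fintype κ]
    (T : (ι → K) →ₗ[K] (κ → K)) :
    Fintype.card ι ≤ Module.finrank K (LinearMap.ker T) + Fintype.card κ := by
  have h1 := LinearMap.finrank_range_add_finrank_ker T
  have h2 := Submodule.finrank_le (LinearMap.range T)
  rw [Module.finrank_fintype_fun_eq_card] at h1 h2
  omega

lemma IsStage.exists_next {L : ℕ} {S : Set (List (Fin 2 × Fin 3) → K)} (h : IsStage L S)
    (f : MonoidAlgebra K (FreeMonoid (Fin 2 × Fin 3))) (D : ℕ) :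
    ∃ L' S', IsStage L' S' ∧ L < L' ∧ (∀ φ ∈ S', WordGenerated S φ) ∧
      ∀ φ ∈ S', KillsPowers f D L' φ := by
  classical
  have : Fintype {u : List (Fin 2 × Fin 3) // u.length ≤ D} :=
    (List.finite_length_le (Fin 2 × Fin 3) D).fintype
  set c := Fintype.card {u : List (Fin 2 × Fin 3) // u.length ≤ D} with hc
  obtain ⟨m, hm, hmc⟩ : ∃ m, 0 < m ∧ 3 * (c * (c * (2 * m * L + 1))) < m * m := by
    refine ⟨9 * c * c * (L + 1) + 1, by omega, ?_⟩
    set m := 9 * c * c * (L + 1) + 1 with hm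
    have hm1 : 1 ≤ m := by omega
    have h1 : m * m = 9 * c * c * (L + 1) * m + m := by rw [hm]; ring
    have h2 : c * c * 1 ≤ c * c * m := Nat.mul_le_mul_left _ hm1
    have h3 : 0 ≤ c * c * L * m := Nat.zero_le _
    nlinarith
  refine ⟨2 * m * L, {ψ | WordGenerated S ψ ∧ KillsPowers f D (2 * m * L) ψ}, ⟨?_, ?_, ?_⟩, ?_,
    fun φ hφ => hφ.1, fun φ hφ => hφ.2⟩
  · have := h.pos; positivity
  · exact fun φ hφ => hφ.2.length_eq
  · intro w hw
    obtain ⟨α, hα⟩ := h.exists_wordGenerated (2 * m) w hw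
    have hα' : ∀ i : Fin (m + 1) ×ₗ Fin (m + 1), ∃ θ, WordGenerated S θ ∧
        (∀ l, θ l ≠ 0 → l.map Prod.fst = w) ∧ HasLeadingExponent (wordValue (letterScalar K) w θ)
          (α + toLex ((((ofLex i).1 : ℕ) : ℤ), (((ofLex i).2 : ℕ) : ℤ))) := fun i =>
      hα _ _ (by have := (ofLex i).1.is_lt; have := (ofLex i).2.is_lt; omega)
    choose θ hθS hθw hθ using hα'
    let κ := {u : List (Fin 2 × Fin 3) // u.length ≤ D} ×
      {u : List (Fin 2 × Fin 3) // u.length ≤ D} × Fin (2 * m * L + 1)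
    let T : (Fin (m + 1) ×ₗ Fin (m + 1) → K) →ₗ[K] (κ → K) :=
      { toFun := fun v k => wordPairing (∑ i, v i • θ i)
          (wordMonomial K k.1.1 * f ^ (k.2.2 : ℕ) * wordMonomial K k.2.1.1)
        map_add' := fun v v' => by
          ext k
          simp [add_smul, Finset.sum_add_distrib, wordPairing_add]
        map_smul' := fun r v => by
          ext k
          simp [mul_smul, ← Finset.smul_sum, wordPairing_smul] }
    let E : Finset (Fin (m + 1) ×ₗ Fin (m + 1)) := Finset.univ.filter fun i =>
      ∃ v ∈ LinearMap.ker T, v i ≠ 0 ∧ ∀ j < i, v j = 0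
    have hE : Eᶜ.card ≤ c * (c * (2 * m * L + 1)) := by
      have h1 := card_add_le_of_card_le_finrank T
      have h2 := finrank_le_card_leading (LinearMap.ker T) E fun v hv i hi hlt =>
        Finset.mem_filter.2 ⟨Finset.mem_univ _, v, hv, hi, hlt⟩
      have h3 : Fintype.card κ = c * (c * (2 * m * L + 1)) := by
        simp [κ, ← hc]
      have h4 := Finset.card_add_card_compl E
      omega
    obtain ⟨a, b, ha, hb, hab⟩ := exists_corner_notMem
      (Eᶜ.image fun i => (((ofLex i).1 : ℕ), ((ofLex i).2 : ℕ))) m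
      (by
        have : (Eᶜ.image fun i => (((ofLex i).1 : ℕ), ((ofLex i).2 : ℕ))).card ≤ Eᶜ.card :=
          Finset.card_image_le
        omega)
    have hmemE : ∀ a' b', a' < m + 1 → b' < m + 1 → (a', b') ∉
        (Eᶜ.image fun i => (((ofLex i).1 : ℕ), ((ofLex i).2 : ℕ))) →
        ∃ i ∈ E, ((ofLex i).1 : ℕ) = a' ∧ ((ofLex i).2 : ℕ) = b' := by
      intro a' b' ha' hb' hnot
      refine ⟨toLex (⟨a', ha'⟩, ⟨b', hb'⟩), ?_, rfl, rfl⟩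
      by_contra hi
      exact hnot (Finset.mem_image.2 ⟨_, Finset.mem_compl.2 hi, rfl⟩)
    have hmono : StrictMono fun i : Fin (m + 1) ×ₗ Fin (m + 1) =>
        α + toLex ((((ofLex i).1 : ℕ) : ℤ), (((ofLex i).2 : ℕ) : ℤ)) := by
      intro i j hij
      refine add_lt_add_right ?_ α
      rw [Prod.Lex.lt_iff] at hij ⊢
      simpa [Fin.ext_iff] using hij
    refine ⟨α + toLex ((a : ℤ), (b : ℤ)), fun a' b' hab' => ?_⟩
    obtain ⟨i, hiE, hi1, hi2⟩ : ∃ i ∈ E, ((ofLex i).1 : ℕ) = a + a' ∧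
        ((ofLex i).2 : ℕ) = b + b' := by
      have : (a' = 0 ∧ b' = 0) ∨ (a' = 1 ∧ b' = 0) ∨ (a' = 0 ∧ b' = 1) := by omega
      rcases this with ⟨rfl, rfl⟩ | ⟨rfl, rfl⟩ | ⟨rfl, rfl⟩
      · exact hmemE _ _ (by omega) (by omega) hab.1
      · exact hmemE _ _ (by omega) (by omega) hab.2.1
      · exact hmemE _ _ (by omega) (by omega) hab.2.2
    obtain ⟨v, hv, hvi, hvlt⟩ := (Finset.mem_filter.1 hiE).2
    have hlabel : ∀ l, (∑ j, v j • θ j) l ≠ 0 → l.map Prod.fst = w := by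
      intro l hl
      rw [Finset.sum_apply] at hl
      obtain ⟨j, -, hj⟩ := Finset.exists_ne_zero_of_sum_ne_zero hl
      exact hθw j l (right_ne_zero_of_mul hj)
    refine ⟨∑ j, v j • θ j, ⟨?_, ?_, ?_⟩, hlabel, ?_⟩
    · exact WordGenerated.sum _ _ fun j _ => (hθS j).smul _
    · intro l hl
      rw [← hw, ← hlabel l hl, List.length_map]
    · intro k hk u s hu hs
      exact congrFun (LinearMap.mem_ker.1 hv) (⟨u, hu⟩, ⟨s, hs⟩, ⟨k, by omega⟩)
    · have := HasLeadingExponent.sum hmono hθ hvi hvlt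
      rw [map_sum]
      simp only [map_smul]
      convert this using 1
      rw [hi1, hi2, add_assoc, ← toLex_add, Prod.mk_add_mk]
      push_cast
      rfl
  · have := h.pos
    nlinarith

lemma isStage_one : IsStage 1 {φ : List (Fin 2 × Fin 3) → K | ∀ l, φ l ≠ 0 → l.length = 1} := by
  classical
  refine ⟨one_pos, fun φ hφ => hφ, fun w hw => ⟨0, fun a b hab => ?_⟩⟩
  obtain ⟨c, rfl⟩ := List.length_eq_one_iff.1 hw
  obtain ⟨i, hi⟩ : ∃ i : Fin 3, ((if i = 1 then 1 else 0 : ℤ), (if i = 2 then 1 else 0 : ℤ)) =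
      ((a : ℤ), (b : ℤ)) := by
    have : (a = 0 ∧ b = 0) ∨ (a = 1 ∧ b = 0) ∨ (a = 0 ∧ b = 1) := by omega
    rcases this with ⟨rfl, rfl⟩ | ⟨rfl, rfl⟩ | ⟨rfl, rfl⟩
    · exact ⟨0, by simp⟩
    · exact ⟨1, by simp⟩
    · exact ⟨2, by simp⟩
  have hsupp : ∀ l, (Pi.single [(c, i)] 1 : List (Fin 2 × Fin 3) → K) l ≠ 0 → l = [(c, i)] := by
    intro l hl
    by_contra hne
    exact hl (Pi.single_eq_of_ne hne 1)
  refine ⟨Pi.single [(c, i)] 1, fun l hl => by simp [hsupp l hl],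
    fun l hl => by simp [hsupp l hl], ?_⟩
  have hval : wordValue (letterScalar K) [c] (Pi.single [(c, i)] 1 : List (Fin 2 × Fin 3) → K) =
      letterScalar K i := by
    rw [wordValue_cons, Finset.sum_eq_single i]
    · simp [wordValue_nil]
    · intro j _ hj
      simp [wordValue_nil, hj]
    · simp
  rw [hval, letterScalar, hi, zero_add]
  exact hasLeadingExponent_single _

lemma exists_stages (f : ℕ → MonoidAlgebra K (FreeMonoid (Fin 2 × Fin 3))) (D : ℕ → ℕ) :
    ∃ (L : ℕ → ℕ) (S : ℕ → Set (List (Fin 2 × Fin 3) → K)), StrictMono L ∧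
      (∀ k, IsStage (L k) (S k)) ∧ (∀ k, ∀ φ ∈ S (k + 1), WordGenerated (S k) φ) ∧
      ∀ k, ∀ φ ∈ S (k + 1), KillsPowers (f k) (D k) (L (k + 1)) φ := by
  have step : ∀ (k : ℕ) (p : {p : ℕ × Set (List (Fin 2 × Fin 3) → K) // IsStage p.1 p.2}),
      ∃ q : {p : ℕ × Set (List (Fin 2 × Fin 3) → K) // IsStage p.1 p.2},
        p.1.1 < q.1.1 ∧ (∀ φ ∈ q.1.2, WordGenerated p.1.2 φ) ∧
        ∀ φ ∈ q.1.2, KillsPowers (f k) (D k) q.1.1 φ := by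
    rintro k ⟨p, hp⟩
    obtain ⟨L', S', h, h'⟩ := hp.exists_next (f k) (D k)
    exact ⟨⟨(L', S'), h⟩, h'⟩
  choose next hnext using step
  let seq : ℕ → {p : ℕ × Set (List (Fin 2 × Fin 3) → K) // IsStage p.1 p.2} :=
    fun k => Nat.rec ⟨(1, _), isStage_one⟩ next k
  exact ⟨fun k => (seq k).1.1, fun k => (seq k).1.2,
    strictMono_nat_of_lt_succ fun k => (hnext k (seq k)).1, fun k => (seq k).2,
    fun k => (hnext k (seq k)).2.1, fun k => (hnext k (seq k)).2.2⟩

end LeadingExponents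

section AnnihilatedQuotient

variable {K X : Type} [Field K]

/-- The largest two-sided ideal of `K⟨X⟩` on which all functionals in `T` vanish. -/
noncomputable def wordIdeal (T : Set (List X → K)) : Ideal (MonoidAlgebra K (FreeMonoid X)) where
  carrier := {x | ∀ φ ∈ T, ∀ y z, wordPairing φ (y * (x * z)) = 0}
  add_mem' {a b} ha hb φ hφ y z := by simp [add_mul, mul_add, ha φ hφ, hb φ hφ]
  zero_mem' φ hφ y z := by simp
  smul_mem' c x hx φ hφ y z := by
    simpa only [smul_eq_mul, mul_assoc] using hx φ hφ (y * c) z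

lemma mem_wordIdeal {T : Set (List X → K)} {x : MonoidAlgebra K (FreeMonoid X)} :
    x ∈ wordIdeal T ↔ ∀ φ ∈ T, ∀ y z, wordPairing φ (y * (x * z)) = 0 :=
  Iff.rfl

instance (T : Set (List X → K)) : (wordIdeal T).IsTwoSided :=
  ⟨fun b hx φ hφ y z => by simpa only [mul_assoc] using hx φ hφ y (b * z)⟩

lemma exists_functional_quotient {T : Set (List X → K)} {φ : List X → K} (hφ : φ ∈ T) :
    ∃ g : MonoidAlgebra K (FreeMonoid X) ⧸ wordIdeal T →ₗ[K] K,
      ∀ x, g (Ideal.Quotient.mkₐ K (wordIdeal T) x) = wordPairing φ x := by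
  refine ⟨((wordIdeal T).restrictScalars K).liftQ (wordPairing φ) (fun x hx => ?_) ∘ₗ
    (Submodule.Quotient.restrictScalarsEquiv K (wordIdeal T)).symm.toLinearMap, fun x => rfl⟩
  simpa using (mem_wordIdeal.1 hx) φ hφ 1 1

/-- The words of positive length span a non-unital subalgebra of `K⟨X⟩`. -/
noncomputable def augmentation (K X : Type) [Field K] :
    NonUnitalSubalgebra K (MonoidAlgebra K (FreeMonoid X)) :=
  { carrier := longWords K X 1
    add_mem' := Submodule.add_mem _
    zero_mem' := Submodule.zero_mem _
    smul_mem' := fun c _ => Submodule.smul_mem _ c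
    mul_mem' := fun {_ y} hx _ => add_zero 1 ▸ mul_mem_longWords hx (mem_longWords_zero y) }

lemma coeff_one_of_mem_augmentation {x : MonoidAlgebra K (FreeMonoid X)}
    (hx : x ∈ augmentation K X) : x.coeff 1 = 0 := by
  refine Submodule.span_induction (p := fun x _ => x.coeff 1 = 0) ?_ (by simp) ?_ ?_ hx
  · rintro _ ⟨l, hl, rfl⟩
    refine Finsupp.single_eq_of_ne ?_
    intro h
    obtain rfl : l = [] := congrArg FreeMonoid.toList h.symm
    simp at hl
  · intro x y _ _ hx hy; simp [hx, hy]
  · intro c x _ hx; simp [hx]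

lemma wordMonomial_singleton_mem_augmentation (x : X) :
    wordMonomial K [x] ∈ augmentation K X :=
  wordMonomial_mem_longWords (by simp)

/-- The image of the augmentation ideal in the quotient by `wordIdeal T`. -/
noncomputable def quotientAugmentation (T : Set (List X → K)) :
    NonUnitalSubalgebra K (MonoidAlgebra K (FreeMonoid X) ⧸ wordIdeal T) :=
  (augmentation K X).map (Ideal.Quotient.mkₐ K (wordIdeal T))

lemma coe_powSucc {B : Type} [Ring B] [Algebra K B] {R : NonUnitalSubalgebra K B} (a : R) (n : ℕ) :
    ((powSucc a n : R) : B) = (a : B) ^ (n + 1) := by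
  induction n with
  | zero => simp [powSucc]
  | succ n ih => rw [powSucc, NonUnitalSubalgebra.coe_mul, ih, pow_succ _ (n + 1)]

lemma isNilRing_quotientAugmentation {T : Set (List X → K)}
    (h : ∀ f : MonoidAlgebra K (FreeMonoid X), f.coeff 1 = 0 →
      ∃ n, ∀ φ ∈ T, ∀ x y, wordPairing φ (x * (f ^ (n + 1) * y)) = 0) :
    IsNilRing (quotientAugmentation T) := by
  rintro ⟨b, hb⟩
  obtain ⟨f, hf, rfl⟩ := NonUnitalSubalgebra.mem_map.1 hb
  obtain ⟨n, hn⟩ := h f (coeff_one_of_mem_augmentation hf)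
  refine ⟨n, Subtype.ext ?_⟩
  rw [coe_powSucc]
  have h1 : Ideal.Quotient.mkₐ K (wordIdeal T) f ^ (n + 1) = 0 := by
    rw [← map_pow]
    exact Ideal.Quotient.eq_zero_iff_mem.2 hn
  exact h1

end AnnihilatedQuotient

section FreeSubalgebra

variable {K : Type} [Field K] {F : Type} [Field F] [Algebra K F] {B : Type} [Ring B] [Algebra K B]

/-- The scalar extension of a linear functional on `B`, restricted to a subalgebra. -/
noncomputable def extendedFunctional (F : Type) [Field F] [Algebra K F]
    (R : NonUnitalSubalgebra K B) (g : B →ₗ[K] K) : R ⊗[K] F →ₗ[K] F :=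
  TensorProduct.lift (LinearMap.lsmul K F ∘ₗ g ∘ₗ R.toSubmodule.subtype)

lemma extendedFunctional_tmul (R : NonUnitalSubalgebra K B) (g : B →ₗ[K] K) (r : R) (s : F) :
    extendedFunctional F R g (r ⊗ₜ s) = g r • s := rfl

lemma extendedFunctional_tmul_mul (R : NonUnitalSubalgebra K B) (g : B →ₗ[K] K) (r : R) (s : F)
    (z : R ⊗[K] F) :
    extendedFunctional F R g (r ⊗ₜ s * z) =
      s * extendedFunctional F R (g ∘ₗ LinearMap.mulLeft K (r : B)) z := by
  induction z with
  | zero => simp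
  | add z z' h h' => rw [mul_add, map_add, map_add, h, h', mul_add]
  | tmul r' s' =>
    rw [Algebra.TensorProduct.tmul_mul_tmul, extendedFunctional_tmul, extendedFunctional_tmul,
      mul_smul_comm]
    rfl

/-- The generic letters `∑ i, (c, i) ⊗ t i`. -/
noncomputable def genericLetter {R : NonUnitalSubalgebra K B} (r : Fin 2 × Fin 3 → R)
    (t : Fin 3 → F) (c : Fin 2) : R ⊗[K] F :=
  ∑ i, r (c, i) ⊗ₜ t i

lemma extendedFunctional_lift_genericLetter {R : NonUnitalSubalgebra K B}
    (r : Fin 2 × Fin 3 → R) (t : Fin 3 → F)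
    (β : MonoidAlgebra K (FreeMonoid (Fin 2 × Fin 3)) →ₐ[K] B)
    (hr : ∀ x, (r x : B) = β (wordMonomial K [x])) (w : FreeSemigroup (Fin 2)) (g : B →ₗ[K] K) :
    extendedFunctional F R g (FreeSemigroup.lift (genericLetter r t) w) =
      wordValue t (w.head :: w.tail) (fun l => g (β (wordMonomial K l))) := by
  induction w using FreeSemigroup.recOnMul generalizing g with
  | ih1 c =>
    rw [FreeSemigroup.lift_of, genericLetter, map_sum]
    change _ = wordValue t [c] _
    rw [wordValue_cons]
    refine Finset.sum_congr rfl fun i _ => ?_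
    rw [extendedFunctional_tmul, hr, wordValue_nil, Algebra.smul_def, mul_comm]
  | ih2 c w _ ih =>
    rw [FreeSemigroup.lift_of_mul, genericLetter, Finset.sum_mul, map_sum]
    change _ = wordValue t (c :: w.head :: w.tail) _
    rw [wordValue_cons]
    refine Finset.sum_congr rfl fun i _ => ?_
    rw [extendedFunctional_tmul_mul, ih]
    congr 2
    ext l
    simp [hr, wordMonomial_cons (c, i) l]

/-- The products of the generic letters are linearly independent if each of them can be extended to
a product detected by a functional vanishing on all words with different labels. -/
lemma hasFreeRankTwo_of_functionals {R : NonUnitalSubalgebra K B} (t : Fin 3 → F)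
    (β : MonoidAlgebra K (FreeMonoid (Fin 2 × Fin 3)) →ₐ[K] B)
    (hr : ∀ x, β (wordMonomial K [x]) ∈ R)
    (hg : ∀ w : List (Fin 2), ∃ v, v ≠ [] ∧ ∃ g : B →ₗ[K] K,
      (∀ l, g (β (wordMonomial K l)) ≠ 0 → l.map Prod.fst = w ++ v) ∧
        wordValue t (w ++ v) (fun l => g (β (wordMonomial K l))) ≠ 0) :
    HasFreeRankTwo K (R ⊗[K] F) := by
  let r : Fin 2 × Fin 3 → R := fun x => ⟨_, hr x⟩
  refine ⟨genericLetter r t 0, genericLetter r t 1, ?_⟩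
  have hgen : (fun i : Fin 2 => if i = 0 then genericLetter r t 0 else genericLetter r t 1) =
      genericLetter r t := by
    ext i
    fin_cases i <;> rfl
  rw [hgen]
  intro c c' hc
  ext w₀
  obtain ⟨v, hv, g, hgw, hg0⟩ := hg (w₀.head :: w₀.tail)
  obtain ⟨v, rfl⟩ : ∃ u : FreeSemigroup (Fin 2), v = u.head :: u.tail := by
    cases v with
    | nil => exact absurd rfl hv
    | cons a v => exact ⟨⟨a, v⟩, rfl⟩
  have hval : ∀ w : FreeSemigroup (Fin 2),
      extendedFunctional F R g (FreeSemigroup.lift (genericLetter r t) (w * v)) =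
        wordValue t ((w.head :: w.tail) ++ (v.head :: v.tail))
          (fun l => g (β (wordMonomial K l))) := fun w =>
    extendedFunctional_lift_genericLetter r t β (fun _ => rfl) (w * v) g
  have key : ∀ c : FreeSemigroup (Fin 2) →₀ K, extendedFunctional F R g
      (Finsupp.linearCombination K (fun w => FreeSemigroup.lift (genericLetter r t) w) c *
        FreeSemigroup.lift (genericLetter r t) v) =
      c w₀ • wordValue t ((w₀.head :: w₀.tail) ++ (v.head :: v.tail))
          (fun l => g (β (wordMonomial K l))) := by
    intro c
    rw [Finsupp.linearCombination_apply, Finsupp.sum, Finset.sum_mul, map_sum,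
      Finset.sum_eq_single w₀]
    · rw [smul_mul_assoc, ← map_mul, map_smul, hval]
    · intro w _ hw
      rw [smul_mul_assoc, ← map_mul, map_smul, hval, wordValue_eq_zero, smul_zero]
      intro l hl
      by_contra hne
      have h := List.append_cancel_right (hl.symm.trans (hgw l hne))
      exact hw (FreeSemigroup.ext (List.cons.inj h).1 (List.cons.inj h).2)
    · intro h
      rw [Finsupp.notMem_support_iff.1 h, zero_smul, zero_mul, map_zero]
  refine smul_left_injective K hg0 ?_
  simp only [← key, hc]

end FreeSubalgebra

section Stages

variable {K : Type} [Field K] {L : ℕ → ℕ} {S : ℕ → Set (List (Fin 2 × Fin 3) → K)}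

lemma wordGenerated_of_le (hS : ∀ k, ∀ φ ∈ S (k + 1), WordGenerated (S k) φ) {i j : ℕ}
    (hij : i ≤ j) : ∀ φ ∈ S j, WordGenerated (S i) φ := by
  induction j, hij using Nat.le_induction with
  | base => exact fun φ hφ => .of_mem hφ
  | succ j _ ih => exact fun φ hφ => .trans ih (hS j φ hφ)

lemma wordPairing_stage_mul_pow_mul_eq_zero (hL : StrictMono L) (hst : ∀ k, IsStage (L k) (S k))
    (hS : ∀ k, ∀ φ ∈ S (k + 1), WordGenerated (S k) φ)
    {f : MonoidAlgebra K (FreeMonoid (Fin 2 × Fin 3))} (hf : f.coeff 1 = 0) {D k : ℕ}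
    (hD : ∀ l, f.coeff (FreeMonoid.ofList l) ≠ 0 → l.length ≤ D)
    (hk : ∀ φ ∈ S (k + 1), KillsPowers f D (L (k + 1)) φ) {j : ℕ}
    {φ : List (Fin 2 × Fin 3) → K} (hφ : φ ∈ S j)
    (x y : MonoidAlgebra K (FreeMonoid (Fin 2 × Fin 3))) :
    wordPairing φ (x * (f ^ (2 * L (k + 1) + 1 + 1) * y)) = 0 := by
  rcases le_total j (k + 1) with hj | hj
  · refine wordPairing_mul_pow_mul_eq_zero (fun l hl => ?_) hf x y
    rw [(hst j).length_eq φ hφ l hl]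
    have := hL.monotone hj
    omega
  · exact ((wordGenerated_of_le hS hj φ hφ).killsHighPowers hf hD hk).all _ le_rfl x y

lemma exists_padding_of_stages (hL : StrictMono L) (hst : ∀ k, IsStage (L k) (S k))
    (w : List (Fin 2)) : ∃ v, v ≠ [] ∧ ∃ φ ∈ ⋃ k, S k,
      (∀ l, φ l ≠ 0 → l.map Prod.fst = w ++ v) ∧ wordValue (letterScalar K) (w ++ v) φ ≠ 0 := by
  have hlt : w.length < L (w.length + 1) := (Nat.lt_succ_self _).trans_le hL.le_apply
  obtain ⟨α, hα⟩ := (hst (w.length + 1)).leading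
    (w ++ List.replicate (L (w.length + 1) - w.length) 0) (by simp; omega)
  obtain ⟨φ, hφS, hφw, hφ⟩ := hα 0 0 (by omega)
  refine ⟨_, ?_, φ, Set.mem_iUnion_of_mem _ hφS, hφw, hφ.ne_zero⟩
  rw [ne_eq, List.replicate_eq_nil_iff]
  omega

lemma exists_enumeration (K X : Type) [Field K] [Countable K] [Countable X] :
    ∃ f : ℕ → MonoidAlgebra K (FreeMonoid X), ∀ x, ∃ k, f k = x := by
  have : Countable (FreeMonoid X) := inferInstanceAs (Countable (List X))
  have : Countable (MonoidAlgebra K (FreeMonoid X)) :=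
    (MonoidAlgebra.coeffLinearEquiv K).toEquiv.injective.countable
  exact exists_surjective_nat _

lemma exists_length_le {X : Type} (f : MonoidAlgebra K (FreeMonoid X)) :
    ∃ D, ∀ l, f.coeff (FreeMonoid.ofList l) ≠ 0 → l.length ≤ D :=
  ⟨f.coeff.support.sup fun m => m.toList.length, fun _ hl =>
    Finset.le_sup (f := fun m : FreeMonoid X => m.toList.length) (Finsupp.mem_support_iff.2 hl)⟩

end Stages

/-- Over every countable field `K` there are a field extension `F` of `K` and a nil
associative `K`-algebra `R` such that `R ⊗[K] F` contains a free noncommutative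
`K`-subalgebra of rank two. -/
theorem stmt3 (K : Type) [Field K] [Countable K] :
    ∃ (F : Type) (_ : Field F) (_ : Algebra K F)
      (R : Type) (i₁ : NonUnitalRing R),
      letI := i₁
      ∃ (i₂ : Module K R),
        letI := i₂
        ∃ (_ : SMulCommClass K R R) (_ : IsScalarTower K R R),
          IsNilRing R ∧ HasFreeRankTwo K (R ⊗[K] F) := by
  obtain ⟨f, hf⟩ := exists_enumeration K (Fin 2 × Fin 3)
  choose D hD using fun k => exists_length_le (f k)
  obtain ⟨L, S, hL, hst, hS, hk⟩ := exists_stages f D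
  refine ⟨LexSeries K, inferInstance, inferInstance, quotientAugmentation (⋃ k, S k),
    inferInstance, inferInstance, inferInstance, inferInstance,
    isNilRing_quotientAugmentation fun x hx => ?_,
    hasFreeRankTwo_of_functionals (letterScalar K) (Ideal.Quotient.mkₐ K _)
      (fun x => NonUnitalSubalgebra.mem_map.2
        ⟨_, wordMonomial_singleton_mem_augmentation x, rfl⟩) fun w => ?_⟩
  · obtain ⟨k, rfl⟩ := hf x
    refine ⟨2 * L (k + 1) + 1, fun φ hφ y z => ?_⟩
    obtain ⟨j, hj⟩ := Set.mem_iUnion.1 hφ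
    exact wordPairing_stage_mul_pow_mul_eq_zero hL hst hS hx (hD k) (hk k) hj y z
  · obtain ⟨v, hv, φ, hφ, hφw, hval⟩ := exists_padding_of_stages hL hst w
    obtain ⟨g, hg⟩ := exists_functional_quotient hφ
    have hgφ : (fun l => g (Ideal.Quotient.mkₐ K _ (wordMonomial K l))) = φ := by
      ext l
      rw [hg, wordPairing_wordMonomial]
    refine ⟨v, hv, g, fun l hl => hφw l ?_, ?_⟩
    · rwa [← hgφ]
    · rwa [hgφ]
end

section
/- For each z in P, the set U_z = { z(n1,...,n6) : n1,...,n6 >= 0, n1+n2+n3 = deg_x z, n4+n5+n6 = deg_y z } is a free basis of the right A-module U_z·A; that is, its elements are nonzero and right-A-linearly independent: whenever a finite sum over u in U_z of u·a_u equals 0, with each a_u in the unitalization of A, all a_u are 0. Moreover, if z_1, ..., z_n in P_i are pairwise distinct monomials of the same degree i, then the union U_{z_1} ∪ U_{z_2} ∪ ... ∪ U_{z_n} is a free basis of the right A-module it generates. -/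
open scoped Classical BigOperators

noncomputable section

/-- The free associative unital `K`-algebra on six generators `x1 x2 x3 y1 y2 y3`,
realized as the monoid algebra of the free monoid on six letters. -/
abbrev FreeA (K : Type) [Field K] : Type := MonoidAlgebra K (FreeMonoid (Fin 6))

/-- The map sending the generators `x1 x2 x3` to `x` and `y1 y2 y3` to `y`. -/
def bf : Fin 6 → Fin 2 := fun i => if (i : ℕ) < 3 then 0 else 1

/-- The monoid homomorphism `β` from monomials in six letters to monomials in two letters. -/
def bm : FreeMonoid (Fin 6) →* FreeMonoid (Fin 2) := FreeMonoid.map bf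

/-- Degree (length) of a monomial. -/
def len {α : Type} (w : FreeMonoid α) : ℕ := (FreeMonoid.toList w).length

/-- The ordering `≺` on monomials in `x, y`: same degree and lexicographically smaller. -/
def prec (z z' : FreeMonoid (Fin 2)) : Prop :=
  len z = len z' ∧ List.Lex (· < ·) (FreeMonoid.toList z) (FreeMonoid.toList z')

/-- The finite set of monomials of degree `n` in six letters. -/
def wordsOf (n : ℕ) : Finset (FreeMonoid (Fin 6)) :=
  (Finset.univ : Finset (Fin n → Fin 6)).image fun f => FreeMonoid.ofList (List.ofFn f)

/-- `wComp K z n` is `z(n₁,…,n₆)`: the sum of all monomials `v` (in six letters) with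
`β v = z` and with exactly `nᵢ` occurrences of the `i`-th generator; it is `0` if no such
monomial exists (in particular if some `nᵢ` is negative). -/
def wComp (K : Type) [Field K] (z : FreeMonoid (Fin 2)) (n : Fin 6 → ℤ) : FreeA K :=
  ∑ v ∈ (wordsOf (len z)).filter
      (fun v => bm v = z ∧ ∀ e : Fin 6, ((FreeMonoid.toList v).count e : ℤ) = n e),
    MonoidAlgebra.single v 1

/-- `H_i`: the `K`-span of the monomials of degree `i`. -/
def Hgr (K : Type) [Field K] (i : ℕ) : Submodule K (FreeA K) :=
  Submodule.span K {a | ∃ w : FreeMonoid (Fin 6), len w = i ∧ a = MonoidAlgebra.single w (1 : K)}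

/-- `S(z)` for `z` a monomial in `x, y`: the span of the monomials `w` in six letters of the
same degree with `β w ≺ z`.  (For a monomial `z` in six letters, `S(z) = SP K (bm z)`.) -/
def SP (K : Type) [Field K] (z : FreeMonoid (Fin 2)) : Submodule K (FreeA K) :=
  Submodule.span K
    {a | ∃ w : FreeMonoid (Fin 6), len w = len z ∧ prec (bm w) z ∧
      a = MonoidAlgebra.single w (1 : K)}

/-- `Q(z)`: the span of the monomials `w` of the same degree with `β w = z`. -/
def QP (K : Type) [Field K] (z : FreeMonoid (Fin 2)) : Submodule K (FreeA K) :=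
  Submodule.span K
    {a | ∃ w : FreeMonoid (Fin 6), len w = len z ∧ bm w = z ∧
      a = MonoidAlgebra.single w (1 : K)}

end

theorem len_bm (w : FreeMonoid (Fin 6)) : len (bm w) = len w := by
  simp [len, bm]

theorem mem_wordsOf {k : ℕ} {w : FreeMonoid (Fin 6)} : w ∈ wordsOf k ↔ len w = k := by
  constructor
  · intro h
    obtain ⟨f, -, rfl⟩ := Finset.mem_image.mp h
    simp [len]
  · rintro rfl
    exact Finset.mem_image.mpr ⟨(FreeMonoid.toList w).get, Finset.mem_univ _,
      congrArg FreeMonoid.ofList (List.ofFn_get _)⟩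

/-- The multidegree of a monomial in six letters. -/
def letterCounts (w : FreeMonoid (Fin 6)) : Fin 6 → ℤ :=
  fun e => ((FreeMonoid.toList w).count e : ℤ)

theorem coeff_single_mul_of_len_eq {K : Type} [Field K] {v w : FreeMonoid (Fin 6)}
    (h : len v = len w) (m : FreeMonoid (Fin 6)) (c : FreeA K) :
    (MonoidAlgebra.single v (1 : K) * c).coeff (w * m) = if v = w then c.coeff m else 0 := by
  split_ifs with hvw
  · subst hvw
    rw [MonoidAlgebra.coeff_single_mul_eq_mul_coeff m fun _ _ => mul_right_inj v, one_mul]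
  · refine MonoidAlgebra.coeff_single_mul_of_forall_mul_ne _ _ fun d hd => hvw ?_
    exact FreeMonoid.toList.injective
      (List.append_inj_left (congrArg FreeMonoid.toList hd) h)

theorem coeff_wComp_mul {K : Type} [Field K] {z : FreeMonoid (Fin 2)} {w : FreeMonoid (Fin 6)}
    (h : len w = len z) (n : Fin 6 → ℤ) (m : FreeMonoid (Fin 6)) (c : FreeA K) :
    (wComp K z n * c).coeff (w * m) =
      if bm w = z ∧ letterCounts w = n then c.coeff m else 0 := by
  have hterm : ∀ v ∈ (wordsOf (len z)).filter
      (fun v => bm v = z ∧ ∀ e : Fin 6, ((FreeMonoid.toList v).count e : ℤ) = n e),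
      (MonoidAlgebra.single v (1 : K) * c).coeff (w * m) = if v = w then c.coeff m else 0 :=
    fun v hv => coeff_single_mul_of_len_eq
      ((mem_wordsOf.mp (Finset.mem_filter.mp hv).1).trans h.symm) m c
  rw [wComp, Finset.sum_mul, MonoidAlgebra.coeff_sum, Finsupp.finsetSum_apply,
    Finset.sum_congr rfl hterm, Finset.sum_ite_eq']
  simp [mem_wordsOf, h, letterCounts, funext_iff]

theorem wComp_eq_zero {K : Type} [Field K] {z : FreeMonoid (Fin 2)} {n : Fin 6 → ℤ}
    (h : n ∉ (wordsOf (len z)).image letterCounts) : wComp K z n = 0 := by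
  refine Finset.sum_eq_zero fun v hv => absurd ?_ h
  obtain ⟨hv, -, hn⟩ := Finset.mem_filter.mp hv
  exact Finset.mem_image.mpr ⟨v, hv, funext hn⟩

theorem exists_list_map_eq_and_count_eq (z : List (Fin 2)) (n : Fin 6 → ℤ) (hn : ∀ i, 0 ≤ n i)
    (h0 : n 0 + n 1 + n 2 = (z.count 0 : ℤ)) (h1 : n 3 + n 4 + n 5 = (z.count 1 : ℤ)) :
    ∃ w : List (Fin 6), w.map bf = z ∧ ∀ e, (w.count e : ℤ) = n e := by
  induction z generalizing n with
  | nil =>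
    refine ⟨[], rfl, fun e => ?_⟩
    have := hn 0; have := hn 1; have := hn 2; have := hn 3; have := hn 4; have := hn 5
    simp only [List.count_nil, Nat.cast_zero] at h0 h1 ⊢
    fin_cases e <;> simp <;> omega
  | cons a t ih =>
    obtain ⟨k, hk, hpos⟩ : ∃ k, bf k = a ∧ 0 < n k := by
      by_contra! hall
      have h00 := hall 0; have h01 := hall 1; have h02 := hall 2
      have h03 := hall 3; have h04 := hall 4; have h05 := hall 5
      fin_cases a <;> simp [bf] at h0 h1 h00 h01 h02 h03 h04 h05 <;> omega
    have hcount : ∀ b, (((a :: t).count b : ℕ) : ℤ) = t.count b + if a = b then 1 else 0 := by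
      intro b
      rw [List.count_cons]
      push_cast
      simp
    rw [hcount] at h0 h1
    obtain ⟨w, hw, hc⟩ := ih (fun e => n e - if k = e then 1 else 0)
      (fun e => by
        have := hn e
        split_ifs with hke
        · subst hke; omega
        · omega)
      (by subst hk; fin_cases k <;> simp [bf] at h0 ⊢ <;> omega)
      (by subst hk; fin_cases k <;> simp [bf] at h1 ⊢ <;> omega)
    refine ⟨k :: w, by simp [hk, hw], fun e => ?_⟩
    have := hc e
    rw [List.count_cons]
    push_cast
    rw [this]
    simp

theorem exists_bm_eq_and_letterCounts_eq (z : FreeMonoid (Fin 2)) (n : Fin 6 → ℤ)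
    (hn : ∀ i, 0 ≤ n i)
    (h0 : n 0 + n 1 + n 2 = ((FreeMonoid.toList z).count (0 : Fin 2) : ℤ))
    (h1 : n 3 + n 4 + n 5 = ((FreeMonoid.toList z).count (1 : Fin 2) : ℤ)) :
    ∃ w, bm w = z ∧ letterCounts w = n := by
  obtain ⟨w, hw, hc⟩ := exists_list_map_eq_and_count_eq (FreeMonoid.toList z) n hn h0 h1
  exact ⟨FreeMonoid.ofList w, FreeMonoid.toList.injective hw, funext hc⟩

theorem eq_zero_of_finsum_wComp_mul_eq_zero {K : Type} [Field K] {i N : ℕ}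
    {zs : Fin N → FreeMonoid (Fin 2)} (hzs : Function.Injective zs) (hlen : ∀ j, len (zs j) = i)
    (c : Fin N → (Fin 6 → ℤ) → FreeA K)
    (hc : (∑ᶠ n : Fin 6 → ℤ, ∑ j, wComp K (zs j) n * c j n) = 0)
    (j : Fin N) {n : Fin 6 → ℤ} {w : FreeMonoid (Fin 6)} (hw : bm w = zs j)
    (hn : letterCounts w = n) : c j n = 0 := by
  have hwi (j' : Fin N) : len w = len (zs j') := by rw [← len_bm, hw, hlen, hlen]
  have hsupp : (Function.support fun n => ∑ j, wComp K (zs j) n * c j n) ⊆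
      ((wordsOf i).image letterCounts : Finset _) := by
    refine Function.support_subset_iff'.mpr fun n' hn' => Finset.sum_eq_zero fun j' _ => ?_
    rw [wComp_eq_zero (by rwa [hlen j']), zero_mul]
  rw [finsum_eq_sum_of_support_subset _ hsupp] at hc
  ext m
  have hcoeff := congrArg (fun a : FreeA K => a.coeff (w * m)) hc
  simp only [MonoidAlgebra.coeff_sum, Finsupp.finsetSum_apply, coeff_wComp_mul (hwi _), hw, hn,
    hzs.eq_iff, MonoidAlgebra.coeff_zero, Finsupp.zero_apply] at hcoeff
  have hmem : n ∈ (wordsOf i).image letterCounts :=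
    Finset.mem_image.mpr ⟨w, mem_wordsOf.mpr ((hwi j).trans (hlen j)), hn⟩
  rw [Finset.sum_eq_single_of_mem n hmem
      (fun n' _ hne => Finset.sum_eq_zero fun j' _ => if_neg fun h => hne h.2.symm),
    Finset.sum_eq_single_of_mem j (Finset.mem_univ j)
      (fun j' _ hne => if_neg fun h => hne h.1.symm), if_pos ⟨rfl, rfl⟩] at hcoeff
  exact hcoeff

theorem stmt4 (K : Type) [Field K] :
    (∀ z : FreeMonoid (Fin 2),
      (∀ n : Fin 6 → ℤ, (∀ i, 0 ≤ n i) →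
          n 0 + n 1 + n 2 = ((FreeMonoid.toList z).count (0 : Fin 2) : ℤ) →
          n 3 + n 4 + n 5 = ((FreeMonoid.toList z).count (1 : Fin 2) : ℤ) →
          wComp K z n ≠ 0) ∧
      (∀ c : (Fin 6 → ℤ) → FreeA K,
        (∑ᶠ n : Fin 6 → ℤ, wComp K z n * c n) = 0 →
        ∀ n : Fin 6 → ℤ, (∀ i, 0 ≤ n i) →
          n 0 + n 1 + n 2 = ((FreeMonoid.toList z).count (0 : Fin 2) : ℤ) →
          n 3 + n 4 + n 5 = ((FreeMonoid.toList z).count (1 : Fin 2) : ℤ) →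
          c n = 0)) ∧
    (∀ (i N : ℕ) (zs : Fin N → FreeMonoid (Fin 2)),
      Function.Injective zs → (∀ j, len (zs j) = i) →
      ∀ c : Fin N → (Fin 6 → ℤ) → FreeA K,
        (∑ᶠ n : Fin 6 → ℤ, ∑ j, wComp K (zs j) n * c j n) = 0 →
        ∀ (j : Fin N) (n : Fin 6 → ℤ), (∀ i, 0 ≤ n i) →
          n 0 + n 1 + n 2 = ((FreeMonoid.toList (zs j)).count (0 : Fin 2) : ℤ) →
          n 3 + n 4 + n 5 = ((FreeMonoid.toList (zs j)).count (1 : Fin 2) : ℤ) →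
          c j n = 0) := by
  refine ⟨fun z => ⟨fun n hn h0 h1 hz => ?_, fun c hc n hn h0 h1 => ?_⟩,
    fun i N zs hzs hlen c hc j n hn h0 h1 => ?_⟩
  · obtain ⟨w, hw, hcount⟩ := exists_bm_eq_and_letterCounts_eq z n hn h0 h1
    have h := coeff_wComp_mul (K := K) (by rw [← len_bm, hw] : len w = len z) n 1 1
    rw [hz, if_pos ⟨hw, hcount⟩] at h
    simp [MonoidAlgebra.one_def] at h
  · obtain ⟨w, hw, hcount⟩ := exists_bm_eq_and_letterCounts_eq z n hn h0 h1
    exact eq_zero_of_finsum_wComp_mul_eq_zero (N := 1) (zs := fun _ => z)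
      (Function.injective_of_subsingleton _) (fun _ => rfl) (fun _ => c) (by simpa using hc) 0
      hw hcount
  · obtain ⟨w, hw, hcount⟩ := exists_bm_eq_and_letterCounts_eq (zs j) n hn h0 h1
    exact eq_zero_of_finsum_wComp_mul_eq_zero hzs hlen c hc j hw hcount
end
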